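/- arXiv:2101.02418 — 2 statements merged into one kernel-verified Lean document; each statement's English description precedes it below -/
import Mathlib

section
/- A fully invariant congruence c on F is a cancellable element of the complete lattice 𝓛 of fully invariant congruences on F if and only if c is one of the following five elements: the bottom ⊥ (the equality relation), σ_D, σ_C2, σ_SL, and the top ⊤ (the all relation). (Equivalently, via the anti-isomorphism between 𝓛 and the lattice of monoid varieties: a monoid variety is a cancellable element of the lattice of monoid varieties if and only if it is one of MON, D, C2, SL, T.) -/
/-- The free monoid on countably many generators. -/
abbrev F : Type := FreeMonoid ℕ

/-- The fixed pairwise distinct generators. -/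
def x : F := FreeMonoid.of 0
def y : F := FreeMonoid.of 1
def z : F := FreeMonoid.of 2
def t : F := FreeMonoid.of 3

/-- A congruence on `F` is fully invariant if it is stable under every
monoid endomorphism of `F`. -/
def IsFullyInvariant (c : Con F) : Prop :=
  ∀ ξ : F →* F, ∀ u v : F, c u v → c (ξ u) (ξ v)

/-- The type of fully invariant congruences on `F`. -/
abbrev FICon : Type := {c : Con F // IsFullyInvariant c}

instance : InfSet FICon :=
  ⟨fun S => ⟨sInf (Subtype.val '' S), fun ξ u v h c hc => by
    obtain ⟨d, hd, rfl⟩ := hc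
    exact d.2 ξ u v (h d.1 ⟨d, hd, rfl⟩)⟩⟩

/-- The complete lattice of fully invariant congruences on `F`:
meets are intersections, joins are the smallest fully invariant congruences
containing the union, `⊥` is the equality relation and `⊤` is the all relation. -/
noncomputable instance : CompleteLattice FICon :=
  completeLatticeOfInf FICon (fun S =>
    ⟨fun c hc => fun u v h => h c.1 ⟨c, hc, rfl⟩,
     fun c hc => fun u v h d hd => by
        obtain ⟨e, he, rfl⟩ := hd
        exact hc he h⟩)

/-- `fic S` is the smallest fully invariant congruence on `F` containing the
set `S` of pairs of words. -/
noncomputable def fic (S : Set (F × F)) : FICon :=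
  sInf {c : FICon | ∀ p ∈ S, c.1 p.1 p.2}

/-- The fully invariant congruence corresponding to the variety `SL` of
semilattice monoids. -/
noncomputable def sigmaSL : FICon := fic {(x ^ 2, x), (x * y, y * x)}

/-- The fully invariant congruence corresponding to the variety `C₂`. -/
noncomputable def sigmaC2 : FICon := fic {(x ^ 3, x ^ 2), (x * y, y * x)}

/-- The fully invariant congruence corresponding to the variety `D`. -/
noncomputable def sigmaD : FICon :=
  fic {(x ^ 3, x ^ 2), (x ^ 2 * y, x * y * x), (x * y * x, y * x ^ 2)}

namespace FICon

theorem inf_apply {c d : FICon} {u v : F} : (c ⊓ d).1 u v ↔ c.1 u v ∧ d.1 u v := by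
  refine ⟨fun h => ⟨(inf_le_left : c ⊓ d ≤ c) h, (inf_le_right : c ⊓ d ≤ d) h⟩, fun h => ?_⟩
  have hle : (⟨c.1 ⊓ d.1, fun ξ u v h => ⟨c.2 ξ u v h.1, d.2 ξ u v h.2⟩⟩ : FICon) ≤ c ⊓ d :=
    le_inf (fun u v h => h.1) (fun u v h => h.2)
  exact hle h

theorem fic_le {S : Set (F × F)} {c : FICon} (h : ∀ p ∈ S, c.1 p.1 p.2) : fic S ≤ c :=
  sInf_le h

theorem subset_fic {S : Set (F × F)} {p : F × F} (hp : p ∈ S) : (fic S).1 p.1 p.2 := by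
  rintro _ ⟨d, hd, rfl⟩
  exact hd p hp

/-- The largest fully invariant congruence saturating the set `Q`. -/
def syn (Q : Set F) : FICon :=
  ⟨{ r := fun u v => ∀ (ξ : F →* F) (α β : F), α * ξ u * β ∈ Q ↔ α * ξ v * β ∈ Q
     iseqv := ⟨fun _ _ _ _ => Iff.rfl, fun h ξ α β => (h ξ α β).symm,
      fun h k ξ α β => (h ξ α β).trans (k ξ α β)⟩
     mul' := by
      intro u v u' v' h k ξ α β
      have h1 := h ξ α (ξ u' * β)
      have h2 := k ξ (α * ξ v) β
      simp only [map_mul, mul_assoc] at h1 h2 ⊢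
      exact h1.trans h2 },
    fun η u v h ξ α β => h (ξ.comp η) α β⟩

theorem mem_of_syn {Q : Set F} {u v : F} (h : (syn Q).1 u v) (hu : u ∈ Q) : v ∈ Q := by
  simpa [hu] using h (MonoidHom.id F) 1 1

/-- A fully invariant congruence all of whose pairs respect `Q` is below `syn Q`. -/
theorem le_syn {Q : Set F} {c : FICon} (h : ∀ u v, c.1 u v → u ∈ Q → v ∈ Q) : c ≤ syn Q :=
  fun u v huv ξ α β =>
    have h1 : c.1 (α * ξ u * β) (α * ξ v * β) :=
      c.1.mul (c.1.mul (c.1.refl α) (c.2 ξ u v huv)) (c.1.refl β)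
    ⟨h _ _ h1, h _ _ (c.1.symm h1)⟩

/-- Cancellability of an element of the lattice of fully invariant congruences. -/
def Cancellable (c : FICon) : Prop :=
  ∀ b d : FICon, c ⊔ b = c ⊔ d → c ⊓ b = c ⊓ d → b = d

/-- A cancellable element is not the side of a pentagon built from a set `Q` and its
subset `P`. -/
theorem Cancellable.false_of_pentagon {c : FICon} (hc : Cancellable c) {P Q : Set F}
    {p q r s : F} (hPQ : P ⊆ Q) (hP : ∀ u ∈ P, ∀ v ∈ Q, c.1 u v → v ∈ P)
    (hp : p ∈ P) (hq : q ∉ P) (hpq : (syn Q).1 p q)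
    (hrsP : (syn P).1 r s) (hrsQ : (syn Q).1 r s) (hpr : c.1 p r) (hsq : c.1 s q) : False := by
  set d := syn Q
  set b := syn P ⊓ syn Q
  have hbd : b ≤ d := inf_le_right
  have key : (c ⊓ d) ⊔ b = d ⊓ (c ⊔ b) := by
    apply hc
    · apply le_antisymm
      · exact sup_le le_sup_left (le_sup_of_le_right
          (sup_le (le_inf inf_le_right (inf_le_left.trans le_sup_left))
            (le_inf hbd le_sup_right)))
      · exact sup_le le_sup_left (inf_le_right.trans (sup_le_sup_left le_sup_right c))
    · apply le_antisymm
      · exact inf_le_inf_left c (sup_le (le_inf inf_le_right (inf_le_left.trans le_sup_left))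
            (le_inf hbd le_sup_right))
      · exact le_inf inf_le_left
          ((inf_le_inf_left c inf_le_left).trans le_sup_left)
  have hle : (c ⊓ d) ⊔ b ≤ syn P := by
    refine sup_le (le_syn fun u v huv hu => ?_) inf_le_left
    rw [inf_apply] at huv
    exact hP u hu v (mem_of_syn huv.2 (hPQ hu)) huv.1
  have hmem : (d ⊓ (c ⊔ b)).1 p q := by
    rw [inf_apply]
    refine ⟨hpq, ?_⟩
    have hcb : c ≤ c ⊔ b := le_sup_left
    have hbb : b ≤ c ⊔ b := le_sup_right
    exact (c ⊔ b).1.trans (hcb hpr)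
      ((c ⊔ b).1.trans (hbb (inf_apply.2 ⟨hrsP, hrsQ⟩)) (hcb hsq))
  rw [← key] at hmem
  exact hq (mem_of_syn (hle hmem) hp)

end FICon
/-! ### Words -/

namespace Word

open FreeMonoid

/-- The number of occurrences of the letter `a` in `w`. -/
def cnt (a : ℕ) (w : F) : ℕ := w.toList.count a

@[simp] theorem cnt_one (a : ℕ) : cnt a 1 = 0 := rfl

@[simp] theorem cnt_mul (a : ℕ) (u v : F) : cnt a (u * v) = cnt a u + cnt a v := by
  simp [cnt, toList_mul]

@[simp] theorem cnt_pow (a : ℕ) (u : F) (n : ℕ) : cnt a (u ^ n) = n * cnt a u := by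
  induction n with
  | zero => simp
  | succ n ih => rw [pow_succ, cnt_mul, ih]; ring

theorem cnt_of (a b : ℕ) : cnt a (of b) = if b = a then 1 else 0 := by
  simp [cnt, toList_of, List.count_singleton]

@[simp] theorem cnt_of_self (a : ℕ) : cnt a (of a) = 1 := by simp [cnt_of]

@[simp] theorem cnt_zero_x : cnt 0 x = 1 := rfl
@[simp] theorem cnt_one_x : cnt 1 x = 0 := rfl
@[simp] theorem cnt_zero_y : cnt 0 y = 0 := rfl
@[simp] theorem cnt_one_y : cnt 1 y = 1 := rfl

theorem exists_eq_of_cnt_pos {a : ℕ} {w : F} (h : 0 < cnt a w) :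
    ∃ s t : F, w = s * of a * t ∧ cnt a s = 0 := by
  obtain ⟨s, t, hw, hs⟩ := List.eq_append_cons_of_mem (List.count_pos_iff.1 h)
  exact ⟨ofList s, ofList t, by rw [mul_assoc]; exact hw, List.count_eq_zero.2 hs⟩

@[simp] theorem length_pow (u : F) (n : ℕ) : (u ^ n).length = n * u.length := by
  induction n with
  | zero => simp
  | succ n ih => rw [pow_succ, length_mul, ih]; ring

@[simp] theorem length_x : x.length = 1 := rfl
@[simp] theorem length_y : y.length = 1 := rfl

theorem length_pos {w : F} (h : w ≠ 1) : 0 < w.length :=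
  Nat.pos_of_ne_zero fun h0 => h (length_eq_zero.1 h0)

/-- The endomorphism sending `x` to `X` and all other letters to `Y`. -/
def sub (X Y : F) : F →* F := lift fun i => if i = 0 then X else Y

@[simp] theorem sub_x (X Y : F) : sub X Y x = X := rfl
@[simp] theorem sub_y (X Y : F) : sub X Y y = Y := rfl

/-- The endomorphism erasing all letters that do not satisfy `p`. -/
def keep (p : ℕ → Bool) : F →* F := lift fun i => if p i then of i else 1

theorem toList_keep (p : ℕ → Bool) (w : F) : (keep p w).toList = w.toList.filter p := by
  induction w using FreeMonoid.inductionOn' with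
  | one => rfl
  | of_mul a w ih =>
    rw [map_mul, toList_mul, toList_mul, ih, toList_of, List.singleton_append, List.filter_cons]
    simp only [keep, lift_eval_of]
    split <;> rfl

theorem cnt_keep (p : ℕ → Bool) (a : ℕ) (w : F) :
    cnt a (keep p w) = if p a then cnt a w else 0 := by
  unfold cnt
  rw [toList_keep]
  split_ifs with h
  · exact List.count_filter h
  · exact List.count_eq_zero.2 fun hm => h (List.mem_filter.1 hm).2

/-- The endomorphism sending `a` to `x` and erasing all other letters. -/
def only (a : ℕ) : F →* F := lift fun i => if i = a then x else 1

theorem only_apply (a : ℕ) (w : F) : only a w = x ^ cnt a w := by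
  induction w using FreeMonoid.inductionOn' with
  | one => rfl
  | of_mul b w ih =>
    rw [map_mul, ih, cnt_mul, cnt_of, pow_add]
    congr 1
    simp only [only, lift_eval_of]
    split_ifs <;> simp

end Word

namespace FICon

open Word FreeMonoid

variable {c d : FICon} {u v : F}

theorem pow_cnt (h : c.1 u v) (a : ℕ) : c.1 (x ^ cnt a u) (x ^ cnt a v) := by
  simpa only [only_apply] using c.2 (only a) u v h

theorem pow_subst {i j : ℕ} (h : c.1 (x ^ i) (x ^ j)) (X : F) : c.1 (X ^ i) (X ^ j) := by
  simpa using c.2 (sub X 1) _ _ h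

theorem mul_left (h : c.1 u v) (w : F) : c.1 (w * u) (w * v) := c.1.mul (c.1.refl w) h

theorem mul_right (h : c.1 u v) (w : F) : c.1 (u * w) (v * w) := c.1.mul h (c.1.refl w)

/-- `c` satisfies no identity equating a positive power of a letter with the empty word. -/
def NoGroup (c : FICon) : Prop := ∀ n, 1 ≤ n → ¬ c.1 1 (x ^ n)

/-- `c` satisfies no identity equating a letter with a higher power of itself. -/
def NoReg (c : FICon) : Prop := ∀ n, 2 ≤ n → ¬ c.1 x (x ^ n)

/-- `c` is not commutative. -/
def NoComm (c : FICon) : Prop := ¬ c.1 (x * y) (y * x)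

theorem NoGroup.cnt_eq_zero (hc : c.NoGroup) (h : c.1 u v) {a : ℕ} (hu : cnt a u = 0) :
    cnt a v = 0 := by
  by_contra hv
  have := pow_cnt h a
  rw [hu, pow_zero] at this
  exact hc _ (Nat.one_le_iff_ne_zero.2 hv) this

theorem NoGroup.cnt_eq_zero_iff (hc : c.NoGroup) (h : c.1 u v) (a : ℕ) :
    cnt a u = 0 ↔ cnt a v = 0 :=
  ⟨hc.cnt_eq_zero h, hc.cnt_eq_zero (c.1.symm h)⟩

theorem NoReg.cnt_eq_one (hr : c.NoReg) (hc : c.NoGroup) (h : c.1 u v) {a : ℕ}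
    (hu : cnt a u = 1) : cnt a v = 1 := by
  have h0 : cnt a v ≠ 0 := fun hv => by
    have := (hc.cnt_eq_zero_iff h a).2 hv
    omega
  by_contra h1
  have := pow_cnt h a
  rw [hu, pow_one] at this
  exact hr _ (by omega) this

theorem NoReg.min_cnt (hr : c.NoReg) (hc : c.NoGroup) (h : c.1 u v) (a : ℕ) :
    min 2 (cnt a u) = min 2 (cnt a v) := by
  have h0 := hc.cnt_eq_zero_iff h a
  have h1 := hr.cnt_eq_one hc h (a := a)
  have h2 := hr.cnt_eq_one hc (c.1.symm h) (a := a)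
  omega

/-- The letters occurring exactly once in `w`, in their order of occurrence. -/
def lin (w : F) : List ℕ := w.toList.filter fun a => cnt a w = 1

theorem cubes_absorb (h1 : c.1 (x ^ 3) (x ^ 2)) (hcen : c.1 (x ^ 2 * y) (y * x ^ 2))
    (a : ℕ) (w : F) : c.1 (of a ^ 2 * w) (of a ^ 2 * keep (· ≠ a) w) := by
  induction w using FreeMonoid.inductionOn' with
  | one => exact c.1.refl _
  | of_mul b w ih =>
    rw [map_mul (keep _)]
    by_cases hb : b = a
    · subst hb
      have hk : keep (· ≠ b) (of b) = 1 := by simp [keep]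
      rw [hk, one_mul, ← mul_assoc, ← pow_succ]
      exact c.1.trans (mul_right (pow_subst h1 (of b)) w) ih
    · have hk : keep (· ≠ a) (of b) = of b := by simp [keep, hb]
      have hab : c.1 (of a ^ 2 * of b) (of b * of a ^ 2) := by
        simpa using c.2 (sub (of a) (of b)) _ _ hcen
      rw [hk, ← mul_assoc, ← mul_assoc]
      refine c.1.trans (mul_right hab w) (c.1.trans ?_ (mul_right (c.1.symm hab) _))
      rw [mul_assoc, mul_assoc]
      exact mul_left ih _

theorem extract_square (h1 : c.1 (x ^ 3) (x ^ 2)) (h2 : c.1 (x ^ 2 * y) (x * y * x))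
    (h3 : c.1 (x * y * x) (y * x ^ 2)) {a : ℕ} {w : F} (hw : 2 ≤ cnt a w) :
    c.1 w (of a ^ 2 * keep (· ≠ a) w) := by
  have hcen := c.1.trans h2 h3
  obtain ⟨s, w', rfl, hs⟩ := exists_eq_of_cnt_pos (a := a) (w := w) (by omega)
  obtain ⟨t, r, rfl, -⟩ := exists_eq_of_cnt_pos (a := a) (w := w') (by
    simp [hs] at hw; omega)
  have hk : keep (· ≠ a) (of a) = 1 := by simp [keep]
  have e : keep (· ≠ a) (s * of a * (t * of a * r)) = keep (· ≠ a) (s * (t * r)) := by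
    simp only [map_mul, hk, mul_assoc, one_mul]
  rw [e]
  refine c.1.trans ?_ (cubes_absorb h1 hcen a _)
  have e1 : c.1 (of a * t * of a) (of a ^ 2 * t) := by
    simpa using c.2 (sub (of a) t) _ _ (c.1.symm h2)
  have e2 : c.1 (s * of a ^ 2) (of a ^ 2 * s) := by
    simpa using c.2 (sub (of a) s) _ _ (c.1.symm hcen)
  have e3 := mul_left (mul_right e1 r) s
  have e4 := mul_right e2 (t * r)
  simp only [mul_assoc] at e3 e4 ⊢
  exact c.1.trans e3 e4

theorem extract_squares (h1 : c.1 (x ^ 3) (x ^ 2)) (h2 : c.1 (x ^ 2 * y) (x * y * x))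
    (h3 : c.1 (x * y * x) (y * x ^ 2)) (S : List ℕ) (hS : S.Nodup) (w : F)
    (hw : ∀ a ∈ S, 2 ≤ cnt a w) :
    c.1 w ((S.map fun a => of a ^ 2).prod * keep (· ∉ S) w) := by
  induction S generalizing w with
  | nil =>
    have : keep (· ∉ ([] : List ℕ)) w = w := by
      apply toList.injective
      rw [toList_keep]
      simp
    rw [this]
    simpa using c.1.refl w
  | cons a S ih =>
    rw [List.nodup_cons] at hS
    have e1 := extract_square h1 h2 h3 (hw a (by simp))
    have e2 := ih hS.2 (keep (· ≠ a) w) (fun b hb => by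
      have hba : b ≠ a := fun h => hS.1 (h ▸ hb)
      rw [cnt_keep, if_pos (by simpa using hba)]
      exact hw b (by simp [hb]))
    have e3 : keep (· ∉ S) (keep (· ≠ a) w) = keep (· ∉ a :: S) w := by
      apply toList.injective
      rw [toList_keep, toList_keep, toList_keep, List.filter_filter]
      congr 1
      funext b
      simp [Bool.and_comm]
    rw [e3] at e2
    rw [List.map_cons, List.prod_cons, mul_assoc]
    exact c.1.trans e1 (mul_left e2 _)

/-- The solution of the word problem for `σ_D`, in one direction. -/
theorem rel_of_lin_eq (h1 : c.1 (x ^ 3) (x ^ 2)) (h2 : c.1 (x ^ 2 * y) (x * y * x))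
    (h3 : c.1 (x * y * x) (y * x ^ 2)) (hm : ∀ a, min 2 (cnt a u) = min 2 (cnt a v))
    (hl : lin u = lin v) : c.1 u v := by
  set S : List ℕ := u.toList.dedup.filter (fun a => 2 ≤ cnt a u) with hS
  have hmem : ∀ a, a ∈ S ↔ 2 ≤ cnt a u := fun a => by
    simp only [hS, List.mem_filter, List.mem_dedup, decide_eq_true_eq, and_iff_right_iff_imp]
    intro h
    exact List.count_pos_iff.1 (by unfold cnt at h; omega)
  have hnd : S.Nodup := (List.nodup_dedup _).filter _
  have hkeep : ∀ w : F, (∀ a, min 2 (cnt a u) = min 2 (cnt a w)) →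
      keep (· ∉ S) w = ofList (lin w) := fun w hw => by
    apply toList.injective
    rw [toList_keep, toList_ofList]
    apply List.filter_congr
    intro a ha
    have hpos : 0 < cnt a w := List.count_pos_iff.2 ha
    have := hw a
    have := hmem a
    rw [decide_eq_decide, this]
    omega
  have eu := extract_squares h1 h2 h3 S hnd u (fun a ha => (hmem a).1 ha)
  have ev := extract_squares h1 h2 h3 S hnd v (fun a ha => by
    have := (hmem a).1 ha
    have := hm a
    omega)
  rw [hkeep u (fun _ => rfl)] at eu
  rw [hkeep v hm, ← hl] at ev
  exact c.1.trans eu (c.1.symm ev)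

theorem sigmaD_le_iff : sigmaD ≤ c ↔
    c.1 (x ^ 3) (x ^ 2) ∧ c.1 (x ^ 2 * y) (x * y * x) ∧ c.1 (x * y * x) (y * x ^ 2) := by
  constructor
  · intro h
    exact ⟨h (subset_fic (p := (_, _)) (by simp)), h (subset_fic (p := (_, _)) (by simp)),
      h (subset_fic (p := (_, _)) (by simp))⟩
  · rintro ⟨h1, h2, h3⟩
    apply fic_le
    simp only [Set.mem_insert_iff, Set.mem_singleton_iff]
    rintro p (rfl | rfl | rfl) <;> assumption

theorem sigmaC2_le_iff : sigmaC2 ≤ c ↔ c.1 (x ^ 3) (x ^ 2) ∧ c.1 (x * y) (y * x) := by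
  constructor
  · intro h
    exact ⟨h (subset_fic (p := (_, _)) (by simp)), h (subset_fic (p := (_, _)) (by simp))⟩
  · rintro ⟨h1, h2⟩
    apply fic_le
    simp only [Set.mem_insert_iff, Set.mem_singleton_iff]
    rintro p (rfl | rfl) <;> assumption

theorem sigmaSL_le_iff : sigmaSL ≤ c ↔ c.1 (x ^ 2) x ∧ c.1 (x * y) (y * x) := by
  constructor
  · intro h
    exact ⟨h (subset_fic (p := (_, _)) (Or.inl rfl)), h (subset_fic (p := (_, _)) (Or.inr rfl))⟩
  · rintro ⟨h1, h2⟩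
    apply fic_le
    simp only [Set.mem_insert_iff, Set.mem_singleton_iff]
    rintro p (rfl | rfl) <;> assumption

theorem rel_comm (h : c.1 (x * y) (y * x)) (u v : F) : c.1 (u * v) (v * u) := by
  simpa using c.2 (sub u v) _ _ h

theorem rel_of_perm (h : c.1 (x * y) (y * x)) (huv : u.toList.Perm v.toList) : c.1 u v := by
  suffices ∀ l l' : List ℕ, l.Perm l' → c.1 (ofList l) (ofList l') from this _ _ huv
  intro l l' hl
  induction hl with
  | nil => exact c.1.refl _
  | cons a _ ih => exact mul_left ih (of a)
  | swap a b l => exact mul_right (rel_comm h (of b) (of a)) (ofList l)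
  | trans _ _ ih1 ih2 => exact c.1.trans ih1 ih2

theorem sigmaD_le_sigmaC2 : sigmaD ≤ sigmaC2 := by
  obtain ⟨h1, h2⟩ := sigmaC2_le_iff.1 le_rfl
  refine sigmaD_le_iff.2 ⟨h1, ?_, ?_⟩
  · have := mul_left (rel_comm h2 x y) x
    rwa [← mul_assoc, ← mul_assoc, ← pow_two] at this
  · have := mul_right (rel_comm h2 x y) x
    rwa [mul_assoc y, ← pow_two] at this

theorem sigmaC2_le_sigmaSL : sigmaC2 ≤ sigmaSL := by
  obtain ⟨h1, h2⟩ := sigmaSL_le_iff.1 le_rfl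
  refine sigmaC2_le_iff.2 ⟨?_, h2⟩
  have := mul_left h1 x
  rwa [← pow_succ', ← pow_two] at this

end FICon

/-! ### Locating a fully invariant congruence with respect to `σ_D`, `σ_C2` and `σ_SL` -/

/-- Two duplicate-free lists with the same members coincide as soon as they order every pair
of distinct members in the same way. -/
theorem List.eq_of_filter_pair_eq {l l' : List ℕ} (hl : l.Nodup) (hl' : l'.Nodup)
    (hm : ∀ a, a ∈ l ↔ a ∈ l')
    (h : ∀ a ∈ l, ∀ b ∈ l, a ≠ b →
      l.filter (fun i => i = a ∨ i = b) = l'.filter (fun i => i = a ∨ i = b)) : l = l' := by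
  induction l generalizing l' with
  | nil => exact (List.eq_nil_iff_forall_not_mem.2 fun a ha => by simpa using (hm a).2 ha).symm
  | cons a l ih =>
    cases l' with
    | nil => simpa using (hm a).1 (by simp)
    | cons a' l' =>
      have haa : a = a' := by
        by_contra hne
        have := h a (by simp) a' ((hm a').2 (by simp)) hne
        simp at this
        exact hne this.1
      subst haa
      rw [List.nodup_cons] at hl hl'
      congr 1
      refine ih hl.2 hl'.2 (fun b => ?_) (fun b hb b' hb' hne => ?_)
      · have := hm b
        simp only [List.mem_cons] at this
        by_cases hba : b = a
        · subst hba; simp [hl.1, hl'.1]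
        · simpa [hba] using this
      · have := h b (by simp [hb]) b' (by simp [hb']) hne
        have h1 : a ≠ b := fun e => hl.1 (e ▸ hb)
        have h2 : a ≠ b' := fun e => hl.1 (e ▸ hb')
        simpa [h1, h2] using this

namespace FICon

open Word FreeMonoid

variable {b c d : FICon} {u v : F}

theorem mem_lin {a : ℕ} : a ∈ lin u ↔ cnt a u = 1 := by
  simp only [lin, List.mem_filter, decide_eq_true_eq, and_iff_right_iff_imp]
  intro h
  exact List.count_pos_iff.1 (by unfold cnt at h; omega)

theorem nodup_lin (u : F) : (lin u).Nodup := by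
  rw [List.nodup_iff_count_le_one]
  intro a
  by_cases ha : a ∈ lin u
  · have h1 := mem_lin.1 ha
    exact ((List.filter_sublist (l := u.toList)).count_le a).trans h1.le
  · rw [List.count_eq_zero.2 ha]; omega

theorem filter_lin {a b : ℕ} (ha : a ∈ lin u) (hb : b ∈ lin u) :
    (lin u).filter (fun i => i = a ∨ i = b) = (keep (fun i => i = a ∨ i = b) u).toList := by
  rw [toList_keep, lin, List.filter_filter]
  apply List.filter_congr
  intro i _
  rw [mem_lin] at ha hb
  by_cases h : i = a ∨ i = b
  · rcases h with rfl | rfl <;> simp [ha, hb]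
  · simp [h]

theorem keep_pair {a b : ℕ} (hab : a ≠ b) (ha : a ∈ lin u) (hb : b ∈ lin u) :
    keep (fun i => i = a ∨ i = b) u = of a * of b ∨
      keep (fun i => i = a ∨ i = b) u = of b * of a := by
  have hp : (keep (fun i => i = a ∨ i = b) u).toList.Perm [a, b] := by
    rw [List.perm_iff_count]
    intro i
    have := cnt_keep (fun i => decide (i = a ∨ i = b)) i u
    unfold cnt at this
    rw [mem_lin] at ha hb
    unfold cnt at ha hb
    rw [this]
    by_cases h : i = a ∨ i = b
    · rcases h with rfl | rfl <;> simp [ha, hb, hab, hab.symm]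
    · push Not at h
      simp [h.1, h.2, h.1.symm, h.2.symm]
  have := List.mem_permutations'.2 hp
  simp only [List.permutations', List.flatMap_cons, List.flatMap_nil, List.permutations'Aux,
    List.append_nil, List.map_cons, List.map_nil, List.mem_cons, List.not_mem_nil, or_false] at this
  exact this.imp (fun e => toList.injective e) (fun e => toList.injective e)

theorem le_sigmaD (hg : b.NoGroup) (hr : b.NoReg) (hn : b.NoComm) : b ≤ sigmaD := by
  intro u v h
  obtain ⟨h1, h2, h3⟩ := sigmaD_le_iff.1 le_rfl
  have hm := hr.min_cnt hg h
  have hmem : ∀ a, a ∈ lin u ↔ a ∈ lin v := fun a => by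
    have := hm a
    rw [mem_lin, mem_lin]
    omega
  refine rel_of_lin_eq h1 h2 h3 hm
    (List.eq_of_filter_pair_eq (nodup_lin u) (nodup_lin v) hmem fun i hi j hj hij => ?_)
  rw [filter_lin hi hj, filter_lin ((hmem i).1 hi) ((hmem j).1 hj)]
  congr 1
  have hk := b.2 (keep fun a => a = i ∨ a = j) u v h
  have hn1 : ∀ k l : ℕ, k ≠ l → ¬ b.1 (of k * of l) (of l * of k) := fun k l hkl hc => hn (by
    have := b.2 (lift fun a => if a = k then x else y) _ _ hc
    simpa [hkl.symm] using this)
  rcases keep_pair hij hi hj with e | e <;>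
    rcases keep_pair hij ((hmem i).1 hi) ((hmem j).1 hj) with e' | e' <;> rw [e, e'] at hk ⊢
  · exact absurd hk (hn1 i j hij)
  · exact absurd hk (hn1 j i hij.symm)

/-- Moving the linear letters to the front, any identity that preserves the set of linear
letters becomes an identity of `σ_D`. -/
theorem exists_perm_sigmaD (hm : ∀ a, min 2 (cnt a u) = min 2 (cnt a v)) :
    ∃ u' v' : F, u.toList.Perm u'.toList ∧ v.toList.Perm v'.toList ∧ sigmaD.1 u' v' := by
  have hmem : ∀ a, a ∈ lin u ↔ a ∈ lin v := fun a => by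
    have := hm a
    rw [mem_lin, mem_lin]
    omega
  have key : ∀ w : F, (∀ a, a ∈ lin u ↔ a ∈ lin w) → ∃ w' : F, w.toList.Perm w'.toList ∧
      (∀ a, cnt a w' = cnt a w) ∧ lin w' = lin u := by
    intro w hw
    have hp : w.toList.Perm (lin u ++ w.toList.filter fun a => ¬ cnt a w = 1) := by
      have h1 : (lin u).Perm (lin w) := (List.perm_ext_iff_of_nodup (nodup_lin u) (nodup_lin w)).2 hw
      refine List.Perm.trans ?_ (h1.symm.append_right _)
      have := List.filter_append_perm (fun a => decide (cnt a w = 1)) w.toList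
      simpa [lin] using this.symm
    have hc : ∀ a, cnt a (ofList (lin u ++ w.toList.filter fun a => ¬ cnt a w = 1)) = cnt a w :=
      fun a => (hp.count_eq a).symm
    refine ⟨ofList (lin u ++ w.toList.filter fun a => ¬ cnt a w = 1), hp, hc, ?_⟩
    rw [lin]
    simp only [hc, toList_ofList, List.filter_append, List.filter_filter]
    have e1 : (lin u).filter (fun a => decide (cnt a w = 1)) = lin u :=
      List.filter_eq_self.2 fun a ha => by simpa using mem_lin.1 ((hw a).1 ha)
    rw [e1]
    simp
  obtain ⟨u', hu, hcu, hlu⟩ := key u fun _ => Iff.rfl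
  obtain ⟨v', hv, hcv, hlv⟩ := key v hmem
  obtain ⟨h1, h2, h3⟩ := sigmaD_le_iff.1 le_rfl
  exact ⟨u', v', hu, hv, rel_of_lin_eq h1 h2 h3 (fun a => by rw [hcu, hcv, hm]) (by rw [hlu, hlv])⟩

theorem le_sigmaC2 (hg : b.NoGroup) (hr : b.NoReg) : b ≤ sigmaC2 := by
  intro u v h
  obtain ⟨u', v', hu, hv, h'⟩ := exists_perm_sigmaD (hr.min_cnt hg h)
  have hcomm := (sigmaC2_le_iff.1 le_rfl).2
  exact sigmaC2.1.trans (rel_of_perm hcomm hu)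
    (sigmaC2.1.trans (sigmaD_le_sigmaC2 h') (sigmaC2.1.symm (rel_of_perm hcomm hv)))

/-- Words with the same content and without linear letters are `σ_D`-related. -/
theorem sigmaD_of_cnt
    (h : ∀ a, (cnt a u = 0 ∧ cnt a v = 0) ∨ (2 ≤ cnt a u ∧ 2 ≤ cnt a v)) : sigmaD.1 u v := by
  obtain ⟨h1, h2, h3⟩ := sigmaD_le_iff.1 le_rfl
  have hu : lin u = [] := List.eq_nil_iff_forall_not_mem.2 fun a ha => by
    have := mem_lin.1 ha
    have := h a
    omega
  have hv : lin v = [] := List.eq_nil_iff_forall_not_mem.2 fun a ha => by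
    have := mem_lin.1 ha
    have := h a
    omega
  refine rel_of_lin_eq h1 h2 h3 (fun a => ?_) (by rw [hu, hv])
  have := h a
  omega

theorem sigmaD_pow (h : ∀ a, cnt a u = 0 ↔ cnt a v = 0) {n : ℕ} (hn : 2 ≤ n) :
    sigmaD.1 (u ^ n) (v ^ n) := by
  refine sigmaD_of_cnt fun a => ?_
  simp only [cnt_pow]
  by_cases h0 : cnt a u = 0
  · left
    simp [h0, (h a).1 h0]
  · have h1 := mt (h a).2 h0
    exact Or.inr ⟨hn.trans (Nat.le_mul_of_pos_right n (Nat.pos_of_ne_zero h0)),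
      hn.trans (Nat.le_mul_of_pos_right n (Nat.pos_of_ne_zero h1))⟩

theorem le_sigmaSL (hg : b.NoGroup) : b ≤ sigmaSL := by
  intro u v h
  have h2 : ∀ w, sigmaSL.1 (w ^ 2) w := fun w => by
    simpa using sigmaSL.2 (sub w 1) _ _ (sigmaSL_le_iff.1 le_rfl).1
  have h' := sigmaC2_le_sigmaSL
    (sigmaD_le_sigmaC2 (sigmaD_pow (hg.cnt_eq_zero_iff h) (le_refl 2)))
  exact sigmaSL.1.trans (sigmaSL.1.symm (h2 u)) (sigmaSL.1.trans h' (h2 v))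

theorem NoGroup.mono (h : b ≤ c) (hc : c.NoGroup) : b.NoGroup := fun n hn hb => hc n hn (h hb)

theorem NoReg.mono (h : b ≤ c) (hc : c.NoReg) : b.NoReg := fun n hn hb => hc n hn (h hb)

theorem NoComm.mono (h : b ≤ c) (hc : c.NoComm) : b.NoComm := fun hb => hc (h hb)

theorem mul_eq_one {u v : F} : u * v = 1 ↔ u = 1 ∧ v = 1 := by
  simp only [← length_eq_zero, length_mul]
  omega

theorem noGroup_sigmaSL : sigmaSL.NoGroup := by
  have hle : sigmaSL ≤ syn {1} := by
    refine sigmaSL_le_iff.2 ⟨fun ξ α β => ?_, fun ξ α β => ?_⟩ <;>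
      simp only [Set.mem_singleton_iff, map_mul, pow_two, mul_eq_one] <;> tauto
  intro n hn h
  have := congrArg FreeMonoid.length (mem_of_syn (Q := {1}) (hle h) rfl : x ^ n = 1)
  simp at this
  omega

theorem noReg_sigmaC2 : sigmaC2.NoReg := by
  have hx : ∀ u w v : F, ∀ n, 2 ≤ n → u * w ^ n * v = x → w = 1 := fun u w v n hn e => by
    have := congrArg FreeMonoid.length e
    simp only [length_mul, length_pow, length_x] at this
    by_contra hw
    have := length_pos hw
    nlinarith
  have hle : sigmaC2 ≤ syn {x} := by
    refine sigmaC2_le_iff.2 ⟨fun ξ α β => ?_, fun ξ α β => ?_⟩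
    · simp only [Set.mem_singleton_iff, map_pow]
      constructor <;> intro h
      · have e := hx _ _ _ 3 (by omega) h
        simpa [e] using h
      · have e := hx _ _ _ 2 (by omega) h
        simpa [e] using h
    · have key : ∀ u v : F, α * (u * v) * β = x → α * (v * u) * β = x := fun u v h => by
        have hl := congrArg FreeMonoid.length h
        simp only [length_mul, length_x] at hl
        rcases Nat.eq_zero_or_pos u.length with h0 | h0
        · rw [length_eq_zero] at h0; subst h0; simpa using h
        · have h1 : v.length = 0 := by omega
          rw [length_eq_zero] at h1; subst h1; simpa using h
      simp only [Set.mem_singleton_iff, map_mul]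
      exact ⟨key _ _, key _ _⟩
  intro n hn h
  have := congrArg FreeMonoid.length (mem_of_syn (Q := {x}) (hle h) rfl : x ^ n = x)
  simp at this
  omega

theorem xy_ne_yx : x * y ≠ y * x := by
  intro h
  have := congrArg toList h
  simp [x, y] at this

theorem noComm_sigmaD : sigmaD.NoComm := by
  have hl : ∀ Z : F, ∀ w α β : F, (∀ a, 2 * cnt a Z ≤ cnt a w) → α * w * β = x * y → Z = 1 := by
    intro Z w α β hZ h
    rw [← length_eq_zero]
    by_contra h0
    obtain ⟨a, ha⟩ := List.exists_mem_of_ne_nil Z.toList (fun e => h0 (congrArg List.length e))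
    have ha : 0 < cnt a Z := List.count_pos_iff.2 ha
    have h1 := hZ a
    have h2 := congrArg (cnt a) h
    simp only [cnt_mul] at h2
    have h3 : cnt a x + cnt a y ≤ 1 := by
      unfold x y; rw [cnt_of, cnt_of]; split_ifs <;> omega
    omega
  have hle : sigmaD ≤ syn {x * y} := by
    refine sigmaD_le_iff.2 ⟨fun ξ α β => ?_, fun ξ α β => ?_, fun ξ α β => ?_⟩ <;>
    · simp only [Set.mem_singleton_iff, map_pow, map_mul]
      constructor <;> intro h <;>
      · have e := hl (ξ x) _ _ _ (fun a => by simp only [cnt_mul, cnt_pow]; omega) h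
        simpa [e] using h
  intro h
  exact xy_ne_yx (mem_of_syn (Q := {x * y}) (hle h) rfl : y * x = x * y).symm

end FICon

/-! ### The congruences `σ_D`, `σ_C2` and `σ_SL` are cancellable -/

namespace FICon

open Word FreeMonoid

variable {b c d : FICon} {u v : F}

theorem rel_of_inf_eq (h : c ⊓ b = c ⊓ d) (hc : c.1 u v) (hb : b.1 u v) : d.1 u v :=
  (inf_apply.1 (h ▸ inf_apply.2 ⟨hc, hb⟩ : (c ⊓ d).1 u v)).2

theorem le_of_not_noGroup (hD : sigmaD ≤ c) (h : c ⊓ b = c ⊓ d) (hd : ¬ d.NoGroup) :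
    b ≤ d := by
  intro u v huv
  simp only [NoGroup, not_forall, not_not] at hd
  obtain ⟨n, hn, hxn⟩ := hd
  have hW : d.1 1 (((u * v) ^ 2) ^ n) := by
    simpa using pow_subst (i := 0) hxn ((u * v) ^ 2)
  set W := ((u * v) ^ 2) ^ n with hWdef
  have hcW : ∀ a, cnt a W = n * (2 * (cnt a u + cnt a v)) := fun a => by
    rw [hWdef, cnt_pow, cnt_pow, cnt_mul]
  have hDW : sigmaD.1 (W * u) (W * v) := by
    refine sigmaD_of_cnt fun a => ?_
    rw [cnt_mul, cnt_mul, hcW]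
    have : 2 * (cnt a u + cnt a v) ≤ n * (2 * (cnt a u + cnt a v)) :=
      Nat.le_mul_of_pos_left _ hn
    by_cases h0 : cnt a u + cnt a v = 0
    · left
      rw [h0]
      omega
    · right
      omega
  have hdW := rel_of_inf_eq h (hD hDW) (mul_left huv W)
  have hu := mul_right hW u
  have hv := mul_right hW v
  rw [one_mul] at hu hv
  exact d.1.trans hu (d.1.trans hdW (d.1.symm hv))

theorem le_of_not_noReg (hD : sigmaD ≤ c) (h : c ⊓ b = c ⊓ d) (hb : b.NoGroup)
    (hd : ¬ d.NoReg) : b ≤ d := by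
  intro u v huv
  simp only [NoReg, not_forall, not_not] at hd
  obtain ⟨n, hn, hxn⟩ := hd
  have hp : ∀ w, d.1 w (w ^ n) := fun w => by
    simpa using pow_subst (i := 1) (by simpa using hxn) w
  have hd := rel_of_inf_eq h (hD (sigmaD_pow (hb.cnt_eq_zero_iff huv) hn)) (b.1.pow n huv)
  exact d.1.trans (hp u) (d.1.trans hd (d.1.symm (hp v)))

theorem le_of_not_noComm (h : sigmaD ⊓ b = sigmaD ⊓ d) (hg : b.NoGroup) (hr : b.NoReg)
    (hb : ¬ b.NoComm) (hd : ¬ d.NoComm) : b ≤ d := by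
  intro u v huv
  obtain ⟨u', v', hu, hv, h'⟩ := exists_perm_sigmaD (hr.min_cnt hg huv)
  have hb := not_not.1 hb
  have hd := not_not.1 hd
  have := rel_of_inf_eq h h' (b.1.trans (b.1.symm (rel_of_perm hb hu))
    (b.1.trans huv (rel_of_perm hb hv)))
  exact d.1.trans (rel_of_perm hd hu) (d.1.trans this (d.1.symm (rel_of_perm hd hv)))

theorem le_of_le (h : c ⊓ b = c ⊓ d) (hb : b ≤ c) : b ≤ d :=
  (le_inf hb le_rfl).trans (h.le.trans inf_le_right)

theorem le_of_sup_eq {e : FICon} (h : c ⊔ b = c ⊔ d) (hc : c ≤ e) (hb : b ≤ e) : d ≤ e :=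
  le_sup_right.trans (h.ge.trans (sup_le hc hb))

theorem noGroup_of_sup_eq (h : c ⊔ b = c ⊔ d) (hc : c ≤ sigmaSL) (hb : b.NoGroup) :
    d.NoGroup :=
  noGroup_sigmaSL.mono (le_of_sup_eq h hc (le_sigmaSL hb))

theorem noReg_of_sup_eq (h : c ⊔ b = c ⊔ d) (hc : c ≤ sigmaC2) (hg : b.NoGroup)
    (hr : b.NoReg) : d.NoReg :=
  noReg_sigmaC2.mono (le_of_sup_eq h hc (le_sigmaC2 hg hr))

theorem sigmaSL_le_of_sup_inf_eq (hs : sigmaSL ⊔ b = sigmaSL ⊔ d)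
    (hi : sigmaSL ⊓ b = sigmaSL ⊓ d) : b ≤ d := by
  by_cases hd : d.NoGroup
  · exact le_of_le hi (le_sigmaSL (noGroup_of_sup_eq hs.symm le_rfl hd))
  · exact le_of_not_noGroup (sigmaD_le_sigmaC2.trans sigmaC2_le_sigmaSL) hi hd

theorem sigmaC2_le_of_sup_inf_eq (hs : sigmaC2 ⊔ b = sigmaC2 ⊔ d)
    (hi : sigmaC2 ⊓ b = sigmaC2 ⊓ d) : b ≤ d := by
  by_cases hd : d.NoGroup
  · have hb := noGroup_of_sup_eq hs.symm sigmaC2_le_sigmaSL hd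
    by_cases hd' : d.NoReg
    · exact le_of_le hi (le_sigmaC2 hb (noReg_of_sup_eq hs.symm le_rfl hd hd'))
    · exact le_of_not_noReg sigmaD_le_sigmaC2 hi hb hd'
  · exact le_of_not_noGroup sigmaD_le_sigmaC2 hi hd

theorem sigmaD_le_of_sup_inf_eq (hs : sigmaD ⊔ b = sigmaD ⊔ d)
    (hi : sigmaD ⊓ b = sigmaD ⊓ d) : b ≤ d := by
  by_cases hd : d.NoGroup
  · have hb := noGroup_of_sup_eq hs.symm (sigmaD_le_sigmaC2.trans sigmaC2_le_sigmaSL) hd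
    by_cases hd' : d.NoReg
    · have hb' := noReg_of_sup_eq hs.symm sigmaD_le_sigmaC2 hd hd'
      by_cases hbc : b.NoComm
      · exact le_of_le hi (le_sigmaD hb hb' hbc)
      · refine le_of_not_noComm hi hb hb' hbc fun hdc => hbc ?_
        exact noComm_sigmaD.mono (le_of_sup_eq hs.symm le_rfl (le_sigmaD hd hd' hdc))
    · exact le_of_not_noReg le_rfl hi hb hd'
  · exact le_of_not_noGroup le_rfl hi hd

theorem cancellable_sigmaSL : Cancellable sigmaSL := fun _ _ hs hi =>
  le_antisymm (sigmaSL_le_of_sup_inf_eq hs hi) (sigmaSL_le_of_sup_inf_eq hs.symm hi.symm)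

theorem cancellable_sigmaC2 : Cancellable sigmaC2 := fun _ _ hs hi =>
  le_antisymm (sigmaC2_le_of_sup_inf_eq hs hi) (sigmaC2_le_of_sup_inf_eq hs.symm hi.symm)

theorem cancellable_sigmaD : Cancellable sigmaD := fun _ _ hs hi =>
  le_antisymm (sigmaD_le_of_sup_inf_eq hs hi) (sigmaD_le_of_sup_inf_eq hs.symm hi.symm)

end FICon

/-! ### Commutation of powers, and balanced identities -/

/-- Two lists coincide as soon as they coincide after deleting all but any two members. -/
theorem List.eq_of_forall_filter_pair_eq {l l' : List ℕ}
    (h : ∀ a b, l.filter (fun i => i = a ∨ i = b) = l'.filter (fun i => i = a ∨ i = b)) :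
    l = l' := by
  induction l generalizing l' with
  | nil =>
    cases l' with
    | nil => rfl
    | cons a' l' => simpa using h a' a'
  | cons a l ih =>
    cases l' with
    | nil => simpa using h a a
    | cons a' l' =>
      have haa : a = a' := by
        have := h a a'
        simp at this
        exact this.1
      subst haa
      congr 1
      refine ih fun b b' => ?_
      have := h b b'
      rw [List.filter_cons, List.filter_cons] at this
      split_ifs at this
      · exact (List.cons.inj this).2
      · exact this

namespace Word

open FreeMonoid

/-- The words in the two letters `x` and `y`. -/
def binary : Submonoid F := Submonoid.closure {x, y}

theorem x_mem_binary : x ∈ binary := Submonoid.subset_closure (by simp)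

theorem y_mem_binary : y ∈ binary := Submonoid.subset_closure (by simp)

theorem binary_induction {p : F → Prop} (one : p 1) (hx : p x) (hy : p y)
    (mul : ∀ u v, p u → p v → p (u * v)) {w : F} (hw : w ∈ binary) : p w := by
  refine Submonoid.closure_induction (motive := fun w _ => p w) ?_ one (fun u v _ _ => mul u v) hw
  rintro w (rfl | rfl)
  · exact hx
  · exact hy

variable {w : F} {ξ : F →* F}

theorem binary_map_of_y (hw : w ∈ binary) (h : ξ y = 1) : ξ w = ξ x ^ cnt 0 w := by
  refine binary_induction (p := fun w => ξ w = ξ x ^ cnt 0 w) ?_ ?_ ?_ ?_ hw <;>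
    simp +contextual [h, pow_add]

theorem binary_map_of_x (hw : w ∈ binary) (h : ξ x = 1) : ξ w = ξ y ^ cnt 1 w := by
  refine binary_induction (p := fun w => ξ w = ξ y ^ cnt 1 w) ?_ ?_ ?_ ?_ hw <;>
    simp +contextual [h, pow_add]

theorem binary_map_self (hw : w ∈ binary) (hx : ξ x = x) (hy : ξ y = y) : ξ w = w := by
  refine binary_induction (p := fun w => ξ w = w) ?_ ?_ ?_ ?_ hw <;>
    simp +contextual [hx, hy]

theorem binary_length_map (ξ : F →* F) (hw : w ∈ binary) :
    (ξ w).length = cnt 0 w * (ξ x).length + cnt 1 w * (ξ y).length := by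
  refine binary_induction
    (p := fun w => (ξ w).length = cnt 0 w * (ξ x).length + cnt 1 w * (ξ y).length)
    ?_ ?_ ?_ (fun u v hu hv => ?_) hw
  · simp
  · simp
  · simp
  · rw [map_mul, length_mul, hu, hv, cnt_mul, cnt_mul]; ring

theorem binary_cnt_map (ξ : F →* F) (a : ℕ) (hw : w ∈ binary) :
    cnt a (ξ w) = cnt 0 w * cnt a (ξ x) + cnt 1 w * cnt a (ξ y) := by
  refine binary_induction
    (p := fun w => cnt a (ξ w) = cnt 0 w * cnt a (ξ x) + cnt 1 w * cnt a (ξ y))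
    ?_ ?_ ?_ (fun u v hu hv => ?_) hw
  · simp
  · simp
  · simp
  · rw [map_mul, cnt_mul, hu, hv, cnt_mul, cnt_mul]; ring

theorem binary_length (hw : w ∈ binary) : w.length = cnt 0 w + cnt 1 w := by
  simpa using binary_length_map (MonoidHom.id F) hw

/-- The endomorphism renaming `a` to `x` and `b` to `y`, and erasing all other letters. -/
def rename (a b : ℕ) : F →* F := lift fun i => if i = a then x else if i = b then y else 1

theorem rename_mem_binary (a b : ℕ) (w : F) : rename a b w ∈ binary := by
  induction w using FreeMonoid.inductionOn' with
  | one => exact one_mem _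
  | of_mul i w ih =>
    rw [map_mul]
    refine mul_mem ?_ ih
    simp only [rename, lift_eval_of]
    split_ifs
    · exact x_mem_binary
    · exact y_mem_binary
    · exact one_mem _

theorem sub_rename (a b : ℕ) (w : F) :
    sub (of a) (of b) (rename a b w) = keep (fun i => i = a ∨ i = b) w := by
  have : (sub (of a) (of b)).comp (rename a b) = keep fun i => i = a ∨ i = b := by
    refine FreeMonoid.hom_eq fun i => ?_
    simp only [MonoidHom.comp_apply, rename, keep, lift_eval_of]
    split_ifs <;> simp_all
  exact DFunLike.congr_fun this w

end Word

namespace FICon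

open Word FreeMonoid

variable {c : FICon} {u v : F}

theorem Cancellable.pow_central (hc : Cancellable c) {i j : ℕ} (hi : 1 ≤ i) (hij : i < j)
    (h : c.1 (x ^ i) (x ^ j)) : c.1 (x ^ i * y) (y * x ^ i) := by
  by_contra hn
  have hlen : ∀ u ∈ ({x ^ i * y, y * x ^ i} : Set F), u.length = i + 1 := by
    rintro u (rfl | rfl) <;> simp [length_mul, add_comm]
  have hcnt : ∀ u ∈ ({x ^ i * y, y * x ^ i} : Set F), cnt 0 u = i ∧ cnt 1 u = 1 := by
    rintro u (rfl | rfl) <;> simp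
  have hsub : ({x ^ i * y} : Set F) ⊆ {x ^ i * y, y * x ^ i} := by simp
  -- The only nontrivial images of the sides of the identity that lie in the set.
  have key : ∀ W X Y α β : F, X ≠ 1 → Y ≠ 1 → W.length = i * X.length + Y.length →
      (∀ a, cnt a W = i * cnt a X + cnt a Y) →
      α * W * β ∈ ({x ^ i * y, y * x ^ i} : Set F) →
      α = 1 ∧ β = 1 ∧ (X = x ∧ Y = y ∨ i = 1 ∧ X = y ∧ Y = x) := by
    intro W X Y α β hX hY hW hWc hm
    have hl := hlen _ hm
    obtain ⟨h0, h1⟩ := hcnt _ hm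
    have hX' := length_pos hX
    have hY' := length_pos hY
    simp only [length_mul, hW] at hl
    have hXl : X.length = 1 := by nlinarith
    rw [hXl] at hl
    have hYl : Y.length = 1 := by omega
    have hα : α = 1 := length_eq_zero.1 (by omega)
    have hβ : β = 1 := length_eq_zero.1 (by omega)
    obtain ⟨a, rfl⟩ := length_eq_one.1 hXl
    obtain ⟨b, rfl⟩ := length_eq_one.1 hYl
    refine ⟨hα, hβ, ?_⟩
    simp only [cnt_mul, hα, hβ, cnt_one, hWc, cnt_of] at h0 h1
    by_cases ha0 : a = 0
    · subst ha0
      by_cases hb : b = 1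
      · left; exact ⟨rfl, congrArg of hb⟩
      · simp [hb] at h1
    · by_cases hb0 : b = 0
      · subst hb0
        simp [ha0] at h0
        subst h0
        by_cases ha : a = 1
        · right; exact ⟨rfl, congrArg of ha, rfl⟩
        · simp [ha] at h1
      · simp [ha0, hb0] at h0
        omega
  have hfar : ∀ X Y α β W : F, X ≠ 1 → Y ≠ 1 → W.length = j * X.length + Y.length →
      α * W * β ∉ ({x ^ i * y, y * x ^ i} : Set F) := by
    intro X Y α β W hX hY hW hm
    have hl := hlen _ hm
    have hX' := length_pos hX
    have hY' := length_pos hY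
    simp only [length_mul, hW] at hl
    nlinarith
  refine hc.false_of_pentagon (P := {x ^ i * y}) (Q := {x ^ i * y, y * x ^ i})
    (p := x ^ i * y) (q := y * x ^ i) (r := x ^ j * y) (s := y * x ^ j) hsub ?_ rfl ?_ ?_ ?_ ?_
    (mul_right h y) (mul_left (c.1.symm h) y)
  · rintro u rfl v (rfl | rfl) huv
    · rfl
    · exact absurd huv hn
  · intro e
    rw [Set.mem_singleton_iff] at e
    exact hn (e ▸ c.1.refl _)
  · intro ξ α β
    simp only [map_mul, map_pow]
    by_cases hX : ξ x = 1
    · simp [hX]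
    by_cases hY : ξ y = 1
    · simp [hY]
    constructor <;> intro hm <;>
    · obtain ⟨rfl, rfl, (⟨e1, e2⟩ | ⟨e0, e1, e2⟩)⟩ := key _ (ξ x) (ξ y) α β hX hY
        (by simp [length_mul, add_comm]) (fun a => by simp [add_comm]) hm
      · simp [e1, e2]
      · subst e0
        simp [e1, e2]
  · intro ξ α β
    simp only [map_mul, map_pow]
    by_cases hX : ξ x = 1
    · simp [hX]
    by_cases hY : ξ y = 1
    · simp [hY]
    exact iff_of_false
      (fun hm => hfar (ξ x) (ξ y) α β _ hX hY (by simp [length_mul]) (hsub hm))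
      (fun hm => hfar (ξ x) (ξ y) α β _ hX hY (by simp [length_mul, add_comm]) (hsub hm))
  · intro ξ α β
    simp only [map_mul, map_pow]
    by_cases hX : ξ x = 1
    · simp [hX]
    by_cases hY : ξ y = 1
    · simp [hY]
    exact iff_of_false
      (hfar (ξ x) (ξ y) α β _ hX hY (by simp [length_mul]))
      (hfar (ξ x) (ξ y) α β _ hX hY (by simp [length_mul, add_comm]))

theorem pow_mul_y_ne {i : ℕ} (hi : 1 ≤ i) : x ^ i * y ≠ y * x ^ i := by
  intro h
  obtain ⟨i, rfl⟩ := Nat.exists_eq_add_of_le' hi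
  rw [pow_succ'] at h
  have := congrArg (fun w => w.toList.head?) h
  simp [toList_mul, x, y] at this

/-- A nontrivial cancellable congruence contains a nontrivial balanced identity in two
letters. -/
theorem Cancellable.exists_balanced (hc : Cancellable c) (hb : c ≠ ⊥) :
    ∃ u ∈ binary, ∃ v ∈ binary, u ≠ v ∧ c.1 u v ∧ cnt 0 u = cnt 0 v ∧ cnt 1 u = cnt 1 v := by
  by_cases hA : ∃ i j, i < j ∧ c.1 (x ^ i) (x ^ j)
  · obtain ⟨i, j, hij, h⟩ := hA
    have h' : c.1 (x ^ (i + 1)) (x ^ (j + 1)) := by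
      rw [pow_succ, pow_succ]
      exact mul_right h x
    exact ⟨_, mul_mem (pow_mem x_mem_binary _) y_mem_binary, _,
      mul_mem y_mem_binary (pow_mem x_mem_binary _), pow_mul_y_ne (by omega),
      hc.pow_central (by omega) (by omega) h', by simp, by simp⟩
  · have hcnt : ∀ u v, c.1 u v → ∀ a, cnt a u = cnt a v := by
      intro u v h a
      by_contra hne
      rcases lt_or_gt_of_ne hne with hlt | hlt
      · exact hA ⟨_, _, hlt, pow_cnt h a⟩
      · exact hA ⟨_, _, hlt, pow_cnt (c.1.symm h) a⟩
    obtain ⟨u, v, h, huv⟩ : ∃ u v, c.1 u v ∧ u ≠ v := by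
      by_contra hn
      push Not at hn
      refine hb (eq_bot_iff.2 fun u v h => ?_)
      rw [hn u v h]
      exact (⊥ : FICon).1.refl v
    obtain ⟨a, b, hab⟩ : ∃ a b, keep (fun i => i = a ∨ i = b) u ≠
        keep (fun i => i = a ∨ i = b) v := by
      by_contra hn
      push Not at hn
      refine huv (toList.injective (List.eq_of_forall_filter_pair_eq fun a b => ?_))
      rw [← toList_keep, ← toList_keep, hn]
    have hr := c.2 (rename a b) u v h
    exact ⟨_, rename_mem_binary a b u, _, rename_mem_binary a b v,
      fun e => hab (by rw [← sub_rename, ← sub_rename, e]), hr, hcnt _ _ hr 0, hcnt _ _ hr 1⟩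

end FICon

/-! ### Cancellable congruences identify two consecutive powers -/

namespace Word

open FreeMonoid

/-- A prefix of a word that starts with `x²`. -/
theorem start_sq_cases {u v w : F} (h : u * v = x * (x * w)) :
    u = 1 ∨ u = x ∨ ∃ u', u = x * (x * u') := by
  change List ℕ at u v w
  change u ++ v = 0 :: 0 :: w at h
  match u, h with
  | [], _ => exact Or.inl rfl
  | [a], h =>
    right; left
    obtain ⟨rfl, _⟩ := List.cons.inj h
    rfl
  | a :: b :: u', h =>
    right; right
    obtain ⟨rfl, h'⟩ := List.cons.inj h
    obtain ⟨rfl, _⟩ := List.cons.inj h'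
    exact ⟨u', rfl⟩

/-- A suffix of a word that ends with `x²`. -/
theorem end_sq_cases {u v w : F} (h : v * u = w * x * x) :
    u = 1 ∨ u = x ∨ ∃ u', u = u' * x * x := by
  have h' : u.reverse * v.reverse = x * (x * w.reverse) := by
    rw [← reverse_mul, h, reverse_mul, reverse_mul]
    rfl
  rcases start_sq_cases h' with e | e | ⟨u', e⟩
  · left
    rw [← reverse_reverse (a := u), e]; rfl
  · right; left
    rw [← reverse_reverse (a := u), e]; rfl
  · right; right
    refine ⟨u'.reverse, ?_⟩
    rw [← reverse_reverse (a := u), e, reverse_mul, reverse_mul]; rfl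

/-- All factors of `w` without occurrences of `x` have fewer than `K` occurrences of `y`. -/
def RunLT (K : ℕ) (w : F) : Prop := ∀ s g r : F, w = s * g * r → cnt 0 g = 0 → cnt 1 g < K

theorem runLT_of_cnt {K : ℕ} {w : F} (h : cnt 1 w < K) : RunLT K w := by
  rintro s g r rfl -
  simp only [cnt_mul] at h
  omega

theorem RunLT.mul {K : ℕ} {u v : F} (hu : RunLT K u) (hv : RunLT K v) :
    RunLT K (u * x * v) := by
  intro s g r h hg
  rw [mul_assoc, mul_assoc] at h
  rcases List.append_eq_append_iff.1 h with ⟨a, hs, ha⟩ | ⟨a, hs, ha⟩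
  · change F at a
    change s = u * a at hs
    change x * v = a * (g * r) at ha
    rcases List.cons_eq_append_iff.1 ha with ⟨rfl, hgr⟩ | ⟨a', rfl, hv'⟩
    · rcases List.append_eq_cons_iff.1 hgr with ⟨rfl, -⟩ | ⟨g', rfl, -⟩
      · exact hu u 1 1 (by simp) hg
      · change cnt 0 (x * ofList g') = 0 at hg
        simp at hg
    · exact hv (ofList a') g r (by rw [mul_assoc]; exact hv') hg
  · change F at a
    change u = s * a at hs
    change g * r = a * (x * v) at ha
    rcases List.append_eq_append_iff.1 ha with ⟨b, hb, hb'⟩ | ⟨b, hb, hb'⟩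
    · change F at b
      change a = g * b at hb
      exact hu s g b (by rw [hs, hb, mul_assoc]) hg
    · change F at b
      change g = a * b at hb
      rcases List.append_eq_cons_iff.1 hb'.symm with ⟨rfl, -⟩ | ⟨b', rfl, -⟩
      · change g = a * 1 at hb
        exact hu s g 1 (by rw [hs, hb]; simp) hg
      · rw [hb] at hg
        change cnt 0 (a * (x * ofList b')) = 0 at hg
        simp at hg

/-- A word with at most `K + 1` occurrences of `x`, with no long runs of `y`, which starts and
ends with `x²`, contains no nontrivial `K`-th power. -/
theorem eq_one_of_pow_factor {K : ℕ} (hK : 3 ≤ K) {w u v : F} (hb : w ∈ binary)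
    (h0 : cnt 0 w ≤ K + 1) (h1 : 0 < cnt 1 w) (hu : w = x * (x * u)) (hv : w = v * x * x)
    (hrun : RunLT K w) {s g r : F} (h : w = s * g ^ K * r) : g = 1 := by
  by_contra hg
  obtain ⟨k, rfl⟩ := Nat.exists_eq_add_of_le' hK
  have hc0 := congrArg (cnt 0) h
  simp only [cnt_mul, cnt_pow] at hc0
  have hg2 : cnt 0 g < 2 := by nlinarith
  have hgbin : 0 < cnt 0 g + cnt 1 g := by
    by_contra hz
    have hl := length_pos hg
    obtain ⟨a, ha⟩ := List.exists_mem_of_ne_nil g.toList hg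
    have ha0 : 0 < cnt a g := List.count_pos_iff.2 ha
    have := binary_cnt_map (MonoidHom.id F) a hb
    have hca := congrArg (cnt a) h
    simp only [cnt_mul, cnt_pow] at hca
    simp only [MonoidHom.id_apply] at this
    have h0a : a ≠ 0 := by rintro rfl; omega
    have h1a : a ≠ 1 := by rintro rfl; omega
    have e1 : cnt a x = 0 := by rw [x, cnt_of, if_neg h0a.symm]
    have e2 : cnt a y = 0 := by rw [y, cnt_of, if_neg h1a.symm]
    rw [e1, e2] at this
    nlinarith
  rcases Nat.eq_zero_or_pos (cnt 0 g) with hz | hz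
  · have := hrun s (g ^ (k + 3)) r h (by rw [cnt_pow, hz, mul_zero])
    rw [cnt_pow] at this
    nlinarith
  have hg1 : cnt 0 g = 1 := by omega
  rw [hg1] at hc0
  have hsr : cnt 0 s + cnt 0 r ≤ 1 := by omega
  have hs := start_sq_cases (u := s) (v := g ^ (k + 3) * r) (by rw [← mul_assoc, ← h, hu])
  have hr := end_sq_cases (u := r) (v := s * g ^ (k + 3)) (by rw [← h, hv])
  have hs' : s = 1 ∨ s = x := by
    rcases hs with e | e | ⟨s', e⟩
    · exact Or.inl e
    · exact Or.inr e
    · simp [e] at hsr; omega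
  have hr' : r = 1 ∨ r = x := by
    rcases hr with e | e | ⟨r', e⟩
    · exact Or.inl e
    · exact Or.inr e
    · simp [e] at hsr; omega
  have hgx : g = x := by
    rcases hs' with e | e
    · rcases start_sq_cases (u := g) (v := g ^ (k + 2) * r) (w := u)
        (by rw [← hu, h, e, pow_succ' g (k + 2)]; simp [mul_assoc]) with e' | e' | ⟨g', e'⟩
      · exact absurd e' hg
      · exact e'
      · simp [e'] at hg1
    · have hr1 : r = 1 := by
        rcases hr' with e' | e'
        · exact e'
        · simp [e, e'] at hsr
      rcases end_sq_cases (u := g) (v := s * g ^ (k + 2)) (w := v)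
        (by rw [← hv, h, hr1, pow_succ g (k + 2)]; simp [mul_assoc]) with e' | e' | ⟨g', e'⟩
      · exact absurd e' hg
      · exact e'
      · simp [e'] at hg1
  rw [h, hgx] at h1
  rcases hs' with e | e <;> rcases hr' with e' | e' <;> simp [e, e'] at h1

end Word

namespace FICon

open Word FreeMonoid

variable {c : FICon} {u v : F}

/-- If the word `g` avoids `K`-th powers, its only nontrivial occurrence in an image of a word
with almost the same numbers of letters is the obvious one. -/
theorem map_trivial_or_self {K K' : ℕ} (hK : 3 ≤ K) (hKK : K + 3 ≤ K') {g w : F}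
    (hg : g ∈ binary) (hw : w ∈ binary)
    (hcg : cnt 0 g = K ∧ cnt 1 g = K' ∨ cnt 0 g = K + 1 ∧ cnt 1 g + 1 = K')
    (hcw : cnt 0 w = K ∧ cnt 1 w = K' ∨ cnt 0 w = K + 1 ∧ cnt 1 w + 1 = K')
    (hpow : ∀ s h r : F, g = s * h ^ K * r → h = 1) {ξ : F →* F} {s r : F}
    (h : s * ξ w * r = g) :
    (ξ x = 1 ∧ ξ y = 1) ∨ (s = 1 ∧ r = 1 ∧ ξ x = x ∧ ξ y = y) := by
  by_cases hX : ξ x = 1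
  · left
    refine ⟨hX, hpow s (ξ y) (ξ y ^ (cnt 1 w - K) * r) ?_⟩
    rw [← h, binary_map_of_x hw hX]
    conv_lhs => rw [show cnt 1 w = K + (cnt 1 w - K) by omega, pow_add]
    simp only [mul_assoc]
  by_cases hY : ξ y = 1
  · left
    refine ⟨hpow s (ξ x) (ξ x ^ (cnt 0 w - K) * r) ?_, hY⟩
    rw [← h, binary_map_of_y hw hY]
    conv_lhs => rw [show cnt 0 w = K + (cnt 0 w - K) by omega, pow_add]
    simp only [mul_assoc]
  right
  have hX' := length_pos hX
  have hY' := length_pos hY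
  have hl := congrArg FreeMonoid.length h
  rw [length_mul, length_mul, binary_length_map ξ hw, binary_length hg] at hl
  have hXm : cnt 0 w ≤ cnt 0 w * (ξ x).length := Nat.le_mul_of_pos_right _ hX'
  have hYm : cnt 1 w ≤ cnt 1 w * (ξ y).length := Nat.le_mul_of_pos_right _ hY'
  have hs : s = 1 := length_eq_zero.1 (by omega)
  have hr : r = 1 := length_eq_zero.1 (by omega)
  have hXl : (ξ x).length = 1 := by
    have : cnt 0 w * (ξ x).length = cnt 0 w * 1 := by omega
    exact Nat.eq_of_mul_eq_mul_left (by omega) this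
  have hYl : (ξ y).length = 1 := by
    have : cnt 1 w * (ξ y).length = cnt 1 w * 1 := by omega
    exact Nat.eq_of_mul_eq_mul_left (by omega) this
  obtain ⟨a, ha⟩ := length_eq_one.1 hXl
  obtain ⟨b, hb⟩ := length_eq_one.1 hYl
  rw [hs, hr, one_mul, mul_one] at h
  have h0 := binary_cnt_map ξ 0 hw
  have h1 := binary_cnt_map ξ 1 hw
  rw [h, ha, hb, cnt_of, cnt_of] at h0 h1
  refine ⟨hs, hr, ?_⟩
  have ha0 : a = 0 := by
    by_contra hne
    rw [if_neg hne] at h0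
    split_ifs at h0 <;> simp at h0 <;> omega
  have hb1 : b = 1 := by
    by_contra hne
    rw [if_neg hne, ha0] at h1
    simp at h1
    omega
  rw [ha, hb, ha0, hb1]
  exact ⟨rfl, rfl⟩

theorem Cancellable.exists_pow_succ (hc : Cancellable c) {u v : F} (hu : u ∈ binary)
    (hv : v ∈ binary) (huv : u ≠ v) (h : c.1 u v) (h0 : cnt 0 u = cnt 0 v)
    (h1 : cnt 1 u = cnt 1 v) : ∃ n, c.1 (x ^ n) (x ^ (n + 1)) := by
  by_contra hn
  push Not at hn
  set e := cnt 0 u with he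
  set f := cnt 1 u with hf
  set m := e + f + 5 with hm
  -- The two words built around `w`; they have the same length.
  set P : F → F := fun w => x * (x * (w * (x ^ (f + 1) * (y ^ m * x * (y ^ m * x * x))))) with hP
  set Q : F → F := fun w =>
    x * (x * (w * (x ^ (f + 2) * (y ^ m * x * (y ^ (m - 1) * x * x))))) with hQ
  have hPb : ∀ w ∈ binary, P w ∈ binary := fun w hw => by
    simp only [hP]
    have := x_mem_binary
    have := y_mem_binary
    repeat' first | assumption | apply mul_mem | apply pow_mem
  have hQb : ∀ w ∈ binary, Q w ∈ binary := fun w hw => by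
    simp only [hQ]
    have := x_mem_binary
    have := y_mem_binary
    repeat' first | assumption | apply mul_mem | apply pow_mem
  have hP0 : ∀ w, cnt 0 w = e → cnt 0 (P w) = m + 1 := fun w hw => by
    simp only [hP, cnt_mul, cnt_pow, cnt_zero_x, cnt_zero_y, hw, hm]; omega
  have hP1 : ∀ w, cnt 1 w = f → cnt 1 (P w) = f + 2 * m := fun w hw => by
    simp [hP, hw]; omega
  have hQ0 : ∀ w, cnt 0 w = e → cnt 0 (Q w) = m + 2 := fun w hw => by
    simp only [hQ, cnt_mul, cnt_pow, cnt_zero_x, cnt_zero_y, hw, hm]; omega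
  have hQ1 : ∀ w, cnt 1 w = f → cnt 1 (Q w) + 1 = f + 2 * m := fun w hw => by
    simp [hQ, hw]; omega
  have hPrun : RunLT (m + 1) (P u) := by
    have : P u = (x * (x * (u * x ^ f))) * x * (y ^ m * x * (y ^ m * x * x)) := by
      simp only [hP, pow_succ, mul_assoc]
    rw [this]
    refine RunLT.mul (runLT_of_cnt ?_)
      (RunLT.mul (runLT_of_cnt ?_) (runLT_of_cnt ?_)) <;>
      (simp only [cnt_mul, cnt_pow, cnt_one_x, cnt_one_y]; omega)
  have hQrun : RunLT (m + 1) (Q u) := by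
    have : Q u = (x * (x * (u * x ^ (f + 1)))) * x * (y ^ m * x * (y ^ (m - 1) * x * x)) := by
      simp only [hQ, pow_succ, mul_assoc]
    rw [this]
    refine RunLT.mul (runLT_of_cnt ?_)
      (RunLT.mul (runLT_of_cnt ?_) (runLT_of_cnt ?_)) <;>
      (simp only [cnt_mul, cnt_pow, cnt_one_x, cnt_one_y]; omega)
  have hPpow : ∀ s g r : F, P u = s * g ^ (m + 1) * r → g = 1 := fun s g r hh =>
    eq_one_of_pow_factor (by omega) (hPb u hu) (by rw [hP0 u rfl]; omega)
      (by rw [hP1 u rfl]; omega) rfl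
      (v := x * (x * (u * (x ^ (f + 1) * (y ^ m * x * y ^ m)))))
      (by simp only [hP, mul_assoc]) hPrun hh
  have hQpow : ∀ s g r : F, Q u = s * g ^ (m + 1) * r → g = 1 := fun s g r hh =>
    eq_one_of_pow_factor (by omega) (hQb u hu) (by rw [hQ0 u rfl])
      (by have := hQ1 u rfl; omega) rfl
      (v := x * (x * (u * (x ^ (f + 2) * (y ^ m * x * y ^ (m - 1))))))
      (by simp only [hQ, mul_assoc]) hQrun hh
  have hcu : ∀ w, cnt 0 w = e → cnt 1 w = f →
      (cnt 0 (P w) = m + 1 ∧ cnt 1 (P w) = f + 2 * m ∨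
        cnt 0 (P w) = m + 1 + 1 ∧ cnt 1 (P w) + 1 = f + 2 * m) ∧
      (cnt 0 (Q w) = m + 1 ∧ cnt 1 (Q w) = f + 2 * m ∨
        cnt 0 (Q w) = m + 1 + 1 ∧ cnt 1 (Q w) + 1 = f + 2 * m) := fun w hw hw' =>
    ⟨Or.inl ⟨hP0 w hw, hP1 w hw'⟩, Or.inr ⟨hQ0 w hw, hQ1 w hw'⟩⟩
  have key : ∀ g ∈ ({P u, Q u} : Set F), ∀ w ∈ binary,
      (cnt 0 w = m + 1 ∧ cnt 1 w = f + 2 * m ∨ cnt 0 w = m + 1 + 1 ∧ cnt 1 w + 1 = f + 2 * m) →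
      ∀ (ξ : F →* F) (s r : F), s * ξ w * r = g →
      (ξ x = 1 ∧ ξ y = 1) ∨ (s = 1 ∧ r = 1 ∧ ξ x = x ∧ ξ y = y) := by
    rintro g (rfl | rfl) w hw hcw ξ s r hh
    · exact map_trivial_or_self (by omega) (by omega) (hPb u hu) hw (hcu u rfl rfl).1 hcw hPpow hh
    · exact map_trivial_or_self (by omega) (by omega) (hQb u hu) hw (hcu u rfl rfl).2 hcw hQpow hh
  have htriv : ∀ w ∈ binary, ∀ ξ : F →* F, ξ x = 1 → ξ y = 1 → ξ w = 1 := fun w hw ξ hX hY => by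
    rw [binary_map_of_x hw hX, hY, one_pow]
  have hPQ : ∀ w w', cnt 0 w = e → cnt 0 w' = e → P w ≠ Q w' := fun w w' hw hw' hh => by
    have := congrArg (cnt 0) hh
    rw [hP0 w hw, hQ0 w' hw'] at this
    omega
  have hPP : P v ≠ P u := fun hh => huv (by
    simp only [hP] at hh
    exact (mul_right_cancel (mul_left_cancel (mul_left_cancel hh))).symm)
  have hQQ : Q v ≠ Q u := fun hh => huv (by
    simp only [hQ] at hh
    exact (mul_right_cancel (mul_left_cancel (mul_left_cancel hh))).symm)
  have hrs : ∀ S ⊆ ({P u, Q u} : Set F), (syn S).1 (P v) (Q v) := by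
    intro S hS ξ s r
    by_cases hξ : ξ x = 1 ∧ ξ y = 1
    · rw [htriv _ (hPb v hv) ξ hξ.1 hξ.2, htriv _ (hQb v hv) ξ hξ.1 hξ.2]
    · refine iff_of_false (fun hh => ?_) (fun hh => ?_)
      · rcases key _ (hS hh) _ (hPb v hv) (hcu v h0.symm h1.symm).1 ξ s r rfl with
          k | ⟨k1, k2, k3, k4⟩
        · exact hξ k
        · rw [k1, k2, binary_map_self (hPb v hv) k3 k4, one_mul, mul_one] at hh
          rcases hS hh with k | k
          · exact hPP k
          · exact hPQ v u h0.symm rfl k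
      · rcases key _ (hS hh) _ (hQb v hv) (hcu v h0.symm h1.symm).2 ξ s r rfl with
          k | ⟨k1, k2, k3, k4⟩
        · exact hξ k
        · rw [k1, k2, binary_map_self (hQb v hv) k3 k4, one_mul, mul_one] at hh
          rcases hS hh with k | k
          · exact hPQ u v rfl h0.symm k.symm
          · exact hQQ k
  have hsub : ({P u} : Set F) ⊆ {P u, Q u} := by simp
  refine hc.false_of_pentagon (P := {P u}) (Q := {P u, Q u}) (p := P u) (q := Q u)
    (r := P v) (s := Q v) hsub ?_ rfl ?_ ?_ (hrs _ hsub) (hrs _ subset_rfl) ?_ ?_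
  · rintro w rfl w' (rfl | rfl) hh
    · rfl
    · have := pow_cnt hh 0
      rw [hP0 u rfl, hQ0 u rfl] at this
      exact absurd this (hn _)
  · exact fun hh => hPQ u u rfl rfl hh.symm
  · intro ξ s r
    by_cases hξ : ξ x = 1 ∧ ξ y = 1
    · rw [htriv _ (hPb u hu) ξ hξ.1 hξ.2, htriv _ (hQb u hu) ξ hξ.1 hξ.2]
    · constructor <;> intro hh
      · rcases key _ hh _ (hPb u hu) (hcu u rfl rfl).1 ξ s r rfl with
          k | ⟨k1, k2, k3, k4⟩
        · exact absurd k hξ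
        · rw [k1, k2, binary_map_self (hQb u hu) k3 k4]
          simp
      · rcases key _ hh _ (hQb u hu) (hcu u rfl rfl).2 ξ s r rfl with
          k | ⟨k1, k2, k3, k4⟩
        · exact absurd k hξ
        · rw [k1, k2, binary_map_self (hPb u hu) k3 k4]
          simp
  · exact mul_left (mul_left (mul_right h _) x) x
  · exact mul_left (mul_left (mul_right (c.1.symm h) _) x) x

end FICon

/-! ### The least exponent at which consecutive powers are identified is at most two -/

namespace FICon

open Word FreeMonoid

variable {c : FICon} {u v : F}

theorem pow_succ_of_le {n m : ℕ} (h : c.1 (x ^ n) (x ^ (n + 1))) (hnm : n ≤ m) :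
    c.1 (x ^ m) (x ^ (m + 1)) := by
  obtain ⟨k, rfl⟩ := Nat.exists_eq_add_of_le hnm
  have := mul_right h (x ^ k)
  rwa [← pow_add, ← pow_add, add_right_comm] at this

/-- If some two consecutive powers are identified, then any power identified with a higher
one is identified with the next one. -/
theorem pow_succ_of_pow {n i j : ℕ} (hn : c.1 (x ^ n) (x ^ (n + 1))) (hij : i < j)
    (h : c.1 (x ^ i) (x ^ j)) : c.1 (x ^ i) (x ^ (i + 1)) := by
  obtain ⟨k, rfl⟩ := Nat.exists_eq_add_of_lt hij
  have hit : ∀ r, c.1 (x ^ i) (x ^ (i + r * (k + 1))) := by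
    intro r
    induction r with
    | zero => simpa using c.1.refl _
    | succ r ih =>
      have := mul_right h (x ^ (r * (k + 1)))
      rw [← pow_add, ← pow_add] at this
      refine c.1.trans ih ?_
      convert this using 2
      ring
  have h1 := hit n
  have h2 : c.1 (x ^ (i + n * (k + 1))) (x ^ (i + n * (k + 1) + 1)) :=
    pow_succ_of_le hn (by nlinarith)
  have h3 := mul_right h1 x
  rw [← pow_succ, ← pow_succ] at h3
  exact c.1.trans h1 (c.1.trans h2 (c.1.symm h3))

/-- The words that start and end with `y` but are not powers of `y`. -/
def Framed (w : F) : Prop :=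
  w.toList.head? = some 1 ∧ w.toList.getLast? = some 1 ∧ cnt 1 w < w.length

theorem cnt_le_length (a : ℕ) (w : F) : cnt a w ≤ w.length := List.count_le_length

theorem framed_pow {s g r : F} {i j : ℕ} (hi : 1 ≤ i) (hj : 1 ≤ j) :
    Framed (s * g ^ i * r) ↔ Framed (s * g ^ j * r) := by
  obtain ⟨i, rfl⟩ := Nat.exists_eq_add_of_le' hi
  obtain ⟨j, rfl⟩ := Nat.exists_eq_add_of_le' hj
  by_cases hg : g = 1
  · simp [hg]
  have hgl : g.toList ≠ [] := hg
  have hhead : ∀ k, (s * g ^ (k + 1) * r).toList.head? = (s * g).toList.head? := fun k => by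
    rw [pow_succ', ← mul_assoc s, mul_assoc, toList_mul, List.head?_append_of_ne_nil]
    rw [toList_mul]
    exact List.append_ne_nil_of_right_ne_nil _ hgl
  have hlast : ∀ k, (s * g ^ (k + 1) * r).toList.getLast? = (g * r).toList.getLast? := fun k => by
    rw [pow_succ, ← mul_assoc s, mul_assoc, toList_mul, List.getLast?_append_of_ne_nil]
    rw [toList_mul]
    exact List.append_ne_nil_of_left_ne_nil hgl _
  have hlen : ∀ k, cnt 1 (s * g ^ (k + 1) * r) < (s * g ^ (k + 1) * r).length ↔
      cnt 1 s < s.length ∨ cnt 1 g < g.length ∨ cnt 1 r < r.length := fun k => by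
    simp only [cnt_mul, cnt_pow, length_mul, length_pow]
    have h1 := cnt_le_length 1 s
    have h2 := cnt_le_length 1 g
    have h3 := cnt_le_length 1 r
    rcases h2.lt_or_eq with h | h
    · have : (k + 1) * cnt 1 g < (k + 1) * g.length := by nlinarith
      omega
    · rw [h]; omega
  simp only [Framed, hhead, hlast, hlen]

/-- A framed word has at least two occurrences of `y`. -/
theorem Framed.two_le {w : F} (h : Framed w) : 2 ≤ cnt 1 w := by
  obtain ⟨h1, h2, h3⟩ := h
  change List ℕ at w
  match w with
  | [] =>
    change none = some 1 at h1
    cases h1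
  | [a] =>
    change some a = some 1 at h1
    rw [Option.some.inj h1] at h3
    exact absurd h3 (by decide)
  | a :: b :: w =>
    change some a = some 1 at h1
    rw [Option.some.inj h1]
    have hm : 1 ∈ b :: w := by
      refine List.mem_of_getLast? (?_ : (b :: w).getLast? = some 1)
      rw [← h2]
      exact List.getLast?_cons_cons.symm
    have := List.count_pos_iff.2 hm
    change 2 ≤ List.count 1 (1 :: b :: w)
    rw [List.count_cons_self]
    omega

theorem Cancellable.not_three_le (hc : Cancellable c) {n : ℕ} (hn : 3 ≤ n)
    (h : c.1 (x ^ n) (x ^ (n + 1))) (hmin : ¬ c.1 (x ^ (n - 1)) (x ^ n)) : False := by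
  obtain ⟨m, rfl⟩ := Nat.exists_eq_add_of_le' hn
  have hmin : ¬ c.1 (x ^ (m + 2)) (x ^ (m + 2 + 1)) := hmin
  have hcen : ∀ Y, c.1 (x ^ (m + 3) * Y) (Y * x ^ (m + 3)) := fun Y => by
    simpa using c.2 (sub x Y) _ _ (hc.pow_central (by omega) (Nat.lt_succ_self _) h)
  set Q : Set F := {w | Framed w ∧ m + 2 ≤ cnt 1 w} with hQ
  set P : Set F := {w | Framed w ∧ cnt 1 w = m + 2} with hP
  -- In both sets, the exponents `m + 2` and `m + 3` are interchangeable.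
  have hsQ : (syn Q).1 (x ^ (m + 2)) (x ^ (m + 3)) := by
    intro ξ s r
    simp only [hQ, Set.mem_ofPred_eq, map_pow]
    rw [framed_pow (i := m + 2) (j := m + 3) (by omega) (by omega)]
    refine and_congr_right fun _ => ?_
    simp only [cnt_mul, cnt_pow]
    rcases Nat.eq_zero_or_pos (cnt 1 (ξ x)) with h0 | h0
    · rw [h0]; omega
    · exact iff_of_true (by nlinarith) (by nlinarith)
  have hsP : (syn P).1 (x ^ (m + 2)) (x ^ (m + 3)) := by
    intro ξ s r
    simp only [hP, Set.mem_ofPred_eq, map_pow]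
    rw [framed_pow (i := m + 2) (j := m + 3) (by omega) (by omega)]
    refine and_congr_right fun hF => ?_
    rw [framed_pow (i := m + 3) (j := 1) (by omega) le_rfl, pow_one] at hF
    simp only [cnt_mul, cnt_pow]
    rcases Nat.eq_zero_or_pos (cnt 1 (ξ x)) with h0 | h0
    · rw [h0]; omega
    · refine iff_of_false (fun hh => ?_) (fun hh => by nlinarith)
      have h1 : cnt 1 (ξ x) = 1 := by nlinarith
      rw [h1] at hh
      have := hF.two_le
      simp only [cnt_mul] at this
      omega
  refine hc.false_of_pentagon (P := P) (Q := Q) (p := y * x ^ (m + 3) * y ^ (m + 1))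
    (q := y ^ 2 * x ^ (m + 3) * y ^ (m + 1)) (r := x ^ (m + 3) * y ^ (m + 2))
    (s := x ^ (m + 3) * y ^ (m + 3)) ?_ ?_ ?_ ?_ ?_ ?_ ?_ ?_ ?_
  · exact fun w hw => ⟨hw.1, hw.2.ge⟩
  · intro u hu v hv huv
    refine ⟨hv.1, ?_⟩
    by_contra hne
    have hlt : m + 2 < cnt 1 v := lt_of_le_of_ne hv.2 (Ne.symm hne)
    have := pow_cnt huv 1
    rw [hu.2] at this
    exact hmin (pow_succ_of_pow h hlt this)
  · refine ⟨⟨?_, ?_, ?_⟩, ?_⟩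
    · rw [mul_assoc]; rfl
    · rw [pow_succ y, ← mul_assoc, toList_mul]
      exact List.getLast?_concat
    · simp only [cnt_mul, cnt_pow, length_mul, length_pow, cnt_one_x, cnt_one_y, length_x, length_y]
      omega
    · simp only [cnt_mul, cnt_pow, cnt_one_x, cnt_one_y]
      omega
  · intro hq
    have := hq.2
    simp only [cnt_mul, cnt_pow, cnt_one_x, cnt_one_y] at this
    omega
  · intro ξ s r
    simp only [hQ, Set.mem_ofPred_eq, map_mul, map_pow]
    have hF := framed_pow (s := s) (g := ξ y) (r := ξ x ^ (m + 3) * ξ y ^ (m + 1) * r)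
      (le_refl 1) (show 1 ≤ 2 by omega)
    simp only [pow_one, mul_assoc] at hF ⊢
    rw [hF]
    refine and_congr_right fun _ => ?_
    simp only [cnt_mul, cnt_pow]
    rcases Nat.eq_zero_or_pos (cnt 1 (ξ y)) with h0 | h0
    · simp only [h0, mul_zero]
    · exact iff_of_true (by nlinarith) (by nlinarith)
  · exact mul_left (pow_subst hsP y) _
  · exact mul_left (pow_subst hsQ y) _
  · have := mul_right (c.1.symm (hcen y)) (y ^ (m + 1))
    rwa [mul_assoc (x ^ (m + 3)), ← pow_succ'] at this
  · have := mul_right (hcen (y ^ 2)) (y ^ (m + 1))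
    rwa [mul_assoc (x ^ (m + 3)), ← pow_add, show 2 + (m + 1) = m + 3 by omega] at this

end FICon

/-! ### Congruences with `x² = x³` -/

namespace FICon

open Word FreeMonoid

variable {c : FICon} {u v : F}

/-- The words obtained from `xxy` by permuting letters. -/
def permXXY : Set F := {w | ∀ a, cnt a w = cnt a (x * x * y)}

theorem mem_permXXY {w : F} : w ∈ permXXY ↔ w = x * x * y ∨ w = x * y * x ∨ w = y * x * x := by
  constructor
  · intro h
    have hp : w.toList.Perm [0, 0, 1] := List.perm_iff_count.2 h
    have := List.mem_permutations'.2 hp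
    simp only [List.permutations', List.flatMap_cons, List.flatMap_nil, List.permutations'Aux,
      List.append_nil, List.map_cons, List.map_nil, List.mem_cons, List.not_mem_nil, or_false,
      List.mem_append] at this
    rcases this with (e | e | e) | (e | e | e) <;> first
      | exact Or.inl (toList.injective e)
      | exact Or.inr (Or.inl (toList.injective e))
      | exact Or.inr (Or.inr (toList.injective e))
  · rintro (rfl | rfl | rfl) a <;> simp only [cnt_mul] <;> omega

theorem syn_permXXY_of_cnt (h : ∀ (ξ : F →* F) a, cnt a (ξ u) = cnt a (ξ v)) :
    (syn permXXY).1 u v := fun ξ s r => by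
  refine forall_congr' fun a => ?_
  have : cnt a (s * ξ u * r) = cnt a (s * ξ v * r) := by simp only [cnt_mul, h]
  rw [this]

theorem eq_of_mem_permXXY {X Y W s r : F} (hX : X ≠ 1) (hY : Y ≠ 1)
    (hW : ∀ a, cnt a W = 2 * cnt a X + cnt a Y) (h : s * W * r ∈ permXXY) :
    X = x ∧ Y = y ∧ s = 1 ∧ r = 1 := by
  have hlen : ∀ w : F, w ≠ 1 → ∃ a, 0 < cnt a w := fun w hw => by
    obtain ⟨a, ha⟩ := List.exists_mem_of_ne_nil w.toList hw
    exact ⟨a, List.count_pos_iff.2 ha⟩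
  have hcnt : ∀ a, cnt a s + (2 * cnt a X + cnt a Y) + cnt a r = cnt a (x * x * y) := fun a => by
    rw [← h a, cnt_mul, cnt_mul, hW]
  have hxy : ∀ a, cnt a (x * x * y) = if a = 0 then 2 else if a = 1 then 1 else 0 := fun a => by
    simp only [cnt_mul, x, y, cnt_of]
    split_ifs <;> omega
  have hX' : ∀ a, cnt a X = if a = 0 then 1 else 0 := by
    obtain ⟨i, hi⟩ := hlen X hX
    have hi0 : i = 0 := by
      have := hcnt i
      rw [hxy] at this
      split_ifs at this <;> omega
    subst hi0
    intro a
    have := hcnt a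
    rw [hxy] at this
    split_ifs at this ⊢ with h1 h2
    · subst h1; omega
    · omega
    · omega
  have hY' : ∀ a, cnt a Y = if a = 1 then 1 else 0 := by
    obtain ⟨i, hi⟩ := hlen Y hY
    have hi1 : i = 1 := by
      have := hcnt i
      rw [hxy, hX'] at this
      split_ifs at this <;> omega
    subst hi1
    intro a
    have := hcnt a
    rw [hxy, hX'] at this
    split_ifs at this ⊢ with h1 h2 <;> first | omega | (subst h1; omega)
  have hsr : ∀ a, cnt a s = 0 ∧ cnt a r = 0 := fun a => by
    have := hcnt a
    rw [hxy, hX', hY'] at this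
    split_ifs at this <;> omega
  refine ⟨?_, ?_, ?_, ?_⟩
  · refine toList.injective (List.perm_singleton.1 (List.perm_iff_count.2 fun a => ?_))
    exact (hX' a).trans (by rw [List.count_singleton]; grind)
  · refine toList.injective (List.perm_singleton.1 (List.perm_iff_count.2 fun a => ?_))
    exact (hY' a).trans (by rw [List.count_singleton]; grind)
  · by_contra hs
    obtain ⟨a, ha⟩ := hlen s hs
    have := (hsr a).1
    omega
  · by_contra hs
    obtain ⟨a, ha⟩ := hlen r hs
    have := (hsr a).2
    omega

theorem xyx_ne_xxy : x * y * x ≠ x * x * y := fun h => by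
  have := congrArg toList h
  simp [x, y] at this

theorem xyx_ne_yxx : x * y * x ≠ y * x * x := fun h => by
  have := congrArg toList h
  simp [x, y] at this

theorem xxy_ne_yxx : x * x * y ≠ y * x * x := fun h => by
  have := congrArg toList h
  simp [x, y] at this

/-- Two words with two letters `x` and one letter `y` each are interchangeable with respect
to a third one. -/
theorem syn_singleton_of_ne {w : F} (hw : w ∈ permXXY) (hu : u ∈ binary) (hv : v ∈ binary)
    (hu0 : u ∈ permXXY) (hv0 : v ∈ permXXY) (huw : u ≠ w) (hvw : v ≠ w) :
    (syn {w}).1 u v := by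
  have hu1 := hu0 0
  have hu2 := hu0 1
  have hv1 := hv0 0
  have hv2 := hv0 1
  simp only [cnt_mul, cnt_zero_x, cnt_one_x, cnt_zero_y, cnt_one_y] at hu1 hu2 hv1 hv2
  intro ξ s r
  by_cases hX : ξ x = 1
  · rw [binary_map_of_x hu hX, binary_map_of_x hv hX, hu2, hv2]
  by_cases hY : ξ y = 1
  · rw [binary_map_of_y hu hY, binary_map_of_y hv hY, hu1, hv1]
  have key : ∀ z ∈ binary, cnt 0 z = 2 → cnt 1 z = 1 → z ≠ w → ¬ s * ξ z * r ∈ ({w} : Set F) := by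
    intro z hz h0 h1 hzw hm
    obtain ⟨e1, e2, e3, e4⟩ := eq_of_mem_permXXY hX hY
      (fun a => by rw [binary_cnt_map ξ a hz, h0, h1, one_mul]) (s := s) (r := r)
      (Set.singleton_subset_iff.2 hw hm)
    rw [e3, e4, binary_map_self hz e1 e2, one_mul, mul_one] at hm
    exact hzw hm
  exact iff_of_false (key u hu hu1 hu2 huw) (key v hv hv1 hv2 hvw)

theorem noGroup_syn_permXXY : (syn permXXY).NoGroup := fun n hn h => by
  have h1 := mul_left h (x * x * y)
  have := mem_of_syn h1 (by rw [mul_one]; exact fun _ => rfl) 0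
  simp at this
  omega

theorem noReg_syn_permXXY : (syn permXXY).NoReg := fun n hn h => by
  have h1 := mul_right (mul_left h x) y
  have := mem_of_syn h1 (fun _ => rfl) 0
  simp at this
  omega

theorem Cancellable.rel_xyx (hc : Cancellable c) (h1 : c.1 (x ^ 3) (x ^ 2))
    (h2 : c.1 (x * x * y) (y * x * x)) : c.1 (x * x * y) (x * y * x) := by
  by_contra hn
  have hx := x_mem_binary
  have hy := y_mem_binary
  have bxxy : x * x * y ∈ binary := mul_mem (mul_mem hx hx) hy
  have bxyx : x * y * x ∈ binary := mul_mem (mul_mem hx hy) hx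
  have byxx : y * x * x ∈ binary := mul_mem (mul_mem hy hx) hx
  have mxxy : x * x * y ∈ permXXY := mem_permXXY.2 (by simp)
  have mxyx : x * y * x ∈ permXXY := mem_permXXY.2 (by simp)
  have myxx : y * x * x ∈ permXXY := mem_permXXY.2 (by simp)
  set b := syn {y * x * x} ⊓ syn permXXY with hb
  set d := syn {x * x * y} ⊓ syn permXXY with hd
  have hb1 : b.1 (x * x * y) (x * y * x) := inf_apply.2
    ⟨syn_singleton_of_ne myxx bxxy bxyx mxxy mxyx xxy_ne_yxx xyx_ne_yxx,
      syn_permXXY_of_cnt fun ξ a => by simp only [map_mul, cnt_mul]; omega⟩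
  have hd1 : d.1 (x * y * x) (y * x * x) := inf_apply.2
    ⟨syn_singleton_of_ne mxxy bxyx byxx mxyx myxx xyx_ne_xxy xxy_ne_yxx.symm,
      syn_permXXY_of_cnt fun ξ a => by simp only [map_mul, cnt_mul]; omega⟩
  have hD : ∀ e : FICon, e.1 (x * x * y) (x * y * x) ∨ e.1 (x * y * x) (y * x * x) →
      sigmaD ≤ c ⊔ e := by
    intro e he
    have hce : c ≤ c ⊔ e := le_sup_left
    have hee : e ≤ c ⊔ e := le_sup_right
    rw [sigmaD_le_iff, pow_two x, ← mul_assoc y]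
    refine ⟨by rw [← pow_two]; exact hce h1, ?_⟩
    rcases he with he | he
    · exact ⟨hee he, (c ⊔ e).1.trans ((c ⊔ e).1.symm (hee he)) (hce h2)⟩
    · exact ⟨(c ⊔ e).1.trans (hce h2) ((c ⊔ e).1.symm (hee he)), hee he⟩
  have hbD : b ≤ sigmaD := le_sigmaD (noGroup_syn_permXXY.mono inf_le_right)
    (noReg_syn_permXXY.mono inf_le_right) fun h =>
      xyx_ne_yxx (mem_of_syn (Q := {y * x * x}) (inf_apply.1 (mul_right (b.1.symm h) x)).1 rfl)
  have hdD : d ≤ sigmaD := le_sigmaD (noGroup_syn_permXXY.mono inf_le_right)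
    (noReg_syn_permXXY.mono inf_le_right) fun h =>
      xyx_ne_xxy (mem_of_syn (Q := {x * x * y}) (u := x * x * y) (v := x * y * x)
        (by simpa only [mul_assoc] using (inf_apply.1 (mul_left h x)).1) rfl)
  have hsup : c ⊔ b = c ⊔ d := le_antisymm
    (sup_le le_sup_left (hbD.trans (hD d (Or.inr hd1))))
    (sup_le le_sup_left (hdD.trans (hD b (Or.inl hb1))))
  have hinf : c ⊓ b = c ⊓ d := by
    refine le_antisymm (le_inf inf_le_left (le_inf (le_syn ?_) (inf_le_right.trans inf_le_right)))
      (le_inf inf_le_left (le_inf (le_syn ?_) (inf_le_right.trans inf_le_right)))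
    · rintro _ v huv rfl
      obtain ⟨hcv, hbv⟩ := inf_apply.1 huv
      obtain ⟨hbv1, hbv2⟩ := inf_apply.1 hbv
      rcases mem_permXXY.1 (mem_of_syn hbv2 mxxy) with rfl | rfl | rfl
      · rfl
      · exact absurd hcv hn
      · exact absurd (mem_of_syn (Q := {y * x * x}) ((syn _).1.symm hbv1) rfl) xxy_ne_yxx
    · rintro _ v huv rfl
      obtain ⟨hcv, hdv⟩ := inf_apply.1 huv
      obtain ⟨hdv1, hdv2⟩ := inf_apply.1 hdv
      rcases mem_permXXY.1 (mem_of_syn hdv2 myxx) with rfl | rfl | rfl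
      · exact absurd (mem_of_syn (Q := {x * x * y}) ((syn _).1.symm hdv1) rfl) xxy_ne_yxx.symm
      · exact absurd (c.1.trans h2 hcv) hn
      · rfl
  have hbd := hc b d hsup hinf
  rw [hbd] at hb1
  exact xyx_ne_xxy (mem_of_syn (Q := {x * x * y}) (inf_apply.1 hb1).1 rfl)

theorem Cancellable.classify (hc : Cancellable c) :
    c = ⊥ ∨ c = sigmaD ∨ c = sigmaC2 ∨ c = sigmaSL ∨ c = ⊤ := by
  by_cases hbot : c = ⊥
  · exact Or.inl hbot
  right
  obtain ⟨u, hu, v, hv, huv, h, h0, h1⟩ := hc.exists_balanced hbot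
  classical
  have hex := hc.exists_pow_succ hu hv huv h h0 h1
  have hn := Nat.find_spec hex
  have hmin : ∀ m < Nat.find hex, ¬ c.1 (x ^ m) (x ^ (m + 1)) := fun m hm => Nat.find_min hex hm
  generalize Nat.find hex = n at hn hmin
  rcases Nat.lt_or_ge n 3 with hlt | hge
  swap
  · refine (hc.not_three_le hge hn ?_).elim
    have := hmin (n - 1) (by omega)
    rwa [Nat.sub_add_cancel (by omega)] at this
  have hgroup : 0 < n → c.NoGroup := fun hpos m hm hcm =>
    hmin 0 hpos (pow_succ_of_pow hn hm (by simpa using hcm))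
  have hreg : 1 < n → c.NoReg := fun hpos m hm hcm =>
    hmin 1 hpos (pow_succ_of_pow hn hm (by simpa using hcm))
  interval_cases n
  · right; right; right
    have hone : ∀ w, c.1 1 w := fun w => by simpa using pow_subst hn w
    exact eq_top_iff.2 fun u v _ => c.1.trans (c.1.symm (hone u)) (hone v)
  · right; right; left
    have hcomm := hc.pow_central (le_refl 1) (Nat.lt_succ_self 1) hn
    rw [pow_one] at hn hcomm
    exact le_antisymm (le_sigmaSL (hgroup one_pos)) (sigmaSL_le_iff.2 ⟨c.1.symm hn, hcomm⟩)
  · have hcen := hc.pow_central (by omega) (Nat.lt_succ_self 2) hn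
    by_cases hcomm : c.NoComm
    · left
      have hcen' : c.1 (x * x * y) (y * x * x) := by rwa [mul_assoc y, ← pow_two]
      have hxyx := hc.rel_xyx (c.1.symm hn) hcen'
      refine le_antisymm (le_sigmaD (hgroup two_pos) (hreg one_lt_two) hcomm)
        (sigmaD_le_iff.2 ⟨c.1.symm hn, by rwa [pow_two], ?_⟩)
      rw [pow_two, ← mul_assoc]
      exact c.1.trans (c.1.symm hxyx) hcen'
    · right; left
      exact le_antisymm (le_sigmaC2 (hgroup two_pos) (hreg one_lt_two))
        (sigmaC2_le_iff.2 ⟨c.1.symm hn, not_not.1 hcomm⟩)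

theorem cancellable_bot : Cancellable (⊥ : FICon) := fun b d hs _ => by simpa using hs

theorem cancellable_top : Cancellable (⊤ : FICon) := fun b d _ hi => by simpa using hi

end FICon

/-- A fully invariant congruence on `F` is a cancellable element of the
complete lattice of fully invariant congruences on `F` if and only if it is
one of `⊥`, `σ_D`, `σ_C2`, `σ_SL`, `⊤`.  (Equivalently, a monoid variety is a
cancellable element of the lattice of monoid varieties iff it is one of
`MON`, `D`, `C₂`, `SL`, `T`.) -/
theorem cancellable_iff (c : FICon) :
    (∀ b d : FICon, c ⊔ b = c ⊔ d → c ⊓ b = c ⊓ d → b = d) ↔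
      c = ⊥ ∨ c = sigmaD ∨ c = sigmaC2 ∨ c = sigmaSL ∨ c = ⊤ := by
  constructor
  · exact fun hc => FICon.Cancellable.classify hc
  · rintro (rfl | rfl | rfl | rfl | rfl)
    · exact FICon.cancellable_bot
    · exact FICon.cancellable_sigmaD
    · exact FICon.cancellable_sigmaC2
    · exact FICon.cancellable_sigmaSL
    · exact FICon.cancellable_top
end

section
/- Let M be a monoid such that c_M ≠ ⊥, i.e. M satisfies some nontrivial identity (equivalently, M generates a proper variety of monoids). Then c_M is a cancellable element of the lattice 𝓛 of fully invariant congruences on F if and only if M satisfies the identity x³yz ≈ yxzx, i.e. a·a·a·b·d = b·a·d·a for all a, b, d ∈ M. -/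
/-- The fully invariant congruence `c_M` on `F` determined by a monoid `M`:
two words are related iff every homomorphism `F →* M` identifies them.  It
corresponds to the variety of monoids generated by `M`. -/
def conOf (M : Type) [Monoid M] : FICon :=
  ⟨{ r := fun u v => ∀ f : F →* M, f u = f v
     iseqv := ⟨fun _ _ => rfl, fun h f => (h f).symm, fun h₁ h₂ f => (h₁ f).trans (h₂ f)⟩
     mul' := fun h₁ h₂ f => by rw [map_mul, map_mul, h₁ f, h₂ f] },
   fun ξ u v h f => h (f.comp ξ)⟩

/-! ### Fully invariant congruences as relations on lists -/

/-- The relation on lists of letters underlying a fully invariant congruence. -/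
def WRel (b : FICon) (u v : List ℕ) : Prop :=
  b.1 (FreeMonoid.ofList u) (FreeMonoid.ofList v)

theorem WRel.refl (b : FICon) (u : List ℕ) : WRel b u u := b.1.refl _

theorem WRel.symm {b : FICon} {u v : List ℕ} (h : WRel b u v) : WRel b v u := b.1.symm h

theorem WRel.trans {b : FICon} {u v w : List ℕ} (h : WRel b u v) (h' : WRel b v w) : WRel b u w :=
  b.1.trans h h'

theorem WRel.append {b : FICon} {u v u' v' : List ℕ} (h : WRel b u v) (h' : WRel b u' v') :
    WRel b (u ++ u') (v ++ v') := b.1.mul h h'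

theorem toList_hom_apply (ξ : F →* F) (u : F) :
    FreeMonoid.toList (ξ u) =
      (FreeMonoid.toList u).flatMap fun i => FreeMonoid.toList (ξ (FreeMonoid.of i)) := by
  induction u using FreeMonoid.inductionOn' with
  | one => simp
  | of_mul i u ih => simp [ih]

theorem WRel.flatMap {b : FICon} {u v : List ℕ} (h : WRel b u v) (φ : ℕ → List ℕ) :
    WRel b (u.flatMap φ) (v.flatMap φ) := by
  have key : ∀ w : List ℕ, FreeMonoid.ofList (w.flatMap φ) =
      FreeMonoid.lift (fun i => FreeMonoid.ofList (φ i)) (FreeMonoid.ofList w) := by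
    intro w
    apply FreeMonoid.toList.injective
    rw [toList_hom_apply]
    simp
  have := b.2 (FreeMonoid.lift fun i => FreeMonoid.ofList (φ i)) _ _ h
  rwa [← key, ← key] at this

theorem le_iff_rel {b d : FICon} : b ≤ d ↔ ∀ u v, WRel b u v → WRel d u v :=
  ⟨fun h _ _ huv => h huv, fun h u v huv => h (FreeMonoid.toList u) (FreeMonoid.toList v) huv⟩

theorem rel_inf {b d : FICon} {u v : List ℕ} (hb : WRel b u v) (hd : WRel d u v) :
    WRel (b ⊓ d) u v := by
  have h : (⟨b.1 ⊓ d.1, fun ξ u v h => ⟨b.2 ξ u v h.1, d.2 ξ u v h.2⟩⟩ : FICon) ≤ b ⊓ d :=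
    le_inf (fun _ _ h => h.1) (fun _ _ h => h.2)
  exact le_iff_rel.1 h u v ⟨hb, hd⟩

theorem rel_conOf {M : Type} [Monoid M] {u v : List ℕ} :
    WRel (conOf M) u v ↔ ∀ g : ℕ → M, (u.map g).prod = (v.map g).prod := by
  constructor
  · intro h g
    simpa [FreeMonoid.lift_apply] using h (FreeMonoid.lift g)
  · intro h f
    have key : ∀ w : F, f w = ((FreeMonoid.toList w).map fun i => f (FreeMonoid.of i)).prod := by
      intro w
      induction w using FreeMonoid.inductionOn' with
      | one => simp
      | of_mul i u ih => simp [ih]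
    rw [key, key]
    exact h _

theorem fic_singleton_le {d : FICon} {u v : List ℕ} (h : WRel d u v) :
    fic {(FreeMonoid.ofList u, FreeMonoid.ofList v)} ≤ d :=
  sInf_le (by rintro p rfl; exact h)

theorem rel_fic_singleton (u v : List ℕ) :
    WRel (fic {(FreeMonoid.ofList u, FreeMonoid.ofList v)}) u v := by
  rintro c ⟨d, hd, rfl⟩
  exact hd _ rfl

/-- The largest fully invariant congruence contained in the kernel of `L`. -/
def syn (L : List ℕ → ℕ) : FICon :=
  ⟨{ r := fun u v => ∀ (ξ : F →* F) (a a' : F),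
        L (FreeMonoid.toList (a * ξ u * a')) = L (FreeMonoid.toList (a * ξ v * a'))
     iseqv := ⟨fun _ _ _ _ => rfl, fun h ξ a a' => (h ξ a a').symm,
       fun h h' ξ a a' => (h ξ a a').trans (h' ξ a a')⟩
     mul' := fun {u v u' v'} h h' ξ a a' => by
       have h₁ := h ξ a (ξ u' * a')
       have h₂ := h' ξ (a * ξ v) a'
       simp only [map_mul, mul_assoc] at h₁ h₂ ⊢
       exact h₁.trans h₂ },
   fun ξ _ _ h η a a' => h (η.comp ξ) a a'⟩

theorem le_syn {L : List ℕ → ℕ} {b : FICon} (h : ∀ u v, WRel b u v → L u = L v) : b ≤ syn L := by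
  intro u v huv ξ a a'
  exact h _ _ (b.1.mul (b.1.mul (b.1.refl a) (b.2 ξ _ _ huv)) (b.1.refl a'))

theorem rel_syn_of {L : List ℕ → ℕ} {u v : List ℕ}
    (h : ∀ (φ : ℕ → List ℕ) (a a' : List ℕ),
      L (a ++ u.flatMap φ ++ a') = L (a ++ v.flatMap φ ++ a')) : WRel (syn L) u v := by
  intro ξ a a'
  have := h (fun i => FreeMonoid.toList (ξ (FreeMonoid.of i))) (FreeMonoid.toList a)
    (FreeMonoid.toList a')
  rw [FreeMonoid.toList_mul, FreeMonoid.toList_mul, FreeMonoid.toList_mul, FreeMonoid.toList_mul,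
    toList_hom_apply ξ (FreeMonoid.ofList u), toList_hom_apply ξ (FreeMonoid.ofList v)]
  exact this

theorem WRel.label_eq {L : List ℕ → ℕ} {b : FICon} (hb : b ≤ syn L) {u v : List ℕ}
    (h : WRel b u v) : L u = L v := by
  have h' : L (FreeMonoid.toList (1 * FreeMonoid.ofList u * 1)) =
      L (FreeMonoid.toList (1 * FreeMonoid.ofList v * 1)) := hb h (MonoidHom.id F) 1 1
  rwa [one_mul, mul_one, one_mul, mul_one] at h'

/-! ### The criterion for failing to be cancellable -/

/-- A set of words is rigid if every substitution instance inside the set either arises from the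
identity substitution or from one that identifies all the words. -/
def Rigid (K : Set (List ℕ)) : Prop :=
  ∀ X ∈ K, ∀ (φ : ℕ → List ℕ) (a a' : List ℕ), a ++ X.flatMap φ ++ a' ∈ K →
    (∀ Y ∈ K, ∀ Z ∈ K, Y.flatMap φ = Z.flatMap φ) ∨
      (a = [] ∧ a' = [] ∧ ∀ Y ∈ K, Y.flatMap φ = Y)

/-- The cancellation property of an element of the lattice. -/
def Cancellable (c : FICon) : Prop :=
  ∀ b d : FICon, c ⊔ b = c ⊔ d → c ⊓ b = c ⊓ d → b = d

theorem Cancellable.rel_of_rigid {c : FICon} (hc : Cancellable c) {K : Set (List ℕ)}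
    (hK : Rigid K) {p q r : List ℕ} (hp : p ∈ K) (hq : q ∈ K) (hr : r ∈ K) (hpq : p ≠ q)
    (h : WRel c p q) : WRel c p r := by
  classical
  by_contra hpr
  have hrp : r ≠ p := by rintro rfl; exact hpr (WRel.refl _ _)
  have hrq : r ≠ q := by rintro rfl; exact hpr h
  have hqr : ¬ WRel c q r := fun h' => hpr (h.trans h')
  let lab (i j k : ℕ) (w : List ℕ) : ℕ :=
    if w = p then i else if w = q then j else if w = r then k else 0
  have rel_lab : ∀ i j k (Y Z : List ℕ), Y ∈ ({p, q, r} : Set (List ℕ)) →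
      Z ∈ ({p, q, r} : Set (List ℕ)) → lab i j k Y = lab i j k Z →
      WRel (syn (lab i j k)) Y Z := by
    intro i j k Y Z hY hZ hYZ
    have hsub : ({p, q, r} : Set (List ℕ)) ⊆ K := by
      rintro w (rfl | rfl | rfl) <;> assumption
    refine rel_syn_of fun φ a a' => ?_
    by_cases h₁ : a ++ Y.flatMap φ ++ a' ∈ ({p, q, r} : Set (List ℕ))
    · rcases hK Y (hsub hY) φ a a' (hsub h₁) with h₂ | ⟨rfl, rfl, h₂⟩
      · rw [h₂ Y (hsub hY) Z (hsub hZ)]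
      · simpa [h₂ Y (hsub hY), h₂ Z (hsub hZ)] using hYZ
    by_cases h₃ : a ++ Z.flatMap φ ++ a' ∈ ({p, q, r} : Set (List ℕ))
    · rcases hK Z (hsub hZ) φ a a' (hsub h₃) with h₂ | ⟨rfl, rfl, h₂⟩
      · rw [h₂ Y (hsub hY) Z (hsub hZ)]
      · simpa [h₂ Y (hsub hY), h₂ Z (hsub hZ)] using hYZ
    · simp only [Set.mem_insert_iff, Set.mem_singleton_iff, not_or] at h₁ h₃
      simp only [lab, h₁, h₃, if_false]
  let e := syn (lab 1 2 3)
  let pr (u v : List ℕ) : FICon := fic {(FreeMonoid.ofList u, FreeMonoid.ofList v)}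
  let b := e ⊔ pr q r
  let d := e ⊔ pr p r
  have hb : b ≤ syn (lab 1 2 2) := by
    refine sup_le (le_syn fun u v huv => ?_) (fic_singleton_le (rel_lab 1 2 2 q r ?_ ?_ ?_))
    · have := huv.label_eq le_rfl
      simp only [lab] at this ⊢
      grind
    · simp
    · simp
    · simp only [lab]; grind
  have hd : d ≤ syn (lab 1 2 1) := by
    refine sup_le (le_syn fun u v huv => ?_) (fic_singleton_le (rel_lab 1 2 1 p r ?_ ?_ ?_))
    · have := huv.label_eq le_rfl
      simp only [lab] at this ⊢
      grind
    · simp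
    · simp
    · simp only [lab]; grind
  have hcb : c ⊓ b ≤ e := by
    refine le_syn fun u v huv => ?_
    have h₁ : WRel c u v := le_iff_rel.1 inf_le_left u v huv
    have h₂ := (le_iff_rel.1 inf_le_right u v huv).label_eq hb
    have h₃ := h₁.symm
    simp only [lab] at h₂ ⊢
    grind
  have hcd : c ⊓ d ≤ e := by
    refine le_syn fun u v huv => ?_
    have h₁ : WRel c u v := le_iff_rel.1 inf_le_left u v huv
    have h₂ := (le_iff_rel.1 inf_le_right u v huv).label_eq hd
    have h₃ := h₁.symm
    simp only [lab] at h₂ ⊢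
    grind
  have hqrb : WRel b q r := le_iff_rel.1 le_sup_right q r (rel_fic_singleton q r)
  have hprd : WRel d p r := le_iff_rel.1 le_sup_right p r (rel_fic_singleton p r)
  have hbd : b = d := by
    apply hc
    · apply le_antisymm
      · refine sup_le le_sup_left (sup_le (le_sup_left.trans le_sup_right)
          (fic_singleton_le ?_))
        exact (le_iff_rel.1 le_sup_left _ _ h.symm).trans (le_iff_rel.1 le_sup_right _ _ hprd)
      · refine sup_le le_sup_left (sup_le (le_sup_left.trans le_sup_right)
          (fic_singleton_le ?_))
        exact (le_iff_rel.1 le_sup_left _ _ h).trans (le_iff_rel.1 le_sup_right _ _ hqrb)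
    · exact le_antisymm (le_inf inf_le_left (hcb.trans le_sup_left))
        (le_inf inf_le_left (hcd.trans le_sup_left))
  rw [hbd] at hqrb
  have := hqrb.label_eq hd
  simp only [lab] at this
  grind

/-! ### Substitution instances of words -/

theorem flatMap_eq_flatten_replicate {w : List ℕ} {φ : ℕ → List ℕ} {e : ℕ}
    (h : ∀ i ∈ w, i ≠ e → φ i = []) :
    w.flatMap φ = (List.replicate (w.count e) (φ e)).flatten := by
  induction w with
  | nil => simp
  | cons i w ih =>
    have ih' := ih fun j hj => h j (List.mem_cons_of_mem _ hj)
    by_cases hi : i = e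
    · subst hi
      simp [ih', List.replicate_succ]
    · simp [ih', h i List.mem_cons_self hi, hi]

theorem flatMap_eq_self {w : List ℕ} {φ : ℕ → List ℕ} (h : ∀ i ∈ w, φ i = [i]) :
    w.flatMap φ = w := by
  induction w with
  | nil => rfl
  | cons i w ih =>
    simp [h i List.mem_cons_self, ih fun j hj => h j (List.mem_cons_of_mem _ hj)]

theorem count_flatMap_eq (X : List ℕ) (φ : ℕ → List ℕ) (d l : ℕ) :
    (X.flatMap φ).count l =
      X.count d * (φ d).count l + ((X.filter (· ≠ d)).flatMap φ).count l := by
  induction X with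
  | nil => simp
  | cons i X ih =>
    by_cases hi : i = d
    · subst hi
      simp [ih]
      ring
    · simp [ih, hi]
      ring

theorem eq_singleton_of_count {l : List ℕ} {d : ℕ} (h : ∀ e ∈ l, e = d) (hl : l.count d = 1) :
    l = [d] := by
  have := List.eq_replicate_of_mem h
  rw [List.count_eq_length.2 fun b hb => (h b hb).symm] at hl
  rwa [hl] at this

theorem letter_fixed {X Y a a' : List ℕ} {φ : ℕ → List ℕ} {d : ℕ}
    (h : a ++ X.flatMap φ ++ a' = Y) (hXY : X.count d = Y.count d)
    (hlt : ∀ l ∈ Y, l ≠ d → Y.count l < Y.count d) (hpos : 0 < Y.count d) (hd : φ d ≠ []) :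
    φ d = [d] ∧ d ∉ a ∧ d ∉ a' ∧ ∀ e ∈ X, e ≠ d → d ∉ φ e := by
  have hcount : ∀ l, Y.count l = a.count l + (X.count d * (φ d).count l +
      ((X.filter (· ≠ d)).flatMap φ).count l) + a'.count l := by
    intro l
    rw [← count_flatMap_eq, ← h, List.count_append, List.count_append]
  have hmem : ∀ l ∈ φ d, l = d := by
    intro l hl
    by_contra hne
    have h₁ := hcount l
    have h₂ : 1 ≤ (φ d).count l := List.one_le_count_iff.2 hl
    have h₃ : l ∈ Y := by
      rw [← List.one_le_count_iff, h₁]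
      nlinarith
    have h₄ := hlt l h₃ hne
    nlinarith
  have h₁ := hcount d
  have h₂ : 1 ≤ (φ d).count d := by
    obtain ⟨l, hl⟩ := List.exists_mem_of_ne_nil _ hd
    rw [List.one_le_count_iff]
    exact hmem l hl ▸ hl
  have h₃ : (φ d).count d = 1 := by nlinarith
  rw [h₃, hXY] at h₁
  refine ⟨eq_singleton_of_count hmem h₃, ?_, ?_, ?_⟩
  · exact List.count_eq_zero.1 (by omega)
  · exact List.count_eq_zero.1 (by omega)
  · intro e he hed hde
    have h₄ : ((X.filter (· ≠ d)).flatMap φ).count d = 0 := by omega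
    rw [List.count_eq_zero] at h₄
    exact h₄ (List.mem_flatMap.2 ⟨e, by simp [he, hed], hde⟩)

theorem append_cons_inj_of_notMem {d : ℕ} : ∀ {l₁ l₂ r₁ r₂ : List ℕ}, d ∉ l₁ → d ∉ l₂ →
    l₁ ++ d :: r₁ = l₂ ++ d :: r₂ → l₁ = l₂ ∧ r₁ = r₂
  | [], [], _, _, _, _, h => by simpa using h
  | [], i :: l₂, _, _, _, h₂, h => by simp_all
  | i :: l₁, [], _, _, h₁, _, h => by simp_all
  | i :: l₁, j :: l₂, r₁, r₂, h₁, h₂, h => by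
    simp only [List.cons_append, List.cons.injEq] at h
    have := append_cons_inj_of_notMem (fun h' => h₁ (List.mem_cons_of_mem _ h'))
      (fun h' => h₂ (List.mem_cons_of_mem _ h')) h.2
    simp [h.1, this]

theorem prefix_eq_nil {a s s' : List ℕ} {d : ℕ} (h : a ++ d :: s = d :: s') (ha : d ∉ a) :
    a = [] :=
  (append_cons_inj_of_notMem (l₂ := []) ha (by simp) h).1

theorem suffix_eq_nil {a' s s' : List ℕ} {d : ℕ} (h : s ++ [d] ++ a' = s' ++ [d])
    (ha : d ∉ a') : a' = [] := by
  have h' := congrArg List.reverse h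
  simp only [List.reverse_append, List.reverse_singleton, List.singleton_append] at h'
  simpa using prefix_eq_nil h' (by simpa using ha)

theorem replicate_append_cons_inj {d c c' : ℕ} (hc : c ≠ d) (hc' : c' ≠ d) {u u' : List ℕ} :
    ∀ {i i' : ℕ}, List.replicate i d ++ c :: u = List.replicate i' d ++ c' :: u' →
      i = i' ∧ c = c' ∧ u = u'
  | 0, 0, h => by simpa using h
  | 0, i' + 1, h => by simp [List.replicate_succ, hc] at h
  | i + 1, 0, h => by simp [List.replicate_succ, hc'.symm] at h
  | i + 1, i' + 1, h => by
    simp only [List.replicate_succ, List.cons_append, List.cons.injEq, true_and] at h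
    simpa using replicate_append_cons_inj hc hc' h

theorem cons_sublist_of_replicate_append {c d : ℕ} (h : c ≠ d) {l r : List ℕ} :
    ∀ {i : ℕ}, List.Sublist (c :: l) (List.replicate i d ++ r) → List.Sublist (c :: l) r
  | 0, h' => by simpa using h'
  | i + 1, h' => by
    rw [List.replicate_succ, List.cons_append] at h'
    cases h' with
    | cons _ h' => exact cons_sublist_of_replicate_append h h'
    | cons_cons _ h' => exact absurd rfl h

theorem infix_of_infix_append_cons {d : ℕ} {l A B : List ℕ} (hd : d ∉ l)
    (h : l <:+: A ++ d :: B) : l <:+: A ∨ l <:+: B := by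
  obtain ⟨s, s', h⟩ := h
  rw [List.append_assoc, List.append_eq_append_iff] at h
  rcases h with ⟨e, rfl, h⟩ | ⟨e, rfl, h⟩
  · rw [List.append_eq_append_iff] at h
    rcases h with ⟨f, rfl, h⟩ | ⟨f, rfl, h⟩
    · exact Or.inl ⟨s, f, by simp⟩
    · cases f with
      | nil => exact Or.inl ⟨s, [], by simp⟩
      | cons i f => simp_all
  · cases e with
    | nil =>
      cases l with
      | nil => exact Or.inl (by simp)
      | cons i l => simp_all
    | cons i e =>
      simp only [List.cons_append, List.cons.injEq] at h
      exact Or.inr ⟨e, s', by simp [h.2]⟩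

/-! ### Words in two letters -/

/-- The words in the letters `0` and `1` with `n` and `m` occurrences respectively. -/
def binaryWords (n m : ℕ) : Set (List ℕ) :=
  {w | w.count 0 = n ∧ w.count 1 = m ∧ ∀ l ∈ w, l = 0 ∨ l = 1}

theorem rigid_binaryWords {n m : ℕ} (h : m < n) (hm : 0 < m) : Rigid (binaryWords n m) := by
  intro X hX φ a a' hY
  by_cases h0 : φ 0 = []
  · refine Or.inl fun Y hY Z hZ => ?_
    have key : ∀ W ∈ binaryWords n m, W.flatMap φ = (List.replicate m (φ 1)).flatten := by
      rintro W ⟨-, h1, h2⟩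
      rw [flatMap_eq_flatten_replicate (e := 1), h1]
      intro i hi hi1
      rcases h2 i hi with rfl | rfl
      · exact h0
      · exact absurd rfl hi1
    rw [key Y hY, key Z hZ]
  set Y := a ++ X.flatMap φ ++ a' with hYdef
  obtain ⟨hX0, hX1, hX2⟩ := hX
  obtain ⟨hY0, hY1, hY2⟩ := hY
  obtain ⟨hφ0, ha, ha', hφ⟩ := letter_fixed hYdef.symm (hX0.trans hY0.symm) (by
    intro l hl hl0
    rcases hY2 l hl with rfl | rfl <;> omega) (by omega) h0
  have h1X : 1 ∈ X := List.one_le_count_iff.1 (by omega)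
  have hφ1 : ∀ l ∈ φ 1, l = 1 := by
    intro l hl
    rcases hY2 l (by
      simp only [hYdef, List.mem_append, List.mem_flatMap]
      exact Or.inl (Or.inr ⟨1, h1X, hl⟩)) with rfl | rfl
    · exact absurd hl (hφ 1 h1X (by simp))
    · rfl
  have hc : Y.count 1 = a.count 1 + (X.count 1 * (φ 1).count 1 +
      ((X.filter (· ≠ 1)).flatMap φ).count 1) + a'.count 1 := by
    rw [← count_flatMap_eq, hYdef, List.count_append, List.count_append]
  rw [hX1, hY1] at hc
  by_cases h1 : φ 1 = []
  · refine Or.inl fun Y hY Z hZ => ?_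
    have key : ∀ W ∈ binaryWords n m, W.flatMap φ = (List.replicate n (φ 0)).flatten := by
      rintro W ⟨h0, -, h2⟩
      rw [flatMap_eq_flatten_replicate (e := 0), h0]
      intro i hi hi1
      rcases h2 i hi with rfl | rfl
      · exact absurd rfl hi1
      · exact h1
    rw [key Y hY, key Z hZ]
  have h2 : 1 ≤ (φ 1).count 1 := by
    obtain ⟨l, hl⟩ := List.exists_mem_of_ne_nil _ h1
    rw [List.one_le_count_iff]
    exact hφ1 l hl ▸ hl
  have h3 : (φ 1).count 1 = 1 := by nlinarith
  rw [h3] at hc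
  have hempty : ∀ b : List ℕ, 0 ∉ b → b.count 1 = 0 → (∀ l ∈ b, l ∈ Y) → b = [] := by
    intro b hb0 hb1 hb
    refine List.eq_nil_iff_forall_not_mem.2 fun l hl => ?_
    rcases hY2 l (hb l hl) with rfl | rfl
    · exact hb0 hl
    · exact List.count_eq_zero.1 hb1 hl
  refine Or.inr ⟨hempty a ha (by omega) fun l hl => by simp [hYdef, hl],
    hempty a' ha' (by omega) fun l hl => by simp [hYdef, hl], ?_⟩
  rintro W ⟨-, -, hW⟩
  refine flatMap_eq_self fun i hi => ?_
  rcases hW i hi with rfl | rfl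
  · exact hφ0
  · exact eq_singleton_of_count hφ1 h3

theorem Cancellable.rel_binaryWords {c : FICon} (hc : Cancellable c) {n m : ℕ} (h : m < n)
    (hm : 0 < m) {p q : List ℕ} (hp : p ∈ binaryWords n m) (hq : q ∈ binaryWords n m)
    (hpq : p ≠ q) (hr : WRel c p q) {u v : List ℕ} (hu : u ∈ binaryWords n m)
    (hv : v ∈ binaryWords n m) : WRel c u v :=
  (hc.rel_of_rigid (rigid_binaryWords h hm) hp hq hu hpq hr).symm.trans
    (hc.rel_of_rigid (rigid_binaryWords h hm) hp hq hv hpq hr)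

/-! ### A nontrivial identity yields powers commuting with all elements -/

/-- A word with an isolated linear letter and a block of letters `1`. -/
def blockWord (m i j k : ℕ) : List ℕ :=
  List.replicate i 0 ++ 3 :: (List.replicate j 0 ++ (List.replicate m 1 ++ List.replicate k 0))

theorem rigid_blockWord {n m : ℕ} (hm : 0 < m) (hmn : m < n) :
    Rigid {w | ∃ i j k, 0 < i ∧ 0 < j ∧ 0 < k ∧ i + j + k = n ∧ w = blockWord m i j k} := by
  rintro X ⟨i, j, k, hi, hj, hk, hn, rfl⟩ φ a a' ⟨i', j', k', hi', hj', hk', hn', hY⟩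
  have himage : ∀ i j k, (blockWord m i j k).flatMap φ = (List.replicate i (φ 0)).flatten ++
      (φ 3 ++ ((List.replicate j (φ 0)).flatten ++ ((List.replicate m (φ 1)).flatten ++
        (List.replicate k (φ 0)).flatten))) := by
    intro i j k
    simp [blockWord, List.flatMap_replicate]
  by_cases h0 : φ 0 = []
  · left
    rintro _ ⟨i, j, k, -, -, -, -, rfl⟩ _ ⟨i', j', k', -, -, -, -, rfl⟩
    simp [himage, h0]
  right
  obtain ⟨hφ0, ha, ha', hφ⟩ := letter_fixed hY (d := 0)
    (by simp [blockWord, List.count_replicate]; omega)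
    (by intro l hl hl0; simp [blockWord, List.count_replicate, List.count_cons] at hl ⊢; grind)
    (by simp [blockWord, List.count_replicate]; omega) h0
  have hφ3 : 0 ∉ φ 3 := hφ 3 (by simp [blockWord]) (by simp)
  have hφ1 : 0 ∉ φ 1 := hφ 1 (by simp [blockWord]; omega) (by simp)
  obtain ⟨i, rfl⟩ := Nat.exists_eq_succ_of_ne_zero hi.ne'
  obtain ⟨k, rfl⟩ := Nat.exists_eq_succ_of_ne_zero hk.ne'
  obtain ⟨j', rfl⟩ := Nat.exists_eq_succ_of_ne_zero hj'.ne'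
  have ha0 : a = [] := by
    obtain ⟨i', rfl⟩ := Nat.exists_eq_succ_of_ne_zero hi'.ne'
    simp only [himage, hφ0] at hY
    simp only [blockWord, List.replicate_succ, List.flatten_cons, List.append_assoc,
      List.cons_append, List.nil_append] at hY
    exact prefix_eq_nil hY ha
  have ha0' : a' = [] := by
    obtain ⟨k', rfl⟩ := Nat.exists_eq_succ_of_ne_zero hk'.ne'
    simp only [himage, hφ0] at hY
    simp only [blockWord, List.replicate_succ', List.flatten_append, List.flatten_singleton,
      ← List.append_assoc, ← List.cons_append] at hY
    exact suffix_eq_nil hY ha'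
  subst ha0 ha0'
  simp only [himage, hφ0, List.flatten_replicate_singleton, List.nil_append,
    List.append_nil] at hY
  rw [blockWord] at hY
  have hlen := congrArg List.length hY
  have hc3 := congrArg (List.count 3) hY
  simp [List.count_flatten, List.count_replicate] at hlen hc3
  have hφ13 : φ 3 = [3] ∧ φ 1 = [1] := by
    rcases h3 : φ 3 with _ | ⟨e, s⟩
    · rcases h1 : φ 1 with _ | ⟨e, s⟩
      · simp [h3, h1] at hlen
        omega
      obtain ⟨m, rfl⟩ := Nat.exists_eq_succ_of_ne_zero hm.ne'
      simp only [h3, h1, List.nil_append, List.replicate_succ (n := m), List.flatten_cons,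
        List.append_assoc, List.cons_append] at hY
      rw [← List.append_assoc, List.replicate_append_replicate] at hY
      have he : e ≠ 0 := by rintro rfl; simp [h1] at hφ1
      obtain ⟨-, rfl, h⟩ := replicate_append_cons_inj he (by simp) hY
      rcases s with _ | ⟨f, s⟩
      · simp [h3, h1] at hlen
        omega
      · rw [List.replicate_succ (n := j')] at h
        simp at h
        simp [h1, h.1] at hφ1
    · have he : e ≠ 0 := by rintro rfl; simp [h3] at hφ3
      simp only [h3, List.cons_append] at hY
      obtain ⟨-, rfl, h⟩ := replicate_append_cons_inj he (by simp) hY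
      rcases s with _ | ⟨f, s⟩
      · refine ⟨rfl, ?_⟩
        have h1 : (φ 1).length = 1 := by
          simp [h3] at hlen
          have : m * (φ 1).length = m := by omega
          exact (Nat.mul_eq_left hm.ne').1 this
        obtain ⟨e, h1⟩ := List.length_eq_one_iff.1 h1
        have he : e ∈ List.replicate (j' + 1) 0 ++ (List.replicate m 1 ++ List.replicate k' 0) := by
          rw [← h]
          simp [h1, hm.ne']
        have he0 : e ≠ 0 := by rintro rfl; simp [h1] at hφ1
        simp [he0] at he
        rw [h1, he.2]
      · rw [List.replicate_succ (n := j')] at h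
        simp at h
        simp [h3, h.1] at hφ3
  refine ⟨rfl, rfl, ?_⟩
  rintro _ ⟨i, j, k, -, -, -, -, rfl⟩
  refine flatMap_eq_self fun l hl => ?_
  simp [blockWord] at hl
  rcases hl with ⟨-, rfl⟩ | rfl | ⟨-, rfl⟩ | ⟨-, rfl⟩ | ⟨-, rfl⟩
  · exact hφ0
  · exact hφ13.1
  · exact hφ0
  · exact hφ13.2
  · exact hφ0

/-- The word with one letter `1` preceded by `i` and followed by `j` letters `0`. -/
def markWord (i j : ℕ) : List ℕ := List.replicate i 0 ++ 1 :: List.replicate j 0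

theorem markWord_mem {i j n : ℕ} (h : i + j = n) : markWord i j ∈ binaryWords n 1 := by
  refine ⟨by simpa [markWord, List.count_replicate] using h,
    by simp [markWord, List.count_replicate], ?_⟩
  simp only [markWord, List.mem_append, List.mem_replicate, List.mem_cons]
  tauto

theorem markWord_inj {i j i' j' : ℕ} (h : markWord i j = markWord i' j') : i = i' :=
  (replicate_append_cons_inj (by simp) (by simp) h).1

/-- In the variety corresponding to `c`, all `n`-th powers commute with everything, even
in the strong sense that the letters of such a power can be moved independently. -/
def CentralPow (c : FICon) (n : ℕ) : Prop :=
  ∀ u ∈ binaryWords n 1, ∀ v ∈ binaryWords n 1, WRel c u v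

theorem Cancellable.centralPow {c : FICon} (hc : Cancellable c) {i j i' j' n : ℕ} (hn : 2 ≤ n)
    (h : i + j = n) (h' : i' + j' = n) (hi : i ≠ i')
    (hr : WRel c (markWord i j) (markWord i' j')) : CentralPow c n := fun _ hu _ hv =>
  hc.rel_binaryWords (by omega) one_pos (markWord_mem h) (markWord_mem h')
    (fun he => hi (markWord_inj he)) hr hu hv

theorem Cancellable.centralPow_mono {c : FICon} (hc : Cancellable c) {n N : ℕ} (hn : 2 ≤ n)
    (hN : n ≤ N) (h : CentralPow c n) : CentralPow c N := by
  obtain ⟨k, rfl⟩ := Nat.exists_eq_add_of_le' hN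
  have h₁ := h _ (markWord_mem (i := 0) (j := n) (by omega)) _
    (markWord_mem (i := 1) (j := n - 1) (by omega))
  have h₂ := (WRel.refl c (List.replicate k 0)).append h₁
  refine hc.centralPow (i := k) (j := n) (i' := k + 1) (j' := n - 1) (by omega) (by omega)
    (by omega) (by omega) ?_
  simpa [markWord, ← List.replicate_append_replicate] using h₂

/-- The substitution encoding all letters by words in `0` and `1`. -/
def binaryCode (i : ℕ) : List ℕ := List.replicate (i + 1) 0 ++ [1]

theorem flatMap_binaryCode_inj : ∀ {u v : List ℕ},
    u.flatMap binaryCode = v.flatMap binaryCode → u = v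
  | [], [], _ => rfl
  | [], i :: v, h => by simp [binaryCode] at h
  | i :: u, [], h => by simp [binaryCode] at h
  | i :: u, j :: v, h => by
    simp only [List.flatMap_cons, binaryCode, List.append_assoc, List.singleton_append] at h
    obtain ⟨h₁, -, h₂⟩ := replicate_append_cons_inj (by simp) (by simp) h
    rw [Nat.succ_injective h₁, flatMap_binaryCode_inj h₂]

theorem count_one_flatMap_binaryCode (u : List ℕ) :
    (u.flatMap binaryCode).count 1 = u.length := by
  induction u with
  | nil => rfl
  | cons i u ih => simp [ih, binaryCode, List.count_replicate]

theorem Cancellable.exists_centralPow {c : FICon} (hc : Cancellable c) (hne : c ≠ ⊥) :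
    ∃ n, 2 ≤ n ∧ CentralPow c n := by
  by_contra! H
  have H' : ∀ {i j i' j' : ℕ}, 2 ≤ i + j → i + j = i' + j' →
      WRel c (markWord i j) (markWord i' j') → i = i' := by
    intro i j i' j' hn h hr
    by_contra hi
    exact H _ hn (hc.centralPow hn rfl h.symm hi hr)
  obtain ⟨u, v, huv, hne⟩ : ∃ u v, WRel c u v ∧ u ≠ v := by
    by_contra! h
    refine hne (le_bot_iff.1 (le_iff_rel.2 fun u v huv => ?_))
    rw [h u v huv]
    exact WRel.refl _ _
  have hcount : ∀ l, u.count l = v.count l := by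
    intro l
    have h := huv.flatMap fun i => if i = l then [0] else []
    rw [flatMap_eq_flatten_replicate (e := l) (by intro i _ hi; simp [hi]),
      flatMap_eq_flatten_replicate (e := l) (by intro i _ hi; simp [hi])] at h
    simp only [if_true, List.flatten_replicate_singleton] at h
    set i := u.count l
    set j := v.count l
    have h₁ := (h.append (WRel.refl c (1 :: List.replicate (j + 2) 0)))
    have h₂ := ((WRel.refl c (List.replicate j 0 ++ [1])).append h).append
      (WRel.refl c (List.replicate 2 0))
    refine H' (i := i) (j := j + 2) (i' := j) (j' := i + 2) (by omega) (by omega) ?_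
    refine WRel.trans (v := markWord j (j + 2)) h₁ ?_
    have h₃ := h₂.symm
    simpa [markWord, ← List.replicate_append_replicate] using h₃
  have hperm : u.Perm v := List.perm_iff_count.2 hcount
  have hu : u ≠ [] := by
    rintro rfl
    exact hne hperm.nil_eq
  have hletters : ∀ w : List ℕ, ∀ l ∈ w.flatMap binaryCode, l = 0 ∨ l = 1 := by
    intro w l hl
    simp only [binaryCode, List.mem_flatMap, List.mem_append, List.mem_replicate,
      List.mem_singleton] at hl
    tauto
  obtain ⟨m, hm⟩ : ∃ m, u.length = m := ⟨_, rfl⟩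
  have hm0 : 0 < m := hm ▸ List.length_pos_iff.2 hu
  have hmem : ∀ w : List ℕ, w.Perm u → List.replicate (m + 1) 0 ++ w.flatMap binaryCode ∈
      binaryWords (m + 1 + (u.flatMap binaryCode).count 0) m := by
    intro w hw
    refine ⟨?_, ?_, ?_⟩
    · rw [List.count_append, (hw.flatMap_right binaryCode).count_eq]
      simp
    · rw [List.count_append, count_one_flatMap_binaryCode, hw.length_eq, hm]
      simp [List.count_replicate]
    · intro l hl
      rcases List.mem_append.1 hl with hl | hl
      · exact Or.inl (List.eq_of_mem_replicate hl)
      · exact hletters w l hl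
  set n := m + 1 + (u.flatMap binaryCode).count 0
  have hfull : ∀ p ∈ binaryWords n m, ∀ q ∈ binaryWords n m, WRel c p q := by
    intro p hp q hq
    refine hc.rel_binaryWords (by omega) hm0 (hmem u (List.Perm.refl _)) (hmem v hperm.symm) ?_
      ((WRel.refl c _).append (huv.flatMap binaryCode)) hp hq
    simpa using fun h => hne (flatMap_binaryCode_inj h)
  have hn : 0 < n := by omega
  have hpq : WRel c (blockWord m 2 n 1) (blockWord m 2 (n - 1) 2) := by
    have h := hfull (List.replicate n 0 ++ List.replicate m 1)
      ⟨by simp [List.count_replicate], by simp [List.count_replicate], by simp; tauto⟩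
      (List.replicate (n - 1) 0 ++ (List.replicate m 1 ++ [0]))
      ⟨by simp [List.count_replicate]; omega, by simp [List.count_replicate], by simp; tauto⟩
    simpa [blockWord] using ((WRel.refl c [0, 0, 3]).append h).append (WRel.refl c [0])
  have hpr : WRel c (blockWord m 2 n 1) (blockWord m 1 (n + 1) 1) :=
    hc.rel_of_rigid (rigid_blockWord (n := n + 3) hm0 (by omega))
      ⟨2, n, 1, by omega, by omega, by omega, by omega, rfl⟩
      ⟨2, n - 1, 2, by omega, by omega, by omega, by omega, rfl⟩
      ⟨1, n + 1, 1, by omega, by omega, by omega, by omega, rfl⟩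
      (by
        intro h
        obtain ⟨k, rfl⟩ := Nat.exists_eq_succ_of_ne_zero hm0.ne'
        simp only [blockWord, List.append_cancel_left_eq, List.cons.injEq, true_and,
          List.replicate_succ (n := k), List.cons_append] at h
        have := (replicate_append_cons_inj (by simp) (by simp) h).1
        omega) hpq
  have h := hpr.flatMap fun i => if i = 0 then [0] else if i = 3 then [1] else []
  have h' : WRel c (markWord 2 (n + 1)) (markWord 1 (n + 2)) := by
    simpa [blockWord, markWord, List.flatMap_replicate, List.replicate_succ'] using h
  exact absurd (H' (by omega) (by omega) h') (by omega)

/-! ### Decreasing the exponent -/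

/-- Two blocks of letters `1` separated and surrounded by blocks of `k` letters `0`. -/
def twoBlocks (k i j : ℕ) : List ℕ :=
  List.replicate k 0 ++ (List.replicate i 1 ++ (List.replicate k 0 ++ (List.replicate j 1 ++
    List.replicate k 0)))

theorem count_zero_twoBlocks (k i j : ℕ) : (twoBlocks k i j).count 0 = 3 * k := by
  simp [twoBlocks, List.count_replicate]
  ring

theorem count_one_twoBlocks (k i j : ℕ) : (twoBlocks k i j).count 1 = i + j := by
  simp [twoBlocks, List.count_replicate]

theorem mem_twoBlocks {k i j l : ℕ} (h : l ∈ twoBlocks k i j) : l = 0 ∨ l = 1 := by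
  simp [twoBlocks] at h
  tauto

theorem flatMap_twoBlocks (k i j : ℕ) (φ : ℕ → List ℕ) :
    (twoBlocks k i j).flatMap φ = (List.replicate k (φ 0)).flatten ++
      ((List.replicate i (φ 1)).flatten ++ ((List.replicate k (φ 0)).flatten ++
        ((List.replicate j (φ 1)).flatten ++ (List.replicate k (φ 0)).flatten))) := by
  simp [twoBlocks, List.flatMap_replicate]

theorem infix_of_infix_append_replicate {d : ℕ} {l B : List ℕ} (hd : d ∉ l) :
    ∀ {i : ℕ}, l <:+: List.replicate i d ++ B → l <:+: B
  | 0, h => by simpa using h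
  | i + 1, h => by
    rcases infix_of_infix_append_cons (A := []) hd h with h | h
    · rw [List.infix_nil.1 h]
      simp
    · exact infix_of_infix_append_replicate hd h

theorem infix_of_infix_append_replicate_append {d : ℕ} {l A B : List ℕ} (hd : d ∉ l) {i : ℕ}
    (hi : 0 < i) (h : l <:+: A ++ (List.replicate i d ++ B)) : l <:+: A ∨ l <:+: B := by
  obtain ⟨i, rfl⟩ := Nat.exists_eq_succ_of_ne_zero hi.ne'
  exact (infix_of_infix_append_cons hd h).imp_right (infix_of_infix_append_replicate hd)

theorem not_replicate_zero_infix_twoBlocks {k i j m : ℕ} (hi : 0 < i) (hj : 0 < j) (hm : k < m) :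
    ¬ List.replicate m 0 <:+: twoBlocks k i j := by
  intro h
  have h0 : 1 ∉ List.replicate m 0 := by simp
  have key : ¬ List.replicate m 0 <:+: List.replicate k 0 := fun h => by
    have := h.length_le
    simp at this
    omega
  rcases infix_of_infix_append_replicate_append h0 hi h with h | h
  · exact key h
  rcases infix_of_infix_append_replicate_append h0 hj h with h | h <;> exact key h

theorem not_replicate_one_infix_twoBlocks {k i j m : ℕ} (hk : 0 < k) (hi : i < m) (hj : j < m) :
    ¬ List.replicate m 1 <:+: twoBlocks k i j := by
  intro h
  have h0 : 0 ∉ List.replicate m 1 := by simp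
  have key : ∀ i < m, ¬ List.replicate m 1 <:+: List.replicate i 1 := fun i hi h => by
    have := h.length_le
    simp at this
    omega
  have h := infix_of_infix_append_replicate h0 h
  rcases infix_of_infix_append_replicate_append h0 hk h with h | h
  · exact key i hi h
  rw [← List.append_nil (List.replicate k 0)] at h
  rcases infix_of_infix_append_replicate_append h0 hk h with h | h
  · exact key j hj h
  · exact key 0 (by omega) h

theorem not_alternating_sublist_twoBlocks (k i j : ℕ) :
    ¬ List.Sublist [1, 0, 1, 0, 1] (twoBlocks k i j) := by
  intro h
  have h₁ := cons_sublist_of_replicate_append (by simp)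
    (List.sublist_of_cons_sublist (cons_sublist_of_replicate_append (by simp) h))
  have h₂ := cons_sublist_of_replicate_append (by simp) (List.sublist_of_cons_sublist h₁)
  have h₃ := cons_sublist_of_replicate_append (by simp) (List.sublist_of_cons_sublist h₂)
  have h₄ := List.sublist_of_cons_sublist h₃
  simp at h₄

theorem not_power_infix_twoBlocks {k i j n : ℕ} (hk : 2 ≤ k) (hi : 0 < i) (hj : 0 < j)
    (hik : i ≤ k) (hjk : j ≤ k) (hij : i + j ≤ k + 2) (hn : k < n) {u : List ℕ} (hu : u ≠ []) :
    ¬ (List.replicate n u).flatten <:+: twoBlocks k i j := by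
  intro h
  have hletters : ∀ l ∈ u, l = 0 ∨ l = 1 := by
    intro l hl
    refine mem_twoBlocks (h.subset ?_)
    simp only [List.mem_flatten, List.mem_replicate]
    exact ⟨u, ⟨by omega, rfl⟩, hl⟩
  have hcount : n * u.count 1 ≤ i + j := by
    have := h.sublist.count_le 1
    rwa [count_one_twoBlocks, List.count_flatten, List.map_replicate, List.sum_replicate,
      smul_eq_mul] at this
  have hc1 : u.count 1 ≤ 1 := by nlinarith
  obtain ⟨m, rfl⟩ := Nat.exists_eq_add_of_lt hn
  by_cases h1 : 1 ∈ u
  · by_cases h0 : 0 ∈ u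
    · have h3 : List.Sublist (u ++ (u ++ u)) (twoBlocks k i j) := by
        refine List.Sublist.trans ?_ h.sublist
        obtain ⟨k, rfl⟩ := Nat.exists_eq_add_of_le hk
        have : 2 + k + m + 1 = k + m + 3 := by ring
        rw [this]
        simp [List.replicate_succ]
      obtain ⟨s, s', rfl⟩ := List.append_of_mem h1
      rcases List.mem_append.1 h0 with h0 | h0
      · have h5 : List.Sublist [0, 1] (s ++ 1 :: s') :=
          (List.singleton_sublist.2 h0).append (List.singleton_sublist.2 List.mem_cons_self)
        exact not_alternating_sublist_twoBlocks k i j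
          ((((List.singleton_sublist.2 h1).append (h5.append h5))).trans h3)
      · have h5 : List.Sublist [1, 0] (s ++ 1 :: s') := by
          refine List.Sublist.trans ?_ (List.sublist_append_right _ _)
          simpa using h0
        exact not_alternating_sublist_twoBlocks k i j
          ((h5.append (h5.append (List.singleton_sublist.2 h1))).trans h3)
    · have hu1 : u = List.replicate u.length 1 := List.eq_replicate_of_mem fun l hl =>
        (hletters l hl).resolve_left (by rintro rfl; exact h0 hl)
      have hlen : u.length = 1 := by
        have h4 : u.count 1 = u.length := List.count_eq_length.2 fun l hl =>
          ((hletters l hl).resolve_left (by rintro rfl; exact h0 hl)).symm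
        have := List.length_pos_iff.2 hu
        omega
      rw [hu1, hlen, List.replicate_one, List.flatten_replicate_singleton] at h
      exact not_replicate_one_infix_twoBlocks (by omega) (by omega) (by omega) h
  · have hu0 : u = List.replicate u.length 0 := List.eq_replicate_of_mem fun l hl =>
      (hletters l hl).resolve_right (by rintro rfl; exact h1 hl)
    have hlen := List.length_pos_iff.2 hu
    rw [hu0, List.flatten_replicate_replicate] at h
    exact not_replicate_zero_infix_twoBlocks hi hj (by nlinarith) h

theorem rigid_twoBlocks {k : ℕ} (hk : 2 ≤ k) :
    Rigid {w | ∃ i j, 0 < i ∧ 0 < j ∧ i ≤ k ∧ j ≤ k ∧ k + 1 ≤ i + j ∧ i + j ≤ k + 2 ∧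
      w = twoBlocks k i j} := by
  rintro X ⟨i, j, hi, hj, hik, hjk, hij, hij', rfl⟩ φ a a'
    ⟨i', j', hi', hj', hik', hjk', hij₁, hij₂, hY⟩
  by_cases h0 : φ 0 = []
  · left
    have hφ1 : φ 1 = [] := by
      by_contra h1
      refine not_power_infix_twoBlocks hk hi' hj' hik' hjk' hij₂ (n := i + j) (by omega) h1
        ⟨a, a', ?_⟩
      rw [← hY, flatMap_twoBlocks, h0]
      simp [← List.replicate_append_replicate]
    rintro _ ⟨i, j, -, -, -, -, -, -, rfl⟩ _ ⟨i', j', -, -, -, -, -, -, rfl⟩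
    simp [flatMap_twoBlocks, h0, hφ1]
  right
  obtain ⟨hφ0, ha, ha', hφ⟩ := letter_fixed hY (d := 0)
    (by rw [count_zero_twoBlocks, count_zero_twoBlocks])
    (by
      intro l hl hl0
      obtain rfl := (mem_twoBlocks hl).resolve_left hl0
      rw [count_zero_twoBlocks, count_one_twoBlocks]
      omega) (by rw [count_zero_twoBlocks]; omega) h0
  have hφ1 : 0 ∉ φ 1 := hφ 1 (by simp [twoBlocks]; omega) (by simp)
  obtain ⟨m, rfl⟩ := Nat.exists_eq_add_of_le' hk
  have ha0 : a = [] := by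
    rw [flatMap_twoBlocks, hφ0] at hY
    simp only [twoBlocks, List.replicate_succ, List.flatten_cons, List.append_assoc,
      List.cons_append, List.nil_append] at hY
    exact prefix_eq_nil hY ha
  have ha0' : a' = [] := by
    rw [flatMap_twoBlocks, hφ0] at hY
    simp only [twoBlocks, List.replicate_succ', List.flatten_append, List.flatten_singleton,
      ← List.append_assoc] at hY
    exact suffix_eq_nil hY ha'
  subst ha0 ha0'
  rw [List.nil_append, List.append_nil] at hY
  have hφ1' : ∀ l ∈ φ 1, l = 1 := by
    intro l hl
    refine (mem_twoBlocks (k := m + 2) (i := i') (j := j') (l := l) ?_).resolve_left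
      (by rintro rfl; exact hφ1 hl)
    rw [← hY, List.mem_flatMap]
    exact ⟨1, by simp [twoBlocks]; omega, hl⟩
  have hc := congrArg (List.count 1) hY
  rw [count_one_twoBlocks, flatMap_twoBlocks, hφ0] at hc
  simp [List.count_flatten, List.count_replicate, ← add_mul] at hc
  have hc1 : (φ 1).count 1 = 1 := by
    rcases Nat.lt_trichotomy ((φ 1).count 1) 1 with h | h | h
    · simp [Nat.lt_one_iff.1 h] at hc
      omega
    · exact h
    · nlinarith
  refine ⟨rfl, rfl, ?_⟩
  rintro _ ⟨i, j, -, -, -, -, -, -, rfl⟩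
  refine flatMap_eq_self fun l hl => ?_
  rcases mem_twoBlocks hl with rfl | rfl
  · exact hφ0
  · exact eq_singleton_of_count hφ1' hc1

theorem Cancellable.rel_pow_succ {c : FICon} (hc : Cancellable c) {k : ℕ} (hk : 2 ≤ k)
    (h : CentralPow c (3 * k)) :
    WRel c (List.replicate (k + 1) 0) (List.replicate (k + 2) 0) := by
  have hfull : ∀ p ∈ binaryWords (3 * k) (k + 1), ∀ q ∈ binaryWords (3 * k) (k + 1),
      WRel c p q := by
    intro p hp q hq
    have h₁ := (h _ (markWord_mem (i := 0) (j := 3 * k) (by omega)) _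
      (markWord_mem (i := 3 * k) (j := 0) (by omega))).flatMap
        fun i => if i = 0 then [0] else List.replicate (k + 1) 1
    simp [markWord, List.flatMap_replicate] at h₁
    refine hc.rel_binaryWords (by omega) (by omega) ?_ ?_ ?_ h₁ hp hq
    · exact ⟨by simp [List.count_replicate], by simp [List.count_replicate], by simp⟩
    · exact ⟨by simp [List.count_replicate], by simp [List.count_replicate], by simp; tauto⟩
    · obtain ⟨m, rfl⟩ := Nat.exists_eq_add_of_le' hk
      simp [List.replicate_succ, Nat.mul_add]
  have hmem : ∀ i j, i + j = k + 1 → twoBlocks k i j ∈ binaryWords (3 * k) (k + 1) :=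
    fun i j hij => ⟨count_zero_twoBlocks k i j, by rw [count_one_twoBlocks, hij],
      fun _ => mem_twoBlocks⟩
  have hpr : WRel c (twoBlocks k k 1) (twoBlocks k 2 k) := by
    refine hc.rel_of_rigid (rigid_twoBlocks hk)
      ⟨k, 1, by omega, by omega, by omega, by omega, by omega, by omega, rfl⟩
      ⟨1, k, by omega, by omega, by omega, by omega, by omega, by omega, rfl⟩
      ⟨2, k, by omega, by omega, by omega, by omega, by omega, by omega, rfl⟩ ?_
      (hfull _ (hmem k 1 (by omega)) _ (hmem 1 k (by omega)))
    obtain ⟨m, rfl⟩ := Nat.exists_eq_add_of_le' hk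
    simp [twoBlocks, List.replicate_succ]
  have := hpr.flatMap fun i => if i = 1 then [0] else []
  simp [flatMap_twoBlocks] at this
  rwa [← List.replicate_succ', ← List.replicate_succ, ← List.replicate_succ] at this

theorem Cancellable.centralPow_of_rel_pow {c : FICon} (hc : Cancellable c) {k : ℕ} (hk : 2 ≤ k)
    (h : WRel c (List.replicate k 0) (List.replicate (k + 1) 0)) : CentralPow c k := by
  have h₁ : CentralPow c (2 * k + 1) := by
    refine hc.centralPow (i := k) (j := k + 1) (i' := k + 1) (j' := k) (by omega) (by omega)
      (by omega) (by omega) ?_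
    have h₂ := (WRel.refl c (List.replicate (k + 1) 0 ++ [1])).append h.symm
    rw [List.append_assoc, List.append_assoc] at h₂
    exact (h.append (WRel.refl c (1 :: List.replicate (k + 1) 0))).trans h₂
  have h₂ : ∀ m, WRel c (List.replicate k 0) (List.replicate (k + m) 0) := by
    intro m
    induction m with
    | zero => exact WRel.refl _ _
    | succ m ih =>
      refine h.trans ?_
      have := ih.append (WRel.refl c [0])
      simpa [← List.replicate_succ', add_assoc] using this
  have h₃ := h₂ (k + 1)
  have h₄ : k + (k + 1) = 2 * k + 1 := by ring
  rw [h₄] at h₃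
  have h₅ := h₁ _ (markWord_mem (i := 0) (j := 2 * k + 1) (by omega)) _
      (markWord_mem (i := 2 * k + 1) (j := 0) (by omega))
  refine hc.centralPow (i := 0) (j := k) (i' := k) (j' := 0) hk (by omega) (by omega) (by omega) ?_
  exact ((WRel.refl c [1]).append h₃).trans (h₅.trans (h₃.symm.append (WRel.refl c [1])))

theorem Cancellable.rel_cube {c : FICon} (hc : Cancellable c) (hne : c ≠ ⊥) :
    WRel c (List.replicate 3 0) (List.replicate 4 0) := by
  obtain ⟨n, hn, h⟩ := hc.exists_centralPow hne
  have key : ∀ m, WRel c (List.replicate (n + 3) 0) (List.replicate (n + 4) 0) →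
      m ≤ n → WRel c (List.replicate (n - m + 3) 0) (List.replicate (n - m + 4) 0) := by
    intro m h₀ hm
    induction m with
    | zero => exact h₀
    | succ m ih =>
      have h₁ := hc.centralPow_of_rel_pow (by omega) (ih (by omega))
      have h₂ : CentralPow c (3 * (n - (m + 1) + 2)) :=
        hc.centralPow_mono (by omega) (by omega) h₁
      exact hc.rel_pow_succ (by omega) h₂
  have h₁ := key n (hc.rel_pow_succ (k := n + 2) (by omega)
    (hc.centralPow_mono hn (by omega) h)) le_rfl
  simpa using h₁

/-! ### The square of every element is central -/

theorem letter_fixed_of_ends {X Y a a' : List ℕ} {φ : ℕ → List ℕ} {d : ℕ}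
    (h : a ++ X.flatMap φ ++ a' = Y) (hXY : X.count d = Y.count d)
    (hlt : ∀ l ∈ Y, l ≠ d → Y.count l < Y.count d) (hd : φ d ≠ [])
    (hX : X.head? = some d) (hX' : X.getLast? = some d) (hY : Y.head? = some d)
    (hY' : Y.getLast? = some d) :
    φ d = [d] ∧ a = [] ∧ a' = [] ∧ (∀ e ∈ X, e ≠ d → d ∉ φ e) ∧ X.flatMap φ = Y := by
  obtain ⟨s, rfl⟩ := List.head?_eq_some_iff.1 hX
  obtain ⟨s', hs⟩ := List.getLast?_eq_some_iff.1 hX'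
  obtain ⟨r, rfl⟩ := List.head?_eq_some_iff.1 hY
  obtain ⟨r', hr⟩ := List.getLast?_eq_some_iff.1 hY'
  obtain ⟨h₁, h₂, h₃, h₄⟩ := letter_fixed h hXY hlt (by simp) hd
  have ha : a = [] := by
    simp only [List.flatMap_cons, h₁, List.append_assoc, List.cons_append,
      List.nil_append] at h
    exact prefix_eq_nil h h₂
  have ha' : a' = [] := by
    rw [hs, hr, List.flatMap_append, List.flatMap_singleton, h₁, ← List.append_assoc] at h
    exact suffix_eq_nil h h₃
  subst ha ha'
  exact ⟨h₁, rfl, rfl, h₄, by simpa using h⟩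

theorem rigid_tripleWords :
    Rigid {[0, 2, 1, 0, 1, 2, 0], [0, 2, 1, 1, 2, 0, 0], [0, 0, 2, 1, 1, 2, 0]} := by
  intro X hX φ a a' hY
  by_cases h0 : φ 0 = []
  · left
    rintro _ (rfl | rfl | rfl) _ (rfl | rfl | rfl) <;> simp [h0]
  right
  generalize hY' : a ++ X.flatMap φ ++ a' = Y at hY
  have hall : φ 0 = [0] ∧ a = [] ∧ a' = [] ∧ (∀ e ∈ X, e ≠ 0 → 0 ∉ φ e) ∧ X.flatMap φ = Y := by
    refine letter_fixed_of_ends hY' ?_ ?_ h0 ?_ ?_ ?_ ?_ <;>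
    rcases hX with rfl | rfl | rfl <;> rcases hY with rfl | rfl | rfl <;> decide
  obtain ⟨hφ0, rfl, rfl, hφ, hXY⟩ := hall
  have h₁ : 0 ∉ φ 1 := hφ 1 (by rcases hX with rfl | rfl | rfl <;> simp) (by simp)
  have h₂ : 0 ∉ φ 2 := hφ 2 (by rcases hX with rfl | rfl | rfl <;> simp) (by simp)
  have hφ12 : φ 1 = [1] ∧ φ 2 = [2] := by
    have hlen := congrArg List.length hXY
    have hcases : ((φ 1).length = 0 ∧ (φ 2).length = 2) ∨
        ((φ 1).length = 1 ∧ (φ 2).length = 1) ∨ ((φ 1).length = 2 ∧ (φ 2).length = 0) := by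
      rcases hX with rfl | rfl | rfl <;> rcases hY with rfl | rfl | rfl <;>
        simp [hφ0] at hlen <;> omega
    simp only [List.length_eq_zero_iff, List.length_eq_one_iff, List.length_eq_two] at hcases
    rcases hcases with ⟨h3, e, f, h4⟩ | ⟨⟨e, h3⟩, f, h4⟩ | ⟨⟨e, f, h3⟩, h4⟩ <;>
    rcases hX with rfl | rfl | rfl <;> rcases hY with rfl | rfl | rfl <;>
    simp [hφ0, h3, h4] at hXY h₁ h₂ ⊢ <;> omega
  refine ⟨rfl, rfl, ?_⟩
  rintro _ (rfl | rfl | rfl) <;> simp [hφ0, hφ12]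

theorem exists_square_of_isInfix {u Y : List ℕ} (hu : u ≠ []) (h : u ++ u <:+: Y) :
    ∃ i < Y.length, ∃ j < Y.length, 0 < j ∧ i + 2 * j ≤ Y.length ∧
      (Y.drop i).take j = (Y.drop (i + j)).take j := by
  obtain ⟨s, s', rfl⟩ := h
  have := List.length_pos_iff.2 hu
  refine ⟨s.length, by simp; omega, u.length, by simp; omega, this, by simp; omega, ?_⟩
  have h : s.length + u.length = (s ++ u).length := by simp
  rw [h]
  conv_rhs => rw [← List.append_assoc, List.append_assoc _ u s', List.drop_left, List.take_left]
  rw [List.append_assoc, List.drop_left, List.append_assoc, List.take_left]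

/-- Four words surrounded by single letters `0`. -/
def fourBlocks (b₁ b₂ b₃ b₄ : List ℕ) : List ℕ :=
  0 :: (b₁ ++ 0 :: (b₂ ++ 0 :: (b₃ ++ 0 :: (b₄ ++ [0]))))

theorem fourBlocks_inj {b₁ b₂ b₃ b₄ d₁ d₂ d₃ d₄ : List ℕ} (h₁ : 0 ∉ b₁) (h₂ : 0 ∉ b₂)
    (h₃ : 0 ∉ b₃) (k₁ : 0 ∉ d₁) (k₂ : 0 ∉ d₂) (k₃ : 0 ∉ d₃)
    (h : fourBlocks b₁ b₂ b₃ b₄ = fourBlocks d₁ d₂ d₃ d₄) :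
    b₁ = d₁ ∧ b₂ = d₂ ∧ b₃ = d₃ ∧ b₄ = d₄ := by
  obtain ⟨e₁, h⟩ := append_cons_inj_of_notMem h₁ k₁ (List.cons_injective h)
  obtain ⟨e₂, h⟩ := append_cons_inj_of_notMem h₂ k₂ h
  obtain ⟨e₃, h⟩ := append_cons_inj_of_notMem h₃ k₃ h
  exact ⟨e₁, e₂, e₃, List.append_cancel_right h⟩

theorem flatMap_fourBlocks (b₁ b₂ b₃ b₄ : List ℕ) {φ : ℕ → List ℕ} (h : φ 0 = [0]) :
    (fourBlocks b₁ b₂ b₃ b₄).flatMap φ =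
      fourBlocks (b₁.flatMap φ) (b₂.flatMap φ) (b₃.flatMap φ) (b₄.flatMap φ) := by
  simp [fourBlocks, h]

theorem rigid_fourBlocks :
    Rigid {fourBlocks [2, 1] [1, 2] [3] [4, 3], fourBlocks [2, 1] [1, 2] [3, 4] [3],
      fourBlocks [2, 1] [1, 2] [1, 3] [4, 3]} := by
  intro X hX φ a a' hY
  generalize hY' : a ++ X.flatMap φ ++ a' = Y at hY
  by_cases h0 : φ 0 = []
  · left
    have hsq : ∀ u : List ℕ, u ++ u <:+: Y → u = [] := by
      intro u h
      by_contra hu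
      have := exists_square_of_isInfix hu h
      revert this
      rcases hY with rfl | rfl | rfl <;> decide
    have h1 : φ 1 = [] := by
      apply hsq
      rw [← hY']
      rcases hX with rfl | rfl | rfl <;>
      exact ⟨a ++ φ 2, _, by simp [fourBlocks, h0]; rfl⟩
    have h2 : φ 2 = [] := by
      apply hsq
      rw [← hY']
      rcases hX with rfl | rfl | rfl <;>
      exact ⟨a, _, by simp [fourBlocks, h0, h1]; rfl⟩
    rintro _ (rfl | rfl | rfl) _ (rfl | rfl | rfl) <;> simp [fourBlocks, h0, h1, h2]
  right
  have hall : φ 0 = [0] ∧ a = [] ∧ a' = [] ∧ (∀ e ∈ X, e ≠ 0 → 0 ∉ φ e) ∧ X.flatMap φ = Y := by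
    refine letter_fixed_of_ends hY' ?_ ?_ h0 ?_ ?_ ?_ ?_ <;>
    rcases hX with rfl | rfl | rfl <;> rcases hY with rfl | rfl | rfl <;> decide
  obtain ⟨hφ0, rfl, rfl, hφ, hXY⟩ := hall
  have hφ' : ∀ b : List ℕ, (∀ i ∈ b, i ∈ [1, 2, 3, 4]) → 0 ∉ b.flatMap φ := by
    intro b hb h
    obtain ⟨i, hi, h⟩ := List.mem_flatMap.1 h
    have hi := hb i hi
    simp only [List.mem_cons, List.not_mem_nil, or_false] at hi
    refine hφ i ?_ (by omega) h
    rcases hX with rfl | rfl | rfl <;> rcases hi with rfl | rfl | rfl | rfl <;> decide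
  have hid : φ 1 = [1] ∧ φ 2 = [2] ∧ φ 3 = [3] ∧ φ 4 = [4] := by
    have key : ∀ b₃ b₄ d₃ d₄ : List ℕ, (∀ i ∈ b₃, i ∈ [1, 2, 3, 4]) → 0 ∉ d₃ →
        (fourBlocks [2, 1] [1, 2] b₃ b₄).flatMap φ = fourBlocks [2, 1] [1, 2] d₃ d₄ →
        φ 1 = [1] ∧ φ 2 = [2] ∧ b₃.flatMap φ = d₃ ∧ b₄.flatMap φ = d₄ := by
      intro b₃ b₄ d₃ d₄ hb hd h
      rw [flatMap_fourBlocks _ _ _ _ hφ0] at h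
      obtain ⟨h₁, h₂, h₃⟩ := fourBlocks_inj (hφ' _ (by simp)) (hφ' _ (by simp))
        (hφ' _ hb) (by simp) (by simp) hd h
      simp only [List.flatMap_cons, List.flatMap_nil, List.append_nil] at h₁ h₂
      rw [← and_assoc]
      refine ⟨?_, h₃⟩
      rcases h2 : φ 2 with _ | ⟨e, _ | ⟨f, s⟩⟩ <;> simp_all
    rcases hX with rfl | rfl | rfl <;> rcases hY with rfl | rfl | rfl <;>
    obtain ⟨h1, h2, h3, h4⟩ := key _ _ _ _ (by decide) (by decide) hXY <;>
    clear key hφ hXY hφ' <;>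
    rcases hφ4 : φ 4 with _ | ⟨e, _ | ⟨f, s⟩⟩ <;> simp_all
  refine ⟨rfl, rfl, ?_⟩
  rintro _ (rfl | rfl | rfl) <;> simp [fourBlocks, hφ0, hid]

theorem rel_conOf_pow {M : Type} [Monoid M] {i j : ℕ} :
    WRel (conOf M) (List.replicate i 0) (List.replicate j 0) ↔ ∀ a : M, a ^ i = a ^ j := by
  rw [rel_conOf]
  simp only [List.map_replicate, List.prod_replicate]
  exact ⟨fun h a => h fun _ => a, fun h g => h _⟩

theorem pow_mul_comm_of_centralPow {M : Type} [Monoid M] {n i j : ℕ}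
    (h : CentralPow (conOf M) n) (hij : i + j = n) (a b : M) : a ^ i * (b * a ^ j) = b * a ^ n := by
  have := rel_conOf.1 (h _ (markWord_mem hij) _ (markWord_mem (i := 0) (j := n) (by omega)))
    fun i => if i = 0 then a else b
  simpa [markWord] using this

theorem square_eq_cube_of_cancellable {M : Type} [Monoid M] (hc : Cancellable (conOf M))
    (hne : conOf M ≠ ⊥) (a : M) : a ^ 2 = a ^ 3 := by
  have hcube := hc.rel_cube hne
  have hcentral := hc.centralPow_of_rel_pow (k := 3) (by omega) hcube
  have h₃ : ∀ a : M, a ^ 3 = a ^ 4 := rel_conOf_pow.1 hcube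
  have hcomm : ∀ a b : M, a ^ 3 * b = b * a ^ 3 := fun a b => by
    simpa using pow_mul_comm_of_centralPow hcentral (i := 3) (j := 0) rfl a b
  have htriple : ∀ y z x : M, y * z * x * y * x * z * y = y ^ 3 * (z * x * x * z) := by
    have h₁ : WRel (conOf M) [0, 2, 1, 1, 2, 0, 0] [0, 0, 2, 1, 1, 2, 0] := by
      have := (hcentral _ (markWord_mem (i := 1) (j := 2) rfl) _
        (markWord_mem (i := 2) (j := 1) rfl)).flatMap fun i => if i = 0 then [0] else [2, 1, 1, 2]
      simpa [markWord, List.replicate_succ] using this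
    have h₂ := hc.rel_of_rigid rigid_tripleWords (r := [0, 2, 1, 0, 1, 2, 0]) (by simp) (by simp)
      (by simp) (by simp) h₁
    intro y z x
    have := rel_conOf.1 h₂ fun i => if i = 0 then y else if i = 1 then x else z
    simp at this
    have h₃ := pow_mul_comm_of_centralPow hcentral (i := 1) (j := 2) rfl y (z * x * x * z)
    rw [hcomm, ← h₃]
    simp only [mul_assoc, pow_two, pow_one]
    exact this.symm
  have hpq : WRel (conOf M) (fourBlocks [2, 1] [1, 2] [3] [4, 3])
      (fourBlocks [2, 1] [1, 2] [3, 4] [3]) := by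
    have habs : ∀ y u v : M, y ^ 3 * (u * (y * v)) = y ^ 3 * (u * v) := by
      intro y u v
      rw [← mul_assoc, hcomm, mul_assoc, ← mul_assoc (y ^ 3), ← pow_succ, ← h₃, ← mul_assoc,
        ← hcomm, mul_assoc]
    refine rel_conOf.2 fun g => ?_
    have key : ∀ w : M, g 0 * (g 2 * (g 1 * (g 0 * (g 1 * (g 2 * (g 0 * w)))))) =
        g 0 ^ 3 * (g 2 * g 1 * g 1 * g 2 * w) := by
      intro w
      rw [← mul_assoc (g 0 ^ 3), ← htriple]
      simp only [mul_assoc]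
    simp only [fourBlocks, List.cons_append, List.nil_append, List.map_cons, List.map_nil,
      List.prod_cons, List.prod_nil, mul_one, key]
    have h₁ := habs (g 0) (g 2 * g 1 * g 1 * g 2 * g 3) (g 4 * (g 3 * g 0))
    have h₂ := habs (g 0) (g 2 * g 1 * g 1 * g 2 * (g 3 * g 4)) (g 3 * g 0)
    simp only [mul_assoc] at h₁ h₂ ⊢
    rw [h₁, h₂]
  have hpr := hc.rel_of_rigid rigid_fourBlocks (r := fourBlocks [2, 1] [1, 2] [1, 3] [4, 3])
    (by simp) (by simp) (by simp) (by simp [fourBlocks]) hpq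
  have := rel_conOf.1 hpr fun i => if i = 1 then a else 1
  simp [fourBlocks] at this
  rw [pow_two, pow_succ, pow_two, mul_assoc]
  exact this

theorem identity_of_cancellable {M : Type} [Monoid M] (hc : Cancellable (conOf M))
    (hne : conOf M ≠ ⊥) (a b d : M) : a * a * a * b * d = b * a * d * a := by
  have hsq := square_eq_cube_of_cancellable hc hne
  have hcentral := hc.centralPow_of_rel_pow (k := 2) le_rfl (rel_conOf_pow.2 hsq)
  have h₁ := pow_mul_comm_of_centralPow hcentral (i := 1) (j := 1) rfl a d
  have h₂ : ∀ e : M, a ^ 2 * e = e * a ^ 2 := fun e => by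
    simpa using pow_mul_comm_of_centralPow hcentral (i := 2) (j := 0) rfl a e
  rw [pow_one] at h₁
  calc a * a * a * b * d = a ^ 3 * b * d := by rw [pow_succ, pow_two]
    _ = b * a * d * a := by
      rw [← hsq, mul_assoc, h₂, mul_assoc, ← h₁]
      simp only [mul_assoc]

/-! ### Words that are isoterms -/

/-- The largest fully invariant congruence in which all words of `S` form singleton classes. -/
def isoterms (S : List (List ℕ)) : FICon := syn fun w => S.idxOf w

theorem WRel.eq_of_isoterms {S : List (List ℕ)} {b : FICon} (hb : b ≤ isoterms S)
    {u v : List ℕ} (hu : u ∈ S) (h : WRel b u v) : u = v :=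
  (List.idxOf_inj hu).1 (h.label_eq hb)

theorem isoterms_anti {S T : List (List ℕ)} (h : T ⊆ S) : isoterms S ≤ isoterms T := by
  refine le_syn fun u v huv => ?_
  by_cases hu : u ∈ T
  · rw [huv.eq_of_isoterms le_rfl (h hu)]
  by_cases hv : v ∈ T
  · rw [huv.symm.eq_of_isoterms le_rfl (h hv)]
  · rw [List.idxOf_of_notMem hu, List.idxOf_of_notMem hv]

theorem exists_rel_of_not_le_isoterms {S : List (List ℕ)} {b : FICon} (h : ¬ b ≤ isoterms S) :
    ∃ u ∈ S, ∃ v, WRel b u v ∧ u ≠ v := by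
  by_contra! H
  refine h (le_syn fun u v huv => ?_)
  by_cases hu : u ∈ S
  · rw [H u hu v huv]
  by_cases hv : v ∈ S
  · rw [H v hv u huv.symm]
  · rw [List.idxOf_of_notMem hu, List.idxOf_of_notMem hv]

theorem WRel.mem_iff {b : FICon} (hb : b ≤ isoterms [[]]) {u v : List ℕ} (h : WRel b u v)
    (i : ℕ) : i ∈ u ↔ i ∈ v := by
  have key : ∀ {u v : List ℕ}, WRel b u v → i ∉ u → i ∉ v := by
    intro u v h hu
    have h' := h.flatMap fun j => if j = i then [0] else []
    have hnil : u.flatMap (fun j => if j = i then [0] else []) = [] := by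
      simp only [List.flatMap_eq_nil_iff]
      rintro j hj
      rw [if_neg]
      rintro rfl
      exact hu hj
    rw [hnil] at h'
    have h'' := (h'.eq_of_isoterms hb (by simp)).symm
    simp only [List.flatMap_eq_nil_iff] at h''
    intro hi
    simpa using h'' i hi
  exact ⟨fun hu => by_contra fun hv => key h.symm hv hu,
    fun hv => by_contra fun hu => key h hu hv⟩

theorem WRel.count_eq_one_iff {b : FICon} (hb : b ≤ isoterms [[], [0]]) {u v : List ℕ}
    (h : WRel b u v) (i : ℕ) : u.count i = 1 ↔ v.count i = 1 := by
  have key : ∀ {u v : List ℕ}, WRel b u v → u.count i = 1 → v.count i = 1 := by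
    intro u v h hu
    have h' := h.flatMap fun j => if j = i then [0] else []
    rw [flatMap_eq_flatten_replicate (e := i) (by intro i _ hi; simp [hi]),
      flatMap_eq_flatten_replicate (e := i) (by intro i _ hi; simp [hi])] at h'
    simp only [if_true, List.flatten_replicate_singleton, hu] at h'
    have h'' := congrArg List.length (h'.eq_of_isoterms hb (by simp))
    simpa using h''.symm
  exact ⟨key h, key h.symm⟩

theorem flatMap_ite_eq_map_filter {i j : ℕ} (w : List ℕ) :
    w.flatMap (fun l => if l = i then [0] else if l = j then [1] else []) =
      (w.filter fun l => l = i ∨ l = j).map fun l => if l = i then 0 else 1 := by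
  induction w with
  | nil => rfl
  | cons l w ih =>
    rw [List.flatMap_cons, ih]
    by_cases hi : l = i
    · simp [hi]
    · by_cases hj : l = j
      · subst hj; simp [hi]
      · simp [hi, hj]

theorem WRel.filter_eq {b : FICon} (hb : b ≤ isoterms [[], [0], [0, 1]]) {u v : List ℕ}
    (h : WRel b u v) {i j : ℕ} (hij : i ≠ j)
    (hu : u.filter (fun l => l = i ∨ l = j) = [i, j]) :
    v.filter (fun l => l = i ∨ l = j) = [i, j] := by
  have h' := h.flatMap fun l => if l = i then [0] else if l = j then [1] else []
  rw [flatMap_ite_eq_map_filter, flatMap_ite_eq_map_filter, hu] at h'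
  have h'' := h'.eq_of_isoterms hb (by simp [hij.symm])
  simp only [List.map_cons, List.map_nil, if_true, if_neg hij.symm] at h''
  obtain ⟨k, l, hkl⟩ : ∃ k l, v.filter (fun l => l = i ∨ l = j) = [k, l] := by
    rw [← List.length_eq_two]
    have := congrArg List.length h''
    simpa using this.symm
  have hk : k ∈ v.filter fun l => l = i ∨ l = j := by rw [hkl]; simp
  have hl : l ∈ v.filter fun l => l = i ∨ l = j := by rw [hkl]; simp
  simp only [List.mem_filter, decide_eq_true_eq] at hk hl
  simp only [hkl, List.map_cons, List.map_nil, List.cons.injEq, and_true] at h''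
  rw [hkl]
  grind

theorem WRel.of_perm {b : FICon} (h : WRel b [0, 1] [1, 0]) {u v : List ℕ} (huv : u.Perm v) :
    WRel b u v := by
  induction huv with
  | nil => exact WRel.refl _ _
  | cons i _ ih => exact (WRel.refl b [i]).append ih
  | swap i j l =>
    have := (h.flatMap fun k => if k = 0 then [j] else [i]).append (WRel.refl b l)
    simpa using this
  | trans _ _ ih₁ ih₂ => exact ih₁.trans ih₂

/-- The letters occurring exactly once, in their order of occurrence. -/
def linearPart (w : List ℕ) : List ℕ := w.filter fun i => w.count i = 1

theorem mem_linearPart {w : List ℕ} {i : ℕ} : i ∈ linearPart w ↔ w.count i = 1 := by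
  simp only [linearPart, List.mem_filter, decide_eq_true_eq, and_iff_right_iff_imp]
  intro h
  exact List.one_le_count_iff.1 h.ge

theorem nodup_linearPart (w : List ℕ) : (linearPart w).Nodup := by
  refine List.nodup_iff_count_le_one.2 fun i => ?_
  by_cases h : i ∈ linearPart w
  · exact (List.filter_sublist.count_le i).trans (mem_linearPart.1 h).le
  · simp [List.count_eq_zero.2 h]

theorem linearPart_perm {u v : List ℕ} (h : ∀ i, u.count i = 1 ↔ v.count i = 1) :
    (linearPart u).Perm (linearPart v) :=
  (List.perm_ext_iff_of_nodup (nodup_linearPart u) (nodup_linearPart v)).2 fun i => by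
    rw [mem_linearPart, mem_linearPart, h]

theorem filter_eq_of_sublist_linearPart {w : List ℕ} {i j : ℕ}
    (h : List.Sublist [i, j] (linearPart w)) :
    i ≠ j ∧ w.filter (fun l => l = i ∨ l = j) = [i, j] := by
  have hij : i ≠ j := by
    have := (nodup_linearPart w).sublist h
    simpa using this
  refine ⟨hij, ?_⟩
  have hi : w.count i = 1 := mem_linearPart.1 (h.subset (by simp))
  have hj : w.count j = 1 := mem_linearPart.1 (h.subset (by simp))
  have h₁ : List.Sublist [i, j] (w.filter fun l => l = i ∨ l = j) := by
    simpa using (h.trans List.filter_sublist).filter fun l => l = i ∨ l = j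
  refine (h₁.eq_of_length ?_).symm
  have h₂ : ∀ w : List ℕ, (w.filter fun l => l = i ∨ l = j).length = w.count i + w.count j := by
    intro w
    induction w with
    | nil => rfl
    | cons l w ih => simp only [List.filter_cons, List.count_cons]; grind
  rw [h₂, hi, hj]
  rfl

theorem linearPart_eq {u v : List ℕ} (h : WRel (isoterms [[], [0], [0, 1]]) u v) :
    linearPart u = linearPart v := by
  refine List.Perm.eq_of_pairwise
    (le := fun i j => i ≠ j ∧ u.filter (fun l => l = i ∨ l = j) = [i, j]) ?_ ?_ ?_
    (linearPart_perm (h.count_eq_one_iff (isoterms_anti (by simp))))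
  · rintro i j - - ⟨-, h₁⟩ ⟨-, h₂⟩
    simp only [or_comm (a := _ = j)] at h₂
    exact (by simpa using h₁.symm.trans h₂ : i = j ∧ j = i).1
  · exact List.pairwise_iff_forall_sublist.2 fun h => filter_eq_of_sublist_linearPart h
  · refine List.pairwise_iff_forall_sublist.2 fun h' => ?_
    obtain ⟨h₁, h₂⟩ := filter_eq_of_sublist_linearPart h'
    exact ⟨h₁, h.symm.filter_eq le_rfl h₁ h₂⟩

/-! ### Monoids satisfying the identity `x³yz ≈ yxzx` -/

/-- The identity `x³yz ≈ yxzx`. -/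
def CubeIdentity (M : Type) [Monoid M] : Prop :=
  ∀ a b d : M, a * a * a * b * d = b * a * d * a

namespace CubeIdentity

variable {M : Type} [Monoid M]

theorem cube (h : CubeIdentity M) (a : M) : a * a * a = a * a := by
  simpa using h a 1 1

theorem sq_comm (h : CubeIdentity M) (a b : M) : a * a * b = b * (a * a) := by
  simpa [h.cube, mul_assoc] using h a b 1

theorem conj (h : CubeIdentity M) (a b : M) : a * b * a = a * a * b := by
  simpa [h.cube] using (h a 1 b).symm

theorem pow_eq (h : CubeIdentity M) (a : M) {n : ℕ} (hn : 2 ≤ n) : a ^ n = a * a := by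
  induction n, hn using Nat.le_induction with
  | base => exact pow_two a
  | succ n _ ih => rw [pow_succ, ih, h.cube]

theorem sq_mul_prod (h : CubeIdentity M) (g : ℕ → M) (i : ℕ) (w : List ℕ) :
    g i * g i * (w.map g).prod = g i * g i * ((w.filter (· ≠ i)).map g).prod := by
  induction w with
  | nil => rfl
  | cons j w ih =>
    by_cases hj : j = i
    · subst hj
      simp only [List.map_cons, List.prod_cons, ← mul_assoc, h.cube, ih]
      simp
    · have : (j :: w).filter (· ≠ i) = j :: w.filter (· ≠ i) := by simp [hj]
      rw [this]
      simp only [List.map_cons, List.prod_cons]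
      rw [← mul_assoc, ← mul_assoc, h.sq_comm, mul_assoc, ih]
      simp only [mul_assoc]

theorem mul_prod_of_mem (h : CubeIdentity M) (g : ℕ → M) {i : ℕ} {w : List ℕ} (hi : i ∈ w) :
    g i * (w.map g).prod = g i * g i * (w.map g).prod := by
  obtain ⟨s, s', rfl⟩ := List.append_of_mem hi
  simp only [List.map_append, List.map_cons, List.prod_append, List.prod_cons]
  generalize (s.map g).prod = p
  generalize (s'.map g).prod = q
  calc g i * (p * (g i * q)) = g i * p * g i * q := by simp only [mul_assoc]
    _ = g i * g i * g i * p * q := by rw [h.conj, h.cube]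
    _ = g i * (g i * p * g i) * q := by rw [h.conj (g i) p]; simp only [mul_assoc]
    _ = _ := by simp only [mul_assoc]

theorem prod_eq_sq_mul (h : CubeIdentity M) (g : ℕ → M) {i : ℕ} {w : List ℕ}
    (hi : 2 ≤ w.count i) :
    (w.map g).prod = g i * g i * ((w.filter (· ≠ i)).map g).prod := by
  obtain ⟨s, s', hw, hs⟩ :=
    List.eq_append_cons_of_mem (List.one_le_count_iff.1 (le_trans one_le_two hi))
  subst hw
  have hs' : i ∈ s' := by
    rw [← List.one_le_count_iff]
    rw [List.count_append, List.count_cons_self, List.count_eq_zero.2 hs] at hi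
    omega
  have : (s ++ i :: s').filter (· ≠ i) = (s ++ s').filter (· ≠ i) := by simp
  rw [this, ← h.sq_mul_prod]
  simp only [List.map_append, List.map_cons, List.prod_append, List.prod_cons]
  rw [h.mul_prod_of_mem g hs', ← mul_assoc, ← h.sq_comm, mul_assoc]

theorem prod_eq_prod_sq_mul (h : CubeIdentity M) (g : ℕ → M) {w : List ℕ} :
    ∀ {l : List ℕ}, l.Nodup → (∀ i ∈ l, 2 ≤ w.count i) →
      (w.map g).prod =
        (l.map fun i => g i * g i).prod * ((w.filter (· ∉ l)).map g).prod
  | [], _, _ => by simp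
  | i :: l, hl, hw => by
    rw [List.nodup_cons] at hl
    have hi : 2 ≤ (w.filter (· ∉ l)).count i := by
      rw [List.count_filter (by simpa using hl.1)]
      exact hw i List.mem_cons_self
    have hf : (w.filter (· ∉ l)).filter (· ≠ i) = w.filter (· ∉ i :: l) := by
      rw [List.filter_filter]
      refine List.filter_congr fun j _ => ?_
      simp
    rw [h.prod_eq_prod_sq_mul g hl.2 fun j hj => hw j (List.mem_cons_of_mem _ hj),
      h.prod_eq_sq_mul g hi, hf, ← mul_assoc, ← h.sq_comm, List.map_cons, List.prod_cons]

theorem rel_of_linearPart (h : CubeIdentity M) {u v : List ℕ} (hm : ∀ i, i ∈ u ↔ i ∈ v)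
    (h₁ : ∀ i, u.count i = 1 ↔ v.count i = 1)
    (hl : WRel (conOf M) (linearPart u) (linearPart v)) : WRel (conOf M) u v := by
  have key : ∀ w : List ℕ, (∀ i, i ∈ u ↔ i ∈ w) → (∀ i, u.count i = 1 ↔ w.count i = 1) →
      ∀ g : ℕ → M, (w.map g).prod =
        ((u.dedup.filter fun i => 2 ≤ u.count i).map fun i => g i * g i).prod *
          ((linearPart w).map g).prod := by
    intro w hm h₁ g
    have hpos : ∀ i, 0 < u.count i ↔ 0 < w.count i := by
      intro i
      rw [List.count_pos_iff, List.count_pos_iff, hm]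
    have hf : linearPart w = w.filter (· ∉ u.dedup.filter fun i => 2 ≤ u.count i) := by
      refine List.filter_congr fun i hi => ?_
      have := (hm i).2 hi
      have h₂ := h₁ i
      have h₃ := hpos i
      have h₄ := List.count_pos_iff.2 hi
      simp only [List.mem_filter, List.mem_dedup, this, decide_eq_decide, decide_eq_true_eq,
        true_and]
      omega
    rw [hf]
    refine h.prod_eq_prod_sq_mul g ((List.nodup_dedup u).filter _) fun i hi => ?_
    simp only [List.mem_filter, decide_eq_true_eq] at hi
    have h₂ := h₁ i
    have h₃ := hpos i
    omega
  rw [rel_conOf] at hl ⊢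
  intro g
  rw [key u (fun _ => Iff.rfl) (fun _ => Iff.rfl), key v hm h₁, hl g]

theorem rel_of_two_le_count (h : CubeIdentity M) {u v : List ℕ} (hm : ∀ i, i ∈ u ↔ i ∈ v)
    (hu : ∀ i ∈ u, 2 ≤ u.count i) (hv : ∀ i ∈ v, 2 ≤ v.count i) : WRel (conOf M) u v := by
  have key : ∀ w : List ℕ, (∀ i ∈ w, 2 ≤ w.count i) → ∀ i, w.count i ≠ 1 := by
    intro w hw i hi
    have := hw i (List.one_le_count_iff.1 hi.ge)
    omega
  have hnil : ∀ w : List ℕ, (∀ i ∈ w, 2 ≤ w.count i) → linearPart w = [] := by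
    intro w hw
    exact List.eq_nil_iff_forall_not_mem.2 fun i hi => key w hw i (mem_linearPart.1 hi)
  refine h.rel_of_linearPart hm (fun i => iff_of_false (key u hu i) (key v hv i)) ?_
  rw [hnil u hu, hnil v hv]
  exact WRel.refl _ _

end CubeIdentity

namespace CubeIdentity

variable {M : Type} [Monoid M]

theorem rel_of_not_le_isoterms_nil (h : CubeIdentity M) (hc : ¬ conOf M ≤ isoterms [[]])
    (u v : List ℕ) : WRel (conOf M) u v := by
  obtain ⟨w, hw, w', hww, hne⟩ := exists_rel_of_not_le_isoterms hc
  rw [List.mem_singleton] at hw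
  subst hw
  have one : ∀ a : M, a = 1 := by
    intro a
    have h₁ : a ^ w'.length = 1 := by simpa using (rel_conOf.1 hww fun _ => a).symm
    obtain ⟨n, hn⟩ : ∃ n, w'.length = n + 1 :=
      Nat.exists_eq_succ_of_ne_zero (by simpa using hne.symm)
    rw [hn] at h₁
    have h₂ : a * a ^ n = 1 := by rw [← pow_succ', h₁]
    have h₃ : a ^ n * a = 1 := by rw [← pow_succ, h₁]
    have h₄ : a * a = a := by
      calc a * a = a * a * (a * a ^ n) := by rw [h₂, mul_one]
        _ = a * a * a * a ^ n := by simp only [mul_assoc]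
        _ = a * (a * a ^ n) := by rw [h.cube, mul_assoc]
        _ = a := by rw [h₂, mul_one]
    calc a = a * (a * a ^ n) := by rw [h₂, mul_one]
      _ = 1 := by rw [← mul_assoc, h₄, h₂]
  rw [rel_conOf]
  intro g
  rw [one (u.map g).prod, one (v.map g).prod]

theorem isoterms_nil_le (h : CubeIdentity M) (hc : conOf M ≤ isoterms [[]])
    (hc' : ¬ conOf M ≤ isoterms [[], [0]]) : isoterms [[]] ≤ conOf M := by
  obtain ⟨w, hw, w', hww, hne⟩ := exists_rel_of_not_le_isoterms hc'
  simp only [List.mem_cons, List.not_mem_nil, or_false] at hw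
  rcases hw with rfl | rfl
  · exact absurd (hww.eq_of_isoterms hc (by simp)) hne
  have idem : ∀ a : M, a * a = a := by
    intro a
    have hlen : 2 ≤ w'.length := by
      have h₀ := hww.mem_iff hc
      match w', h₀ with
      | [], h₀ => simpa using h₀ 0
      | [i], h₀ =>
        have hi : i = 0 := by simpa using (h₀ i).2 (by simp)
        exact absurd (by rw [hi]) hne
      | i :: j :: w', _ => simp
    have := rel_conOf.1 hww fun _ => a
    simp only [List.map_cons, List.map_nil, List.prod_cons, List.prod_nil, mul_one,
      List.map_const', List.prod_replicate, h.pow_eq a hlen] at this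
    exact this.symm
  have double : ∀ w : List ℕ, WRel (conOf M) w (w.flatMap fun i => [i, i]) := by
    intro w
    rw [rel_conOf]
    intro g
    induction w with
    | nil => rfl
    | cons i w ih =>
      simp only [List.flatMap_cons, List.map_append, List.map_cons, List.map_nil, List.prod_append,
        List.prod_cons, List.prod_nil, mul_one, idem, ih]
  rw [le_iff_rel]
  intro u v huv
  refine ((double u).trans ?_).trans (double v).symm
  have hm : ∀ (w : List ℕ) i, i ∈ w.flatMap (fun i => [i, i]) ↔ i ∈ w := by simp
  have hcount : ∀ w : List ℕ, ∀ i ∈ w.flatMap (fun i => [i, i]),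
      2 ≤ (w.flatMap fun i => [i, i]).count i := by
    intro w i hi
    rw [hm] at hi
    rw [count_flatMap_eq w _ i i]
    have := List.one_le_count_iff.2 hi
    simp
    omega
  refine h.rel_of_two_le_count (fun i => ?_) (hcount u) (hcount v)
  rw [hm, hm, huv.mem_iff le_rfl]

end CubeIdentity

theorem rel_swap_of_not_le_isoterms {b : FICon} (hb : b ≤ isoterms [[], [0]])
    (hb' : ¬ b ≤ isoterms [[], [0], [0, 1]]) : WRel b [0, 1] [1, 0] := by
  obtain ⟨w, hw, w', hww, hne⟩ := exists_rel_of_not_le_isoterms hb'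
  simp only [List.mem_cons, List.not_mem_nil, or_false] at hw
  rcases hw with rfl | rfl | rfl
  · exact absurd (hww.eq_of_isoterms hb (by simp)) hne
  · exact absurd (hww.eq_of_isoterms hb (by simp)) hne
  have hp : List.Perm [0, 1] w' := by
    rw [List.perm_iff_count]
    intro i
    have h₁ := hww.count_eq_one_iff hb i
    have h₂ := hww.mem_iff (hb.trans (isoterms_anti (by simp))) i
    have h₃ : [0, 1].count i ≤ 1 := List.nodup_iff_count_le_one.1 (by simp) i
    rw [← List.count_pos_iff, ← List.count_pos_iff] at h₂
    omega
  match w', hp.length_eq with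
  | [i, j], _ =>
    have h₀ : (0 : ℕ) ∈ [i, j] := hp.subset (by simp)
    have h₁ : (1 : ℕ) ∈ [i, j] := hp.subset (by simp)
    simp only [List.mem_cons, List.not_mem_nil, or_false] at h₀ h₁
    obtain ⟨rfl, rfl⟩ | ⟨rfl, rfl⟩ : (i = 0 ∧ j = 1) ∨ (i = 1 ∧ j = 0) := by omega
    · exact absurd rfl hne
    · exact hww

namespace CubeIdentity

variable {M : Type} [Monoid M]

theorem isoterms_singleton_le (h : CubeIdentity M) (hc : conOf M ≤ isoterms [[], [0]])
    (hc' : ¬ conOf M ≤ isoterms [[], [0], [0, 1]]) : isoterms [[], [0]] ≤ conOf M := by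
  rw [le_iff_rel]
  intro u v huv
  have h₁ := huv.count_eq_one_iff le_rfl
  exact h.rel_of_linearPart (huv.mem_iff (isoterms_anti (by simp))) h₁
    ((rel_swap_of_not_le_isoterms hc hc').of_perm (linearPart_perm h₁))

theorem isoterms_pair_le (h : CubeIdentity M) : isoterms [[], [0], [0, 1]] ≤ conOf M := by
  rw [le_iff_rel]
  intro u v huv
  refine h.rel_of_linearPart (huv.mem_iff (isoterms_anti (by simp)))
    (huv.count_eq_one_iff (isoterms_anti (by simp))) ?_
  rw [linearPart_eq huv]
  exact WRel.refl _ _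

end CubeIdentity

theorem exists_rel_nil_of_not_le_isoterms {b : FICon} (hb : ¬ b ≤ isoterms [[]]) :
    ∃ n, 0 < n ∧ ∀ k w, WRel b [] (List.replicate (k * n) w).flatten := by
  obtain ⟨w, hw, w', hww, hne⟩ := exists_rel_of_not_le_isoterms hb
  rw [List.mem_singleton] at hw
  subst hw
  refine ⟨w'.length, List.length_pos_iff.2 hne.symm, fun k w => ?_⟩
  induction k with
  | zero => simpa using WRel.refl b []
  | succ k ih =>
    have := ih.append (hww.flatMap fun _ => w)
    rwa [List.flatMap_def, List.flatMap_def, List.map_const', List.map_const',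
      ← List.flatten_append, List.replicate_append_replicate, ← Nat.succ_mul] at this

theorem exists_rel_replicate_of_not_le_isoterms {b : FICon} (hb : b ≤ isoterms [[]])
    (hb' : ¬ b ≤ isoterms [[], [0]]) :
    ∃ n, 0 < n ∧ ∀ k u, WRel b u (u.flatMap (List.replicate (1 + k * n))) := by
  obtain ⟨w, hw, w', hww, hne⟩ := exists_rel_of_not_le_isoterms hb'
  simp only [List.mem_cons, List.not_mem_nil, or_false] at hw
  rcases hw with rfl | rfl
  · exact absurd (hww.eq_of_isoterms hb (by simp)) hne
  have hw' : w' = List.replicate w'.length 0 := by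
    refine List.eq_replicate_of_mem fun i hi => ?_
    simpa using (hww.mem_iff hb i).2 hi
  obtain ⟨n, hn⟩ : ∃ n, w'.length = 1 + n := by
    refine Nat.exists_eq_add_of_le (List.length_pos_iff.2 ?_)
    rintro rfl
    simpa using hww.mem_iff hb 0
  rw [hn] at hw'
  subst hw'
  refine ⟨n, Nat.pos_of_ne_zero ?_, fun k u => ?_⟩
  · rintro rfl
    exact hne rfl
  have pow : ∀ k, WRel b [0] (List.replicate (1 + k * n) 0) := by
    intro k
    induction k with
    | zero => simpa using WRel.refl b [0]
    | succ k ih =>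
      refine hww.trans ?_
      have := ih.append (WRel.refl b (List.replicate n 0))
      rw [List.replicate_append_replicate] at this
      rwa [List.replicate_add, Nat.succ_mul, ← add_assoc]
  induction u with
  | nil => exact WRel.refl _ _
  | cons i u ih =>
    have := ((pow k).flatMap fun _ => [i]).append ih
    simpa [List.flatMap_replicate] using this

theorem two_le_count_flatMap_replicate {u : List ℕ} {n i : ℕ} (hn : 2 ≤ n)
    (hi : i ∈ u.flatMap (List.replicate n)) : 2 ≤ (u.flatMap (List.replicate n)).count i := by
  have hi' : i ∈ u := by
    simp only [List.mem_flatMap, List.mem_replicate] at hi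
    obtain ⟨j, hj, -, rfl⟩ := hi
    exact hj
  have := List.one_le_count_iff.2 hi'
  rw [count_flatMap_eq u _ i i, List.count_replicate_self]
  nlinarith

theorem perm_flatMap_replicate_count {S w : List ℕ} (hS : S.Nodup) (hw : ∀ i ∈ w, i ∈ S) :
    w.Perm (S.flatMap fun i => List.replicate (w.count i) i) := by
  rw [List.perm_iff_count]
  intro i
  have h₁ : ((S.filter (· ≠ i)).flatMap fun i => List.replicate (w.count i) i).count i = 0 := by
    rw [List.count_eq_zero]
    simp only [List.mem_flatMap, List.mem_filter, List.mem_replicate, decide_eq_true_eq]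
    rintro ⟨j, ⟨-, hj⟩, -, rfl⟩
    exact hj rfl
  rw [count_flatMap_eq S _ i i, h₁, List.count_replicate_self, add_zero]
  by_cases hi : i ∈ w
  · rw [List.count_eq_one_of_mem hS (hw i hi), one_mul]
  · rw [List.count_eq_zero.2 hi, mul_zero]

namespace CubeIdentity

variable {M : Type} [Monoid M]

theorem le_of_not_le_isoterms_nil (h : CubeIdentity M) {b d : FICon}
    (hbd : conOf M ⊓ b ≤ d) (hb : ¬ b ≤ isoterms [[]]) (hd : ¬ d ≤ isoterms [[]]) : b ≤ d := by
  obtain ⟨n, hn, hbn⟩ := exists_rel_nil_of_not_le_isoterms hb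
  obtain ⟨m, hm, hdm⟩ := exists_rel_nil_of_not_le_isoterms hd
  rw [le_iff_rel]
  intro u v huv
  have hbW := hbn (2 * m) (u ++ v)
  have hdW := hdm (2 * n) (u ++ v)
  rw [mul_right_comm] at hbW
  have hK : 2 ≤ 2 * n * m := by nlinarith [Nat.mul_pos hn hm]
  generalize 2 * n * m = K at *
  set W := (List.replicate K (u ++ v)).flatten with hW
  have hWc : WRel (conOf M) (u ++ W) (v ++ W) := by
    rw [rel_conOf]
    intro g
    have hWg : (W.map g).prod = (u.map g).prod * (u.map g).prod *
        ((v.map g).prod * (v.map g).prod) := by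
      rw [hW, List.map_flatten, List.prod_flatten]
      simp only [List.map_replicate, List.prod_replicate, List.map_append, List.prod_append]
      rw [h.pow_eq _ hK, ← mul_assoc, h.conj, mul_assoc]
    rw [List.map_append, List.map_append, List.prod_append, List.prod_append, hWg]
    generalize (u.map g).prod = p
    generalize (v.map g).prod = q
    calc p * (p * p * (q * q)) = p * p * p * (q * q) := by simp only [mul_assoc]
      _ = p * p * (q * q * q) := by rw [h.cube, h.cube]
      _ = p * p * q * (q * q) := by simp only [mul_assoc]
      _ = q * (p * p * (q * q)) := by rw [h.sq_comm]; simp only [mul_assoc]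
  have hWb : WRel b (u ++ W) (v ++ W) := huv.append (WRel.refl b W)
  have h₁ : WRel d (u ++ W) (v ++ W) := le_iff_rel.1 hbd _ _ (rel_inf hWc hWb)
  have h₂ : ∀ w, WRel d w (w ++ W) := fun w => by
    simpa using (WRel.refl d w).append hdW
  exact ((h₂ u).trans h₁).trans (h₂ v).symm

theorem le_of_le_isoterms_nil (h : CubeIdentity M) {b d : FICon} (hbd : conOf M ⊓ b ≤ d)
    (hb : b ≤ isoterms [[]]) (hb' : ¬ b ≤ isoterms [[], [0]]) (hd : d ≤ isoterms [[]])
    (hd' : ¬ d ≤ isoterms [[], [0]]) : b ≤ d := by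
  obtain ⟨n, hn, hbn⟩ := exists_rel_replicate_of_not_le_isoterms hb hb'
  obtain ⟨m, hm, hdm⟩ := exists_rel_replicate_of_not_le_isoterms hd hd'
  rw [le_iff_rel]
  intro u v huv
  have hK : 2 ≤ 1 + n * m := by nlinarith [Nat.mul_pos hn hm]
  replace hbn := hbn m
  replace hdm := hdm n
  rw [mul_comm] at hbn
  generalize 1 + n * m = K at *
  have h₁ : WRel b (u.flatMap (List.replicate K)) (v.flatMap (List.replicate K)) :=
    huv.flatMap _
  have h₂ : WRel (conOf M) (u.flatMap (List.replicate K)) (v.flatMap (List.replicate K)) :=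
    h.rel_of_two_le_count (h₁.mem_iff hb) (fun _ => two_le_count_flatMap_replicate hK)
      (fun _ => two_le_count_flatMap_replicate hK)
  exact ((hdm u).trans (le_iff_rel.1 hbd _ _ (rel_inf h₂ h₁))).trans (hdm v).symm

theorem le_of_le_isoterms_singleton (h : CubeIdentity M) {b d : FICon} (hbd : conOf M ⊓ b ≤ d)
    (hb : b ≤ isoterms [[], [0]]) (hb' : ¬ b ≤ isoterms [[], [0], [0, 1]])
    (hd : d ≤ isoterms [[], [0]]) (hd' : ¬ d ≤ isoterms [[], [0], [0, 1]]) : b ≤ d := by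
  have hbs := rel_swap_of_not_le_isoterms hb hb'
  have hds := rel_swap_of_not_le_isoterms hd hd'
  rw [le_iff_rel]
  intro u v huv
  have hm := huv.mem_iff (hb.trans (isoterms_anti (by simp)))
  have h₁ := huv.count_eq_one_iff hb
  have hu := perm_flatMap_replicate_count (S := u.dedup) (w := u) (List.nodup_dedup u) (by simp)
  have hv := perm_flatMap_replicate_count (S := u.dedup) (w := v) (List.nodup_dedup u)
    (by simp [hm])
  have hc : WRel (conOf M) (u.dedup.flatMap fun i => List.replicate (u.count i) i)
      (u.dedup.flatMap fun i => List.replicate (v.count i) i) := by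
    rw [rel_conOf]
    intro g
    have hpow : ∀ i, g i ^ u.count i = g i ^ v.count i := by
      intro i
      have h₂ := h₁ i
      have h₃ := hm i
      rw [← List.count_pos_iff, ← List.count_pos_iff] at h₃
      obtain h₄ | ⟨h₄, h₅⟩ : u.count i = v.count i ∨ 2 ≤ u.count i ∧ 2 ≤ v.count i := by omega
      · rw [h₄]
      · rw [h.pow_eq _ h₄, h.pow_eq _ h₅]
    induction u.dedup with
    | nil => rfl
    | cons i S ih =>
      simp only [List.flatMap_cons, List.map_append, List.prod_append, List.map_replicate,
        List.prod_replicate, ih, hpow]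
  have h₂ := le_iff_rel.1 hbd _ _
    (rel_inf hc (((hbs.of_perm hu).symm.trans huv).trans (hbs.of_perm hv)))
  exact ((hds.of_perm hu).trans h₂).trans (hds.of_perm hv).symm

theorem le_of_sup_eq_of_inf_eq (h : CubeIdentity M) {b d : FICon}
    (hs : conOf M ⊔ b = conOf M ⊔ d) (hi : conOf M ⊓ b = conOf M ⊓ d) : b ≤ d := by
  have hbd : conOf M ⊓ b ≤ d := hi.le.trans inf_le_right
  have hble : ∀ {e}, conOf M ≤ e → d ≤ e → b ≤ e := fun hc hd =>
    le_sup_right.trans (hs.le.trans (sup_le hc hd))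
  have hdle : ∀ {e}, conOf M ≤ e → b ≤ e → d ≤ e := fun hc hb =>
    le_sup_right.trans (hs.ge.trans (sup_le hc hb))
  by_cases hbc : b ≤ conOf M
  · exact (le_inf hbc le_rfl).trans hbd
  have hc : conOf M ≤ isoterms [[]] := by
    by_contra hc
    exact hbc (le_iff_rel.2 fun u v _ => h.rel_of_not_le_isoterms_nil hc u v)
  by_cases hb : b ≤ isoterms [[]]
  swap
  · exact h.le_of_not_le_isoterms_nil hbd hb fun hd => hb (hble hc hd)
  have hd := hdle hc hb
  have hc' : conOf M ≤ isoterms [[], [0]] := by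
    by_contra hc'
    exact hbc (hb.trans (h.isoterms_nil_le hc hc'))
  by_cases hb' : b ≤ isoterms [[], [0]]
  swap
  · exact h.le_of_le_isoterms_nil hbd hb hb' hd fun hd' => hb' (hble hc' hd')
  have hd' := hdle hc' hb'
  have hc'' : conOf M ≤ isoterms [[], [0], [0, 1]] := by
    by_contra hc''
    exact hbc (hb'.trans (h.isoterms_singleton_le hc' hc''))
  by_cases hb'' : b ≤ isoterms [[], [0], [0, 1]]
  · exact absurd (hb''.trans h.isoterms_pair_le) hbc
  · exact h.le_of_le_isoterms_singleton hbd hb' hb'' hd' fun hd'' => hb'' (hble hc'' hd'')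

theorem cancellable (h : CubeIdentity M) : Cancellable (conOf M) := fun _ _ hs hi =>
  le_antisymm (h.le_of_sup_eq_of_inf_eq hs hi) (h.le_of_sup_eq_of_inf_eq hs.symm hi.symm)

end CubeIdentity

/-- Let `M` be a monoid satisfying some nontrivial identity (`c_M ≠ ⊥`).
Then `c_M` is a cancellable element of the lattice of fully invariant
congruences on `F` if and only if `M` satisfies the identity
`x³yz ≈ yxzx`. -/
theorem conOf_cancellable_iff (M : Type) [Monoid M] (hM : conOf M ≠ ⊥) :
    (∀ b d : FICon, conOf M ⊔ b = conOf M ⊔ d → conOf M ⊓ b = conOf M ⊓ d → b = d) ↔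
      ∀ a b d : M, a * a * a * b * d = b * a * d * a := by
  exact ⟨fun hc => identity_of_cancellable hc hM, fun h => CubeIdentity.cancellable h⟩
end
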